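/- arXiv:math/0403370 — 2 statements merged into one kernel-verified Lean document; each statement's English description precedes it below -/
import Mathlib

section
/- There exist a regular local ring S of dimension 4 which is essentially of finite type over the complex numbers ℂ, and an ideal J ⊆ S, such that lim_{n→∞} λ(Ext^4_S(S/J^n, S))/n^4 exists and is an irrational number; in particular, λ(Ext^4_S(S/J^n, S)) is not a polynomial, nor a quasi-polynomial, in n for large n. -/
/-!
STATEMENT 7: There exist a regular local ring `S` of dimension 4 which is essentially of
finite type over the complex numbers `ℂ`, and an ideal `J ⊆ S`, such that
`lim_{n→∞} λ(Ext^4_S(S/Jⁿ, S))/n⁴` exists and is an irrational number; in particular,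
`λ(Ext^4_S(S/Jⁿ, S))` is not a polynomial, nor a quasi-polynomial, in `n` for large `n`.

Regularity of the (Noetherian) local ring `S` of dimension 4 is expressed by the maximal
ideal being generated by 4 elements; `λ` is the length over `S` (Krull dimension of the
lattice of submodules); a quasi-polynomial is a function given for large `n` by polynomials
depending periodically on `n`.
-/

open Filter

/-- The length of a module: the Krull dimension of its lattice of submodules. -/
noncomputable def moduleLength (R M : Type*) [Ring R] [AddCommGroup M] [Module R M] :
    WithBot ℕ∞ :=
  Order.krullDim (Submodule R M)

/-- `Ext^i_R(M, N)` as an object of `ModuleCat R`. -/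
noncomputable def extModule (R : Type) [CommRing R] (i : ℕ)
    (M N : ModuleCat R) : ModuleCat R :=
  ((Ext R (ModuleCat R) i).obj (Opposite.op M)).obj N

/-- The data of a regular local ring of dimension 4, essentially of finite type over `ℂ`,
together with an ideal `J`. -/
structure RegularLocal4Data where
  S : Type
  [commRing : CommRing S]
  [isLocal : IsLocalRing S]
  [noeth : IsNoetherianRing S]
  [alg : Algebra ℂ S]
  [essFin : Algebra.EssFiniteType ℂ S]
  dim4 : ringKrullDim S = 4
  regular : ∃ s : Finset S, s.card = 4 ∧
    Ideal.span (↑s : Set S) = IsLocalRing.maximalIdeal S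
  J : Ideal S

attribute [instance] RegularLocal4Data.commRing RegularLocal4Data.isLocal
  RegularLocal4Data.noeth RegularLocal4Data.alg RegularLocal4Data.essFin

namespace EpsIrr
section ExtCompare
open CategoryTheory Abelian

variable {R : Type} [CommRing R]

theorem ker_mem {X : ModuleCat.{0} R} (P : ProjectiveResolution X) (Y : ModuleCat.{0} R) (p : ℕ)
    (f : P.complex.X (p+1) ⟶ Y)
    (hf : f ∈ LinearMap.ker ((P.complex.linearYonedaObj R Y).sc' p (p+1) (p+2)).g.hom) :
    P.complex.d (p+2) (p+1) ≫ f = 0 := hf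

theorem extMk_smul_aux {X : ModuleCat.{0} R} (P : ProjectiveResolution X) (Y : ModuleCat.{0} R)
    (p : ℕ) (r : R) (f : P.complex.X (p+1) ⟶ Y) (hf : P.complex.d (p+2) (p+1) ≫ f = 0)
    (hf' : P.complex.d (p+2) (p+1) ≫ (r • f) = 0) :
    P.extMk (r • f) (p+2) rfl hf' = r • P.extMk f (p+2) rfl hf := by
  rw [Abelian.Ext.smul_eq_comp_mk₀, P.extMk_comp_mk₀]
  congr 1

noncomputable def extPhi {X : ModuleCat.{0} R} (P : ProjectiveResolution X)
    (Y : ModuleCat.{0} R) (p : ℕ) :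
    LinearMap.ker ((P.complex.linearYonedaObj R Y).sc' p (p+1) (p+2)).g.hom →ₗ[R]
      Abelian.Ext X Y (p+1) where
  toFun f := P.extMk (n := p+1) f.1 (p+2) rfl (ker_mem P Y p f.1 f.2)
  map_add' f g := (P.add_extMk (n := p+1) f.1 g.1 (p+2) rfl (ker_mem P Y p f.1 f.2)
    (ker_mem P Y p g.1 g.2)).symm
  map_smul' r f := extMk_smul_aux P Y p r f.1 (ker_mem P Y p f.1 f.2)
    (ker_mem P Y p _ (r • f).2)

theorem extPhi_surj {X : ModuleCat.{0} R} (P : ProjectiveResolution X)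
    (Y : ModuleCat.{0} R) (p : ℕ) : Function.Surjective (extPhi P Y p) := by
  intro a
  obtain ⟨f, hf, h⟩ := P.extMk_surjective a (p+2) rfl
  exact ⟨⟨f, hf⟩, h⟩

theorem extPhi_ker {X : ModuleCat.{0} R} (P : ProjectiveResolution X)
    (Y : ModuleCat.{0} R) (p : ℕ) : LinearMap.ker (extPhi P Y p) =
      LinearMap.range ((P.complex.linearYonedaObj R Y).sc' p (p+1) (p+2)).moduleCatToCycles := by
  ext f
  rw [LinearMap.mem_ker]
  refine (P.extMk_eq_zero_iff (n := p+1) f.1 (p+2) rfl (ker_mem P Y p f.1 f.2) p rfl).trans ?_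
  constructor
  · rintro ⟨g, hg⟩
    exact ⟨g, Subtype.ext hg⟩
  · rintro ⟨g, hg⟩
    exact ⟨g, congrArg Subtype.val hg⟩

theorem ext_equiv (X Y : ModuleCat.{0} R) (p : ℕ) :
    Nonempty (extModule R (p+1) X Y ≃ₗ[R] Abelian.Ext X Y (p+1)) := by
  obtain ⟨P⟩ := (inferInstance : HasProjectiveResolution X).out
  let K := P.complex.linearYonedaObj R Y
  let e1 := (P.isoExt (R := R) (p+1) Y).toLinearEquiv
  let e2 := (K.homologyIsoSc' p (p+1) (p+2) (by simp) (by simp)).toLinearEquiv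
  let e3 := (K.sc' p (p+1) (p+2)).moduleCatHomologyIso.toLinearEquiv
  let e4 := Submodule.quotEquivOfEq _ _ (extPhi_ker P Y p)
  let e5 := (extPhi P Y p).quotKerEquivOfSurjective (extPhi_surj P Y p)
  exact ⟨e1.trans (e2.trans (e3.trans (e4.symm.trans e5)))⟩

theorem moduleLength_eq {M : Type*} [AddCommGroup M] [Module R M] :
    moduleLength R M = (Module.length R M : WithBot ℕ∞) := (Module.coe_length R M).symm

theorem moduleLength_ext (X Y : ModuleCat.{0} R) (p : ℕ) :
    moduleLength R (extModule R (p+1) X Y) = (Module.length R (Abelian.Ext X Y (p+1)) : WithBot ℕ∞) := by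
  rw [moduleLength_eq, (ext_equiv X Y p).some.length_eq]

end ExtCompare
end EpsIrr

namespace EpsIrr
section LES
open CategoryTheory Abelian

variable (R : Type) [CommRing R]

/-- `Ext^i_R(M, R)`. -/
abbrev EE (M : Type) [AddCommGroup M] [Module R M] (i : ℕ) : Type :=
  Abelian.Ext (ModuleCat.of R M) (ModuleCat.of R R) i

variable {R}
variable {A B C : Type} [AddCommGroup A] [Module R A] [AddCommGroup B] [Module R B]
  [AddCommGroup C] [Module R C]

/-- pullback on Ext -/
noncomputable def pre (f : A →ₗ[R] B) (i : ℕ) : EE R B i →ₗ[R] EE R A i :=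
  (Ext.mk₀ (ModuleCat.ofHom f)).precompOfLinear R (ModuleCat.of R R) (zero_add i)

theorem pre_apply (f : A →ₗ[R] B) (i : ℕ) (x : EE R B i) :
    pre f i x = (Ext.mk₀ (ModuleCat.ofHom f)).comp x (zero_add i) := rfl

theorem pre_comp (f : A →ₗ[R] B) (g : B →ₗ[R] C) (i : ℕ) (x : EE R C i) :
    pre (g ∘ₗ f) i x = pre f i (pre g i x) := by
  simp only [pre_apply, ModuleCat.ofHom_comp]
  rw [Ext.mk₀_comp_mk₀_assoc]

theorem pre_id (i : ℕ) (x : EE R A i) : pre (LinearMap.id : A →ₗ[R] A) i x = x := by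
  simp only [pre_apply]
  exact Ext.mk₀_id_comp x

theorem pre_lsmul (r : R) (i : ℕ) (x : EE R A i) : pre (LinearMap.lsmul R A r) i x = r • x := by
  rw [pre_apply]
  have : ModuleCat.ofHom (LinearMap.lsmul R A r) = r • 𝟙 (ModuleCat.of R A) := rfl
  rw [this, Ext.mk₀_smul, Ext.smul_comp, Ext.mk₀_id_comp]

noncomputable def preEquiv (e : A ≃ₗ[R] B) (i : ℕ) : EE R B i ≃ₗ[R] EE R A i :=
  LinearEquiv.ofLinearMap (pre e.toLinearMap i) (pre e.symm.toLinearMap i)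
    (by ext x; simp [← pre_comp, pre_id]) (by ext x; simp [← pre_comp, pre_id])

theorem les (f : A →ₗ[R] B) (g : B →ₗ[R] C) (hf : Function.Injective f)
    (hg : Function.Surjective g) (h : Function.Exact f g) :
    Function.Injective (pre g 0) ∧
    (∀ i, Function.Exact (pre g i) (pre f i)) ∧
    ∃ δ : ∀ i, EE R A i →ₗ[R] EE R C (i+1),
      ∀ i, Function.Exact (pre f i) (δ i) ∧ Function.Exact (δ i) (pre g (i+1)) := by
  let S := ModuleCat.shortComplexOfCompEqZero f g h.linearMap_comp_eq_zero
  have hS : S.ShortExact := ModuleCat.shortComplex_shortExact S h hf hg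
  refine ⟨?_, ?_, ?_⟩
  · have : Epi (ModuleCat.ofHom g) := hS.epi_g
    exact Ext.precomp_mk₀_injective_of_epi (ModuleCat.of R R) (ModuleCat.ofHom g)
  · intro i y
    constructor
    · intro hy
      exact Ext.contravariant_sequence_exact₂ hS _ y hy
    · rintro ⟨x, rfl⟩
      rw [← pre_comp, h.linearMap_comp_eq_zero]
      rw [pre_apply]
      exact (congrArg (fun t => Ext.comp t x (zero_add i)) (Ext.mk₀_zero _ _)).trans (Ext.zero_comp _ _ _ _ _)
  · refine ⟨fun i => hS.extClass.precompOfLinear R (ModuleCat.of R R) (add_comm 1 i), ?_⟩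
    intro i
    constructor
    · intro y
      constructor
      · intro hy
        exact Ext.contravariant_sequence_exact₁ hS _ y (add_comm 1 i) hy
      · rintro ⟨x, rfl⟩
        exact ShortComplex.ShortExact.extClass_comp_assoc hS x (h := add_comm 1 i)
    · intro y
      constructor
      · intro hy
        exact Ext.contravariant_sequence_exact₃ hS _ y hy (add_comm 1 i)
      · rintro ⟨x, rfl⟩
        exact ShortComplex.ShortExact.comp_extClass_assoc hS x (add_comm 1 i)

instance ee_finite [IsNoetherianRing R] [Module.Finite R A] (i : ℕ) : Module.Finite R (EE R A i) :=
  ModuleCat.finite_ext R (ModuleCat.of R A) (ModuleCat.of R R) i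

theorem ee_proj [Module.Projective R A] (i : ℕ) : Subsingleton (EE R A (i+1)) := by
  have : Projective (ModuleCat.of R A) := inferInstance
  exact Ext.subsingleton_of_projective _ _ i

noncomputable def ee_zero : EE R A 0 ≃ₗ[R] (A →ₗ[R] R) :=
  Ext.linearEquiv₀.trans ModuleCat.homLinearEquiv

end LES
end EpsIrr

namespace EpsIrr
section RegStep
open scoped Pointwise

variable {R : Type} [CommRing R]

def PPext (R : Type) [CommRing R] (M N : Type) [AddCommGroup M] [Module R M] [AddCommGroup N]
    [Module R N] (j : ℕ) : Prop :=
  (∀ i, i ≠ j → Subsingleton (EE R M i)) ∧ Nonempty (EE R M j ≃ₗ[R] N)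

variable {M N M' N' : Type} [AddCommGroup M] [Module R M] [AddCommGroup N] [Module R N]
   [AddCommGroup M'] [Module R M'] [AddCommGroup N'] [Module R N']

theorem PPext.congr {j : ℕ} (h : PPext R M N j) (e : M' ≃ₗ[R] M) (e' : N ≃ₗ[R] N') : PPext R M' N' j := by
  refine ⟨fun i hi => ?_, ?_⟩
  · have := h.1 i hi
    exact (preEquiv e i).symm.toEquiv.subsingleton
  · exact ⟨(preEquiv e j).symm.trans (h.2.some.trans e')⟩

theorem pp_self : PPext R R R 0 := by
  refine ⟨fun i hi => ?_, ?_⟩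
  · obtain ⟨k, rfl⟩ := Nat.exists_eq_succ_of_ne_zero hi
    exact ee_proj k
  · exact ⟨ee_zero.trans (LinearMap.ringLmapEquivSelf R R R)⟩

theorem PPext.step {j : ℕ} (h : PPext R M N j) (x : R) (hM : IsSMulRegular M x)
    (hN : IsSMulRegular N x) : PPext R (QuotSMulTop x M) (QuotSMulTop x N) (j+1) := by
  obtain ⟨h0, h1, δ, h2⟩ := les (LinearMap.lsmul R M x) (x • (⊤ : Submodule R M)).mkQ hM
    (Submodule.mkQ_surjective _) (LinearMap.exact_lsmul_mkQ_smul_top M x)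
  have hreg : ∀ i, IsSMulRegular (EE R M i) x := by
    intro i
    by_cases hi : i = j
    · subst hi
      exact (h.2.some.isSMulRegular_congr x).mpr hN
    · have := h.1 i hi
      intro a b _
      exact Subsingleton.elim _ _
  have hz : ∀ i y, pre (x • (⊤ : Submodule R M)).mkQ i y = 0 := by
    intro i y
    have := (h1 i).apply_apply_eq_zero y
    rw [pre_lsmul] at this
    exact (hreg i).right_eq_zero_of_smul this
  refine ⟨?_, ?_⟩
  · intro i hi
    rcases i with _ | i
    · refine subsingleton_of_forall_eq 0 fun y => h0 ?_
      rw [hz]; simp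
    · have := h.1 i (by omega)
      refine subsingleton_of_forall_eq 0 fun y => ?_
      obtain ⟨z, rfl⟩ := ((h2 i).2 y).1 (hz _ _)
      rw [Subsingleton.elim z 0, map_zero]
  · have hs : Function.Surjective (δ j) := fun y => ((h2 j).2 y).1 (hz _ _)
    have hk : LinearMap.ker (δ j) = x • (⊤ : Submodule R (EE R M j)) := by
      ext z
      rw [LinearMap.mem_ker, (h2 j).1 z, Submodule.mem_smul_pointwise_iff_exists]
      simp only [Set.mem_range, pre_lsmul, Submodule.mem_top, true_and]
    exact ⟨((δ j).quotKerEquivOfSurjective hs).symm.trans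
      ((Submodule.quotEquivOfEq _ _ hk).trans (QuotSMulTop.congr x h.2.some))⟩

theorem PPext.list (rs : List R) : ∀ {M : Type} [AddCommGroup M] [Module R M] {j : ℕ},
    RingTheory.Sequence.IsWeaklyRegular M rs → PPext R M M j →
    PPext R (M ⧸ (Ideal.ofList rs • ⊤ : Submodule R M)) (M ⧸ (Ideal.ofList rs • ⊤ : Submodule R M))
      (j + rs.length) := by
  induction rs with
  | nil =>
    intro M _ _ j _ h
    have e : (M ⧸ (Ideal.ofList ([] : List R) • ⊤ : Submodule R M)) ≃ₗ[R] M :=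
      Submodule.quotEquivOfEqBot _ (by simp)
    exact h.congr e e.symm
  | cons r rs ih =>
    intro M _ _ j hr h
    rw [RingTheory.Sequence.isWeaklyRegular_cons_iff] at hr
    have := ih hr.2 (h.step r hr.1 hr.1)
    have e := Submodule.quotOfListConsSMulTopEquivQuotSMulTopInner M r rs
    have h3 := this.congr e e.symm
    rw [List.length_cons, add_comm rs.length, ← add_assoc]
    exact h3

theorem pp_quot (rs : List R) (h : RingTheory.Sequence.IsWeaklyRegular R rs) :
    PPext R (R ⧸ Ideal.ofList rs) (R ⧸ Ideal.ofList rs) rs.length := by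
  have := PPext.list rs h (pp_self (R := R))
  rw [zero_add] at this
  have e : (R ⧸ Ideal.ofList rs) ≃ₗ[R] (R ⧸ (Ideal.ofList rs • ⊤ : Submodule R R)) :=
    Submodule.quotEquivOfEq _ _ (by simp)
  exact this.congr e e.symm

end RegStep
end EpsIrr

namespace EpsIrr
section FinLen
open scoped Pointwise
open IsLocalRing

variable {R : Type} [CommRing R]

def QQext (R : Type) [CommRing R] (M : Type) [AddCommGroup M] [Module R M] : Prop :=
  (∀ i, i ≠ 4 → Subsingleton (EE R M i)) ∧ Module.length R (EE R M 4) = Module.length R M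

variable {A B C : Type} [AddCommGroup A] [Module R A] [AddCommGroup B] [Module R B]
  [AddCommGroup C] [Module R C]

theorem ses_sub (f : A →ₗ[R] B) (g : B →ₗ[R] C) (hf : Function.Injective f)
    (hg : Function.Surjective g) (h : Function.Exact f g) (i : ℕ) (hA : Subsingleton (EE R A i))
    (hC : Subsingleton (EE R C i)) : Subsingleton (EE R B i) := by
  obtain ⟨h0, h1, δ, h2⟩ := les f g hf hg h
  refine subsingleton_of_forall_eq 0 fun y => ?_
  obtain ⟨z, rfl⟩ := (h1 i y).1 (Subsingleton.elim _ _)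
  rw [Subsingleton.elim z 0, map_zero]

theorem ses_length (f : A →ₗ[R] B) (g : B →ₗ[R] C) (hf : Function.Injective f)
    (hg : Function.Surjective g) (h : Function.Exact f g) (hA : Subsingleton (EE R A 3))
    (hC : Subsingleton (EE R C 5)) : Module.length R (EE R B 4) =
      Module.length R (EE R C 4) + Module.length R (EE R A 4) := by
  obtain ⟨h0, h1, δ, h2⟩ := les f g hf hg h
  refine Module.length_eq_add_of_exact (pre g 4) (pre f 4) ?_ ?_ (h1 4)
  · rw [injective_iff_map_eq_zero]
    intro y hy
    obtain ⟨z, rfl⟩ := ((h2 3).2 y).1 hy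
    rw [Subsingleton.elim z 0, map_zero]
  · intro y
    exact ((h2 4).1 y).1 (Subsingleton.elim _ _)

theorem QQext.ses (f : A →ₗ[R] B) (g : B →ₗ[R] C) (hf : Function.Injective f)
    (hg : Function.Surjective g) (h : Function.Exact f g) (hA : QQext R A) (hC : QQext R C) :
    QQext R B := by
  refine ⟨fun i hi => ses_sub f g hf hg h i (hA.1 i hi) (hC.1 i hi), ?_⟩
  rw [ses_length f g hf hg h (hA.1 3 (by norm_num)) (hC.1 5 (by norm_num)), hA.2, hC.2,
    Module.length_eq_add_of_exact f g hf hg h, add_comm]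

theorem QQext.congr (e : A ≃ₗ[R] B) (hA : QQext R A) : QQext R B := by
  refine ⟨fun i hi => ?_, ?_⟩
  · have := hA.1 i hi
    exact (preEquiv e i).toEquiv.subsingleton
  · rw [(preEquiv e 4).length_eq, hA.2, e.length_eq]

theorem ee_of_subsingleton [Subsingleton A] (i : ℕ) : Subsingleton (EE R A i) := by
  refine subsingleton_of_forall_eq 0 fun y => ?_
  rw [← pre_id i y, show (LinearMap.id : A →ₗ[R] A) = LinearMap.lsmul R A 0 from by
    ext; exact Subsingleton.elim _ _, pre_lsmul, zero_smul]

variable [IsLocalRing R]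

theorem QQext.fl (hk : QQext R (R ⧸ maximalIdeal R)) {M : Type} [AddCommGroup M] [Module R M]
    (h : IsFiniteLength R M) : QQext R M := by
  induction h with
  | of_subsingleton =>
    refine ⟨fun i _ => ee_of_subsingleton i, ?_⟩
    have := ee_of_subsingleton (R := R) (A := ‹Type›) 4
    rw [Module.length_eq_zero_iff.mpr this, Module.length_eq_zero_iff.mpr inferInstance]
  | @of_simple_quotient M _ _ N hs _ ih =>
    refine QQext.ses N.subtype N.mkQ N.injective_subtype N.mkQ_surjective
      (LinearMap.exact_subtype_mkQ N) ih ?_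
    obtain ⟨I, hI, ⟨e⟩⟩ := isSimpleModule_iff_quot_maximal.mp hs
    rw [eq_maximalIdeal hI] at e
    exact hk.congr e.symm

variable [IsNoetherianRing R]

theorem ee_zero_of_reg {M : Type} [AddCommGroup M] [Module R M] [Module.Finite R M]
    (x : R) (hx : x ∈ maximalIdeal R) (hM : IsSMulRegular M x) (i : ℕ)
    (h : Subsingleton (EE R (QuotSMulTop x M) (i+1))) : Subsingleton (EE R M i) := by
  obtain ⟨h0, h1, δ, h2⟩ := les (LinearMap.lsmul R M x) (x • (⊤ : Submodule R M)).mkQ hM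
    (Submodule.mkQ_surjective _) (LinearMap.exact_lsmul_mkQ_smul_top M x)
  have hle : (⊤ : Submodule R (EE R M i)) ≤ Ideal.span {x} • ⊤ := by
    intro y _
    obtain ⟨z, rfl⟩ := ((h2 i).1 y).1 (Subsingleton.elim _ _)
    rw [pre_lsmul]
    exact Submodule.smul_mem_smul (Ideal.mem_span_singleton_self x) trivial
  have := Submodule.eq_bot_of_le_smul_of_le_jacobson_bot (Ideal.span {x}) ⊤
    (Module.Finite.fg_top) hle (by
      rw [Ideal.span_singleton_le_iff_mem]
      exact (IsLocalRing.maximalIdeal_le_jacobson ⊥) hx)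
  exact (Submodule.subsingleton_iff R).mp (subsingleton_of_bot_eq_top this.symm)

theorem ee_high_step (hk : QQext R (R ⧸ maximalIdeal R)) {M : Type} [AddCommGroup M] [Module R M]
    [Module.Finite R M]
    (H : ∀ P : Submodule R M, P ≠ ⊥ → ∀ i, 5 ≤ i → Subsingleton (EE R (M ⧸ P) i)) :
    ∀ i, 5 ≤ i → Subsingleton (EE R M i) := by
  rcases subsingleton_or_nontrivial M with hM | hM
  · exact fun i _ => ee_of_subsingleton i
  by_cases hx : ∃ x ∈ maximalIdeal R, IsSMulRegular M x
  · obtain ⟨x, hx, hr⟩ := hx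
    intro i hi
    refine ee_zero_of_reg x hx hr i (H (x • ⊤) ?_ (i+1) (by omega))
    intro h0
    obtain ⟨v, hv⟩ := exists_ne (0 : M)
    have : x • v ∈ x • (⊤ : Submodule R M) := Submodule.smul_mem_pointwise_smul v x ⊤ trivial
    rw [h0, Submodule.mem_bot] at this
    exact hv (hr.right_eq_zero_of_smul this)
  · have h1 := IsSMulRegular.subsingleton_linearMap_iff (R := R) (M := M)
      (N := R ⧸ maximalIdeal R)
    rw [Ideal.annihilator_quotient] at h1
    rw [← h1] at hx
    have h3 : ∃ φ : (R ⧸ maximalIdeal R) →ₗ[R] M, φ ≠ 0 := by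
      by_contra h4
      push Not at h4
      exact hx (subsingleton_of_forall_eq 0 h4)
    obtain ⟨φ, hφ⟩ := h3
    have hs : IsSimpleModule R (R ⧸ maximalIdeal R) :=
      isSimpleModule_iff_quot_maximal.mpr ⟨_, inferInstance, ⟨LinearEquiv.refl _ _⟩⟩
    have hinj : Function.Injective φ := (LinearMap.injective_or_eq_zero φ).resolve_right hφ
    intro i hi
    refine ses_sub φ (LinearMap.range φ).mkQ hinj (Submodule.mkQ_surjective _) ?_ i
      (hk.1 i (by omega)) (H _ ?_ i hi)
    · exact LinearMap.exact_map_mkQ_range φ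
    · rwa [Ne, LinearMap.range_eq_bot]

theorem ee_high (hk : QQext R (R ⧸ maximalIdeal R)) {M : Type} [AddCommGroup M] [Module R M]
    [Module.Finite R M] : ∀ i, 5 ≤ i → Subsingleton (EE R M i) := by
  have key : ∀ N : Submodule R M, ∀ i, 5 ≤ i → Subsingleton (EE R (M ⧸ N) i) := by
    intro N
    induction N using IsNoetherian.induction with
    | _ N ih =>
    refine ee_high_step hk fun P hP i hi => ?_
    have h1 : P = Submodule.map N.mkQ (Submodule.comap N.mkQ P) :=
      (Submodule.map_comap_eq_of_surjective N.mkQ_surjective P).symm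
    have hle : N ≤ Submodule.comap N.mkQ P := by
      intro x hx
      rw [Submodule.mem_comap, (Submodule.Quotient.mk_eq_zero N).mpr hx |> fun h => (h : N.mkQ x = 0)]
      exact zero_mem _
    have hlt : N < Submodule.comap N.mkQ P := by
      refine lt_of_le_of_ne hle fun h => hP ?_
      rw [h1, ← h]
      simp
    have := ih _ hlt i hi
    have e := Submodule.quotientQuotientEquivQuotient N _ hle
    rw [← h1] at e
    exact (preEquiv e i).symm.toEquiv.subsingleton
  intro i hi
  have := key ⊥ i hi
  exact (preEquiv (Submodule.quotEquivOfEqBot (⊥ : Submodule R M) rfl) i).toEquiv.subsingleton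

theorem ee_four_length (hk : QQext R (R ⧸ maximalIdeal R)) {M : Type} [AddCommGroup M] [Module R M]
    [Module.Finite R M] (N : Submodule R M) (hN : IsFiniteLength R N) (x : R)
    (hx : x ∈ maximalIdeal R) (hr : IsSMulRegular (M ⧸ N) x) :
    Module.length R (EE R M 4) = Module.length R N := by
  have h5 := ee_high hk (M := QuotSMulTop x (M ⧸ N)) 5 le_rfl
  have h4 := ee_zero_of_reg x hx hr 4 h5
  have hQ := QQext.fl hk hN
  rw [ses_length N.subtype N.mkQ N.injective_subtype N.mkQ_surjective
      (LinearMap.exact_subtype_mkQ N) (hQ.1 3 (by norm_num)) (ee_high hk 5 le_rfl),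
      Module.length_eq_zero_iff.mpr h4, zero_add, hQ.2]

theorem qq_residue (rs : List R) (h : RingTheory.Sequence.IsWeaklyRegular R rs)
    (hl : rs.length = 4) (hm : Ideal.ofList rs = maximalIdeal R) :
    QQext R (R ⧸ maximalIdeal R) := by
  have := pp_quot rs h
  rw [hl, hm] at this
  exact ⟨this.1, this.2.some.length_eq⟩

/-- Main Ext computation. -/
theorem ext_four_length (rs : List R) (h : RingTheory.Sequence.IsWeaklyRegular R rs)
    (hl : rs.length = 4) (hm : Ideal.ofList rs = maximalIdeal R) (I K : Ideal R) (hIK : I ≤ K)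
    (hN : IsFiniteLength R (Submodule.map (Submodule.mkQ I) K)) (x : R)
    (hx : x ∈ maximalIdeal R) (hr : ∀ f, x * f ∈ K → f ∈ K) :
    moduleLength R (extModule R 4 (ModuleCat.of R (R ⧸ I)) (ModuleCat.of R R)) =
     (Module.length R (Submodule.map (Submodule.mkQ I) K) : WithBot ℕ∞) := by
  rw [moduleLength_ext _ _ 3]
  congr 1
  refine ee_four_length (qq_residue rs h hl hm) _ hN x hx ?_
  refine ((Submodule.quotientQuotientEquivQuotient I K hIK).isSMulRegular_congr x).mpr ?_
  rw [isSMulRegular_iff_right_eq_zero_of_smul]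
  intro y hy
  obtain ⟨f, rfl⟩ := Submodule.mkQ_surjective K y
  have h1 : x * f ∈ K := (Submodule.Quotient.mk_eq_zero K).mp hy
  exact (Submodule.Quotient.mk_eq_zero K).mpr (hr f h1)

end FinLen
end EpsIrr

namespace EpsIrr
section Geo
open MvPolynomial

abbrev R0 : Type := MvPolynomial (Fin 3) ℂ
abbrev Vec : Type := Fin 3 → ℂ

/-- linear form -/
noncomputable def lin (c : Vec) : R0 := ∑ i, C (c i) * X i

/-- ideal of a point -/
noncomputable def Ip (p : Vec) : Ideal R0 := Ideal.span {f | ∃ c : Vec, c ⬝ᵥ p = 0 ∧ f = lin c}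

/-- irrelevant ideal -/
noncomputable abbrev mm : Ideal R0 := idealOfVars (Fin 3) ℂ

theorem lin_mem_Ip {c p : Vec} (h : c ⬝ᵥ p = 0) : lin c ∈ Ip p := Ideal.subset_span ⟨c, h, rfl⟩

theorem lin_add (c d : Vec) : lin (c + d) = lin c + lin d := by
  simp [lin, add_mul, Finset.sum_add_distrib]

theorem lin_smul (a : ℂ) (c : Vec) : lin (a • c) = C a * lin c := by
  simp [lin, Finset.mul_sum, mul_assoc]

theorem lin_neg (c : Vec) : lin (-c) = - lin c := by simp [lin]

theorem lin_sub (c d : Vec) : lin (c - d) = lin c - lin d := by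
  rw [sub_eq_add_neg, lin_add, lin_neg, sub_eq_add_neg]

theorem lin_single (i : Fin 3) : lin (Pi.single i 1) = X i := by
  rw [lin, Finset.sum_eq_single i]
  · simp
  · intro j _ hj; simp [hj]
  · simp

theorem lin_hom (c : Vec) : (lin c).IsHomogeneous 1 := by
  refine IsHomogeneous.sum _ _ _ fun i _ => ?_
  simpa using (isHomogeneous_C (Fin 3) (c i)).mul (isHomogeneous_X ℂ i)

theorem lin_inj {c : Vec} (h : lin c = 0) : c = 0 := by
  funext i
  have := congrArg (coeff (Finsupp.single i 1)) h
  rw [lin, coeff_sum, Finset.sum_eq_single i] at this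
  · simpa [coeff_C_mul] using this
  · intro j _ hj
    rw [coeff_C_mul, coeff_X, if_neg, mul_zero]
    intro h
    exact hj ((Finsupp.single_left_injective one_ne_zero) h)
  · simp

theorem eval_lin (c q : Vec) : eval q (lin c) = c ⬝ᵥ q := by
  simp [lin, dotProduct]

theorem lin_mem_mm (c : Vec) : lin c ∈ mm := by
  refine Ideal.sum_mem _ fun i _ => Ideal.mul_mem_left _ _ (Ideal.subset_span ⟨i, rfl⟩)

theorem Ip_le_mm (p : Vec) : Ip p ≤ mm := by
  rw [Ip, Ideal.span_le]
  rintro _ ⟨c, _, rfl⟩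
  exact lin_mem_mm c

theorem eval_Ip {p : Vec} {f : R0} (h : f ∈ Ip p) : eval p f = 0 := by
  have : Ip p ≤ RingHom.ker (eval p) := by
    rw [Ip, Ideal.span_le]
    rintro _ ⟨c, hc, rfl⟩
    simpa [eval_lin] using hc
  exact this h

/-- order ideal at a coordinate point -/
noncomputable def ordIdeal (k : Fin 3) (m : ℕ) : Ideal R0 :=
  restrictSupportIdeal (R := ℂ) {s : Fin 3 →₀ ℕ | m + s k ≤ s.degree} (by
    intro s t hst hs
    obtain ⟨u, rfl⟩ := exists_add_of_le hst
    have := Finsupp.le_degree k u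
    simp only [Set.mem_ofPred_eq, map_add, Finsupp.add_apply] at hs ⊢
    omega)

theorem mem_ordIdeal {k : Fin 3} {m : ℕ} {f : R0} :
    f ∈ ordIdeal k m ↔ ∀ s ∈ f.support, m + s k ≤ s.degree := by
  exact Iff.rfl

theorem ordIdeal_mul (k : Fin 3) (m n : ℕ) : ordIdeal k m * ordIdeal k n ≤ ordIdeal k (m+n) := by
  rw [Ideal.mul_le]
  intro f hf g hg
  rw [mem_ordIdeal] at *
  intro s hs
  classical
  obtain ⟨a, ha, b, hb, rfl⟩ := Finset.mem_add.mp (support_mul f g hs)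
  have h1 := hf a ha
  have h2 := hg b hb
  simp only [map_add, Finsupp.add_apply]
  omega

theorem mem_Ip_single_pow {k : Fin 3} {m : ℕ} {f : R0} :
    f ∈ Ip (Pi.single k 1) ^ m ↔ ∀ s ∈ f.support, m + s k ≤ s.degree := by
  rw [← mem_ordIdeal]
  constructor
  · have h1 : Ip (Pi.single k 1) ≤ ordIdeal k 1 := by
      rw [Ip, Ideal.span_le]
      rintro _ ⟨c, hc, rfl⟩
      rw [dotProduct_single_one] at hc
      refine Ideal.sum_mem _ fun i _ => ?_
      by_cases hik : i = k
      · subst hik; simp [hc]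
      · refine Ideal.mul_mem_left _ _ ?_
        rw [mem_ordIdeal]
        intro s hs
        rw [support_X, Finset.mem_singleton] at hs
        subst hs
        simp [hik]
    have h2 : Ip (Pi.single k 1) ^ m ≤ ordIdeal k m := by
      induction m with
      | zero => 
        intro f _
        rw [mem_ordIdeal]
        intro s _
        have := Finsupp.le_degree k s
        omega
      | succ n ih =>
        rw [pow_succ]
        exact (Ideal.mul_mono ih h1).trans (ordIdeal_mul k n 1)
    exact fun h => h2 h
  · intro h
    rw [mem_ordIdeal] at h
    rw [f.as_sum]
    refine Ideal.sum_mem _ fun s hs => ?_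
    rw [monomial_eq, Finsupp.prod_fintype _ _ (by simp)]
    refine Ideal.mul_mem_left _ _ ?_
    rw [← Finset.mul_prod_erase _ _ (Finset.mem_univ k)]
    refine Ideal.mul_mem_left _ _ ?_
    have h3 : ∏ i ∈ Finset.univ.erase k, (X i : R0) ^ s i ∈
        ∏ i ∈ Finset.univ.erase k, Ip (Pi.single k 1) ^ s i := by
      refine Ideal.prod_mem_prod fun i hi => Ideal.pow_mem_pow ?_ _
      rw [← lin_single]
      apply lin_mem_Ip
      rw [dotProduct_single_one]
      simp [(Finset.ne_of_mem_erase hi).symm]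
    rw [Finset.prod_pow_eq_pow_sum] at h3
    refine Ideal.pow_le_pow_right ?_ h3
    have := h s hs
    rw [Finsupp.degree_eq_sum, ← Finset.add_sum_erase _ _ (Finset.mem_univ k)] at this
    omega

/-- auxiliary grading map -/
noncomputable def thet (k : Fin 3) : R0 →ₐ[ℂ] Polynomial R0 :=
  aeval fun i => Polynomial.C (X i) * (if i = k then 1 else Polynomial.X)

theorem thet_monomial (k : Fin 3) (s : Fin 3 →₀ ℕ) (c : ℂ) :
    thet k (monomial s c) = Polynomial.monomial (s.degree - s k) (monomial s c) := by
  rw [monomial_eq, thet, map_mul]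
  rw [Finsupp.prod_fintype _ _ (by simp), map_prod]
  simp only [map_pow, aeval_X, mul_pow, Finset.prod_mul_distrib]
  have : (∏ x, (if x = k then (1 : Polynomial R0) else Polynomial.X) ^ s x)
      = Polynomial.X ^ (s.degree - s k) := by
    rw [← Finset.mul_prod_erase _ _ (Finset.mem_univ k), if_pos rfl, one_pow, one_mul,
      Finset.prod_congr rfl (g := fun i => (Polynomial.X : Polynomial R0) ^ s i),
      Finset.prod_pow_eq_pow_sum]
    · congr 1
      rw [Finsupp.degree_eq_sum, ← Finset.add_sum_erase _ _ (Finset.mem_univ k)]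
      omega
    · intro i hi
      rw [if_neg (Finset.ne_of_mem_erase hi)]
  rw [this, ← Polynomial.C_mul_X_pow_eq_monomial, ← mul_assoc, aeval_C,
    Polynomial.algebraMap_apply, algebraMap_eq, map_mul, map_prod]
  simp only [map_pow]

theorem mem_Ip_single_iff_dvd {k : Fin 3} {m : ℕ} {f : R0} :
    f ∈ Ip (Pi.single k 1) ^ m ↔ Polynomial.X ^ m ∣ thet k f := by
  classical
  rw [mem_Ip_single_pow, Polynomial.X_pow_dvd_iff]
  have hc : ∀ d, (thet k f).coeff d =
      ∑ s ∈ f.support, if s.degree - s k = d then monomial s (coeff s f) else 0 := by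
    intro d
    conv_lhs => rw [f.as_sum]
    rw [map_sum, Polynomial.finsetSum_coeff]
    refine Finset.sum_congr rfl fun s _ => ?_
    rw [thet_monomial, Polynomial.coeff_monomial]
  constructor
  · intro h d hd
    rw [hc]
    refine Finset.sum_eq_zero fun s hs => ?_
    rw [if_neg]
    have := h s hs
    omega
  · intro h s hs
    by_contra hlt
    have hle := Finsupp.le_degree k s
    have h1 := h (s.degree - s k) (by omega)
    rw [hc] at h1
    have h2 := congrArg (coeff s) h1
    rw [coeff_sum, Finset.sum_eq_single s] at h2
    · rw [if_pos rfl, coeff_monomial, if_pos rfl, coeff_zero] at h2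
      exact (mem_support_iff.mp hs) h2
    · intro t _ hts
      split_ifs
      · rw [coeff_monomial, if_neg hts]
      · simp
    · exact fun h => absurd hs h

theorem single_primary {k : Fin 3} {a b : ℕ} {h g : R0} (hh : h ∉ Ip (Pi.single k 1) ^ (a+1))
    (hg : h * g ∈ Ip (Pi.single k 1) ^ (a + b)) : g ∈ Ip (Pi.single k 1) ^ b := by
  rw [mem_Ip_single_iff_dvd] at *
  rw [map_mul, pow_dvd_iff_le_emultiplicity, emultiplicity_mul Polynomial.prime_X] at hg
  rw [pow_dvd_iff_le_emultiplicity] at hh ⊢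
  have h1 : emultiplicity Polynomial.X (thet k h) < ((a+1 : ℕ) : ℕ∞) := not_le.mp hh
  generalize emultiplicity Polynomial.X (thet k h) = x at *
  generalize emultiplicity Polynomial.X (thet k g) = y at *
  induction y using ENat.recTopCoe with
  | top => exact le_top
  | coe y =>
    induction x using ENat.recTopCoe with
    | top => simp at h1
    | coe x =>
      norm_cast at *
      omega

/-- Linear substitution -/
noncomputable def sub (L : Matrix (Fin 3) (Fin 3) ℂ) : R0 →ₐ[ℂ] R0 := aeval fun i => lin (L i)

theorem sub_lin (L : Matrix (Fin 3) (Fin 3) ℂ) (c : Vec) :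
    sub L (lin c) = lin (Matrix.vecMul c L) := by
  rw [lin, map_sum]
  simp only [map_mul, sub, aeval_X, algHom_C]
  simp only [lin, Finset.mul_sum, Matrix.vecMul, dotProduct, map_sum, Finset.sum_mul]
  rw [Finset.sum_comm]
  refine Finset.sum_congr rfl fun i _ => Finset.sum_congr rfl fun j _ => ?_
  simp [mul_assoc]

theorem sub_sub (L K : Matrix (Fin 3) (Fin 3) ℂ) (f : R0) : sub K (sub L f) = sub (L * K) f := by
  have : (sub K).comp (sub L) = sub (L * K) := by
    apply algHom_ext
    intro i
    rw [AlgHom.comp_apply, ← lin_single, sub_lin, sub_lin, sub_lin, Matrix.vecMul_vecMul]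
  exact DFunLike.congr_fun this f

theorem sub_one (f : R0) : sub 1 f = f := by
  have : sub 1 = AlgHom.id ℂ R0 := by
    apply algHom_ext
    intro i
    rw [← lin_single, sub_lin, Matrix.vecMul_one, AlgHom.id_apply]
  exact DFunLike.congr_fun this f

theorem sub_injective (L : Matrix (Fin 3) (Fin 3) ℂ) (hL : IsUnit L.det) :
    Function.Injective (sub L) := by
  intro f g h
  have := congrArg (sub L⁻¹) h
  rwa [sub_sub, sub_sub, Matrix.mul_nonsing_inv _ hL, sub_one, sub_one] at this

theorem sub_hom (L : Matrix (Fin 3) (Fin 3) ℂ) {f : R0} {d : ℕ} (h : f.IsHomogeneous d) :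
    (sub L f).IsHomogeneous d := by
  have := h.eval₂ C (fun i => lin (L i)) (n := 1) (fun r => isHomogeneous_C _ r)
    (fun i => lin_hom _)
  rw [one_mul] at this
  exact this

theorem sub_Ip (L : Matrix (Fin 3) (Fin 3) ℂ) {p q : Vec} {a : ℂ} 
    (h : Matrix.mulVec L q = a • p) {m : ℕ} {f : R0} (hf : f ∈ Ip p ^ m) : sub L f ∈ Ip q ^ m := by
  have h1 : (Ip p).map (sub L) ≤ Ip q := by
    rw [Ip, Ideal.map_span, Ideal.span_le]
    rintro _ ⟨_, ⟨c, hc, rfl⟩, rfl⟩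
    rw [sub_lin]
    apply lin_mem_Ip
    rw [← Matrix.dotProduct_mulVec, h, dotProduct_smul, hc, smul_zero]
  have h2 := Ideal.mem_map_of_mem (sub L) hf
  rw [Ideal.map_pow] at h2
  exact Ideal.pow_right_mono h1 m h2

theorem sub_Ip_iff (L : Matrix (Fin 3) (Fin 3) ℂ) (hL : IsUnit L.det) {p q : Vec}
    (h : Matrix.mulVec L q = p) {m : ℕ} {f : R0} : sub L f ∈ Ip q ^ m ↔ f ∈ Ip p ^ m := by
  constructor
  · intro hf
    have h3 : Matrix.mulVec L⁻¹ p = (1:ℂ) • q := by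
      rw [← h, Matrix.mulVec_mulVec, Matrix.nonsing_inv_mul _ hL, Matrix.one_mulVec, one_smul]
    have := sub_Ip L⁻¹ h3 hf
    rwa [sub_sub, Matrix.mul_nonsing_inv _ hL, sub_one] at this
  · exact sub_Ip L (a := 1) (by rw [h, one_smul])

end Geo
end EpsIrr

namespace EpsIrr
section Geo2
open MvPolynomial

theorem exists_move {p : Vec} (hp : p ≠ 0) : ∃ k : Fin 3, ∃ L : Matrix (Fin 3) (Fin 3) ℂ,
    IsUnit L.det ∧ Matrix.mulVec L (Pi.single k 1) = p := by
  obtain ⟨k, hk⟩ := Function.ne_iff.mp hp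
  refine ⟨k, Matrix.updateCol 1 k p, ?_, ?_⟩
  · rw [← Matrix.cramer_apply, Matrix.cramer_one]
    exact isUnit_iff_ne_zero.mpr hk
  · rw [Matrix.mulVec_single_one]
    ext i
    simp

theorem point_primary {p : Vec} (hp : p ≠ 0) {a b : ℕ} {h g : R0} (hh : h ∉ Ip p ^ (a+1))
    (hg : h * g ∈ Ip p ^ (a + b)) : g ∈ Ip p ^ b := by
  obtain ⟨k, L, hL, hk⟩ := exists_move hp
  rw [← sub_Ip_iff L hL hk] at *
  rw [map_mul] at hg
  exact single_primary hh hg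

theorem mem_mm_pow_of_mem {p : Vec} {m : ℕ} {f : R0} (h : f ∈ Ip p ^ m) : f ∈ mm ^ m :=
  Ideal.pow_right_mono (Ip_le_mm p) m h

theorem hom_mm {f : R0} {d m : ℕ} (hf : f.IsHomogeneous d) (h0 : f ≠ 0) (h : f ∈ mm ^ m) :
    m ≤ d := by
  rw [mem_pow_idealOfVars_iff] at h
  obtain ⟨s, hs⟩ := MvPolynomial.ne_zero_iff.mp h0
  have := h s (mem_support_iff.mpr hs)
  have h2 : s.degree = d := by
    by_contra hne
    exact hs (hf.coeff_eq_zero hne)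
  omega

theorem lin_not_mem {p c : Vec} (hc : c ≠ 0) : lin c ∉ Ip p ^ 2 := by
  intro h
  have := hom_mm (lin_hom c) (fun h => hc (lin_inj h)) (mem_mm_pow_of_mem h)
  omega

theorem lin_div {p c : Vec} (hp : p ≠ 0) (hc : c ≠ 0) {m : ℕ} {g : R0}
    (h : lin c * g ∈ Ip p ^ m) : g ∈ Ip p ^ (m - 1) := by
  rcases m with _ | m
  · simp
  · exact point_primary hp (a := 1) (lin_not_mem hc) (by rwa [add_comm 1, Nat.add_sub_cancel])

theorem lin_div' {p c : Vec} (hp : p ≠ 0) (hc : c ⬝ᵥ p ≠ 0) {m : ℕ} {g : R0}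
    (h : lin c * g ∈ Ip p ^ m) : g ∈ Ip p ^ m := by
  refine point_primary hp (a := 0) (h := lin c) ?_ (by rwa [zero_add])
  intro h1
  rw [zero_add, pow_one] at h1
  exact hc (by rw [← eval_lin]; exact eval_Ip h1)

attribute [local instance] MvPolynomial.gradedAlgebra

theorem Ip_pow_homog (p : Vec) (m : ℕ) {f : R0} (hf : f ∈ Ip p ^ m) (d : ℕ) :
    homogeneousComponent d f ∈ Ip p ^ m := by
  have h1 : (Ip p).IsHomogeneous (homogeneousSubmodule (Fin 3) ℂ) := by
    refine Ideal.homogeneous_span _ _ ?_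
    rintro _ ⟨c, _, rfl⟩
    exact ⟨1, lin_hom c⟩
  have h2 : ∀ m : ℕ, (Ip p ^ m).IsHomogeneous (homogeneousSubmodule (Fin 3) ℂ) := by
    intro m
    induction m with
    | zero => rw [pow_zero, Ideal.one_eq_top]; exact Ideal.IsHomogeneous.top _
    | succ n ih => rw [pow_succ]; exact ih.mul h1
  exact homogeneousComponent_mem_of_mem (h2 m) hf d

theorem mem_Ip_of_eval {q : Vec} (hq : q ≠ 0) {f : R0} {d : ℕ} (hf : f.IsHomogeneous d)
    (h : eval q f = 0) : f ∈ Ip q := by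
  obtain ⟨k, hk⟩ := Function.ne_iff.mp hq
  have hk : q k ≠ 0 := hk
  let w : R0 := C (q k)⁻¹ * X k
  have hX : ∀ i, (X i : R0) - C (q i) * w ∈ Ip q := by
    intro i
    have : (X i : R0) - C (q i) * w = lin (Pi.single i 1 - (q i * (q k)⁻¹) • Pi.single k 1) := by
      rw [lin_sub, lin_smul, lin_single, lin_single, C_mul, mul_assoc]
    rw [this]
    apply lin_mem_Ip
    rw [sub_dotProduct, smul_dotProduct, single_one_dotProduct, single_one_dotProduct]
    simp [hk]
  have h1 : Ideal.Quotient.mk (Ip q) f =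
      Ideal.Quotient.mk (Ip q) (aeval (fun i => C (q i) * w) f) := by
    have : (Ideal.Quotient.mkₐ ℂ (Ip q)) =
        (Ideal.Quotient.mkₐ ℂ (Ip q)).comp (aeval (fun i => C (q i) * w)) := by
      apply algHom_ext
      intro i
      rw [AlgHom.comp_apply, aeval_X]
      exact Ideal.Quotient.eq.mpr (hX i)
    exact DFunLike.congr_fun this f
  have h2 : aeval (fun i => C (q i) * w) f = 0 := by
    have h3 : (aeval (fun i => C (q i) * w) f : R0) = w ^ d * C (eval q f) := by
      rw [f.as_sum, map_sum, map_sum, map_sum, Finset.mul_sum]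
      refine Finset.sum_congr rfl fun s hs => ?_
      have hd : s.degree = d := by
        by_contra hne
        exact (mem_support_iff.mp hs) (hf.coeff_eq_zero hne)
      rw [aeval_monomial, eval_monomial, Finsupp.prod_fintype _ _ (by simp),
        Finsupp.prod_fintype _ _ (by simp)]
      simp only [mul_pow, Finset.prod_mul_distrib, Finset.prod_pow_eq_pow_sum]
      rw [← Finsupp.degree_eq_sum, hd, map_mul, map_prod, algebraMap_eq]
      simp only [map_pow]
      ring
    rw [h3, h, map_zero, mul_zero]
  rw [h2, map_zero] at h1
  exact Ideal.Quotient.eq_zero_iff_mem.mp h1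

/-- forms -/
noncomputable abbrev Hom (d : ℕ) : Submodule ℂ R0 := homogeneousSubmodule (Fin 3) ℂ d

instance (d : ℕ) : Module.Finite ℂ (Hom d) :=
  Module.Finite.iff_fg.mpr (homogeneousSubmodule_fg (R := ℂ) (σ := Fin 3) d)

theorem finite_of_le {A : Submodule ℂ R0} {d : ℕ} (h : A ≤ Hom d) : Module.Finite ℂ A :=
  Submodule.finiteDimensional_of_le h

/-- power of the point ideal as a ℂ-space -/
noncomputable def Jp (p : Vec) (m : ℕ) : Submodule ℂ R0 := (Ip p ^ m).restrictScalars ℂ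

theorem mem_Jp {p : Vec} {m : ℕ} {f : R0} : f ∈ Jp p m ↔ f ∈ Ip p ^ m := Iff.rfl

theorem finrank_step {p : Vec} (hp : p ≠ 0) {A : Submodule ℂ R0} {d : ℕ} (hA : A ≤ Hom d) (m : ℕ) :
    Module.finrank ℂ ↥(A ⊓ Jp p m) ≤ Module.finrank ℂ ↥(A ⊓ Jp p (m+1)) + (m+1) := by
  obtain ⟨k, L, hL, hk⟩ := exists_move hp
  have : Module.Finite ℂ ↥(A ⊓ Jp p m) := finite_of_le (inf_le_left.trans hA)
  have : Module.Finite ℂ ↥(A ⊓ Jp p (m+1)) := finite_of_le (inf_le_left.trans hA)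
  let expo : Fin (m+1) → (Fin 3 →₀ ℕ) := fun i =>
    Finsupp.single k (d - m) + Finsupp.single (k+1) i.val + Finsupp.single (k+2) (m - i.val)
  let φ : ↥(A ⊓ Jp p m) →ₗ[ℂ] (Fin (m+1) → ℂ) :=
    LinearMap.pi fun i => (lcoeff ℂ (expo i)) ∘ₗ (sub L).toLinearMap ∘ₗ (A ⊓ Jp p m).subtype
  have hφ : ∀ f : ↥(A ⊓ Jp p m), φ f = 0 → f.1 ∈ A ⊓ Jp p (m+1) := by
    intro f hf
    refine ⟨f.2.1, ?_⟩
    change f.1 ∈ Ip p ^ (m+1)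
    rw [← sub_Ip_iff L hL hk, mem_Ip_single_pow]
    have h2 : f.1 ∈ Ip p ^ m := f.2.2
    rw [← sub_Ip_iff L hL hk, mem_Ip_single_pow] at h2
    have hom := sub_hom L (hA f.2.1 : f.1.IsHomogeneous d)
    intro s hs
    have h3 := h2 s hs
    by_contra hlt
    have hd : s.degree = d := by
      by_contra hne
      exact (mem_support_iff.mp hs) (hom.coeff_eq_zero hne)
    have hsum : s.degree = s k + s (k+1) + s (k+2) := by
      rw [Finsupp.degree_eq_sum, Fin.sum_univ_three]
      fin_cases k
      · rfl
      · change s 0 + s 1 + s 2 = s 1 + s 2 + s 0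
        omega
      · change s 0 + s 1 + s 2 = s 2 + s 0 + s 1
        omega
    have hs2 : s = expo ⟨s (k+1), by omega⟩ := by
      have hk0 : s k = d - m := by omega
      have hk2 : s (k+2) = m - s (k+1) := by omega
      have e1 : k + 1 ≠ k := by clear * -; revert k; decide
      have e2 : k + 2 ≠ k := by clear * -; revert k; decide
      have e3 : k + 2 ≠ k + 1 := by clear * -; revert k; decide
      have e4 : ∀ i : Fin 3, i = k ∨ i = k+1 ∨ i = k+2 := by clear * -; revert k; decide
      ext i
      rcases e4 i with rfl | rfl | rfl
      · simp [expo, e1, e2, hk0]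
      · simp [expo, e1, e1.symm, e3]
      · simp [expo, e2.symm, e3.symm, hk2]
    have h4 := congrFun hf ⟨s (k+1), by omega⟩
    apply mem_support_iff.mp hs
    rw [hs2]
    exact h4
  have hker : LinearMap.ker φ ≤ Submodule.comap (A ⊓ Jp p m).subtype (A ⊓ Jp p (m+1)) :=
    fun f hf => hφ f hf
  have h1 := φ.finrank_range_add_finrank_ker
  have h2 : Module.finrank ℂ (LinearMap.range φ) ≤ m + 1 := by
    have := Submodule.finrank_le (LinearMap.range φ)
    simpa using this
  have h3 : Module.finrank ℂ (LinearMap.ker φ) ≤ Module.finrank ℂ ↥(A ⊓ Jp p (m+1)) := by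
    refine LinearMap.finrank_le_finrank_of_injective
      (f := ((A ⊓ Jp p m).subtype.comp (LinearMap.ker φ).subtype).codRestrict (A ⊓ Jp p (m+1))
        fun f => hφ f.1 f.2) ?_
    intro x y hxy
    have hv : x.1.1 = y.1.1 := congrArg (fun z : ↥(A ⊓ Jp p (m+1)) => z.1) hxy
    exact Subtype.ext (Subtype.ext hv)
  omega

theorem finrank_Hom_ge (d : ℕ) : (d+1)*(d+2) ≤ 2 * Module.finrank ℂ (Hom d) := by
  let ι := Σ i : Fin (d+1), Fin (i.val+1)
  let expo : ι → (Fin 3 →₀ ℕ) := fun x =>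
    Finsupp.single 0 (d - x.1.val) + Finsupp.single 1 x.2.val + Finsupp.single 2 (x.1.val - x.2.val)
  have hinj : Function.Injective expo := by
    rintro ⟨⟨i, hi⟩, ⟨j, hj⟩⟩ ⟨⟨i', hi'⟩, ⟨j', hj'⟩⟩ h
    have h0 := DFunLike.congr_fun h 0
    have h1 := DFunLike.congr_fun h 1
    have h2 := DFunLike.congr_fun h 2
    simp [expo] at h0 h1 h2 hj hj'
    have : i = i' := by omega
    subst this
    subst h1
    rfl
  have hmem : ∀ x, (monomial (expo x) (1:ℂ)) ∈ Hom d := by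
    rintro ⟨⟨i, hi⟩, ⟨j, hj⟩⟩
    apply isHomogeneous_monomial
    simp only [expo, map_add, Finsupp.degree_single]
    have : j < i + 1 := hj
    omega
  have hli : LinearIndependent ℂ (fun x : ι => (⟨monomial (expo x) 1, hmem x⟩ : Hom d)) := by
    apply LinearIndependent.of_comp (Hom d).subtype
    have := (basisMonomials (Fin 3) ℂ).linearIndependent.comp expo hinj
    simpa [Function.comp_def] using this
  have h := hli.fintype_card_le_finrank
  have hcard : 2 * Fintype.card ι = (d+1)*(d+2) := by
    simp only [ι, Fintype.card_sigma, Fintype.card_fin]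
    rw [Fin.sum_univ_eq_sum_range (fun i => i + 1) (d+1)]
    clear * -
    induction d with
    | zero => simp
    | succ n ih => rw [Finset.sum_range_succ, mul_add, ih]; ring
  omega

end Geo2
end EpsIrr

namespace EpsIrr
section Geo3
open MvPolynomial

/-- restriction to a parametrized line -/
noncomputable def restr (u v : Vec) : R0 →ₐ[ℂ] Polynomial ℂ :=
  aeval fun i => Polynomial.C (u i) + Polynomial.C (v i) * Polynomial.X

theorem restr_lin (u v c : Vec) :
    restr u v (lin c) = Polynomial.C (c ⬝ᵥ u) + Polynomial.C (c ⬝ᵥ v) * Polynomial.X := by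
  simp only [restr, lin, map_sum, map_mul, aeval_X, algHom_C, dotProduct, Polynomial.algebraMap_eq,
    Finset.sum_mul, ← Finset.sum_add_distrib]
  refine Finset.sum_congr rfl fun i _ => ?_
  ring

theorem restr_natDegree (u v : Vec) {f : R0} {d : ℕ} (hf : f.IsHomogeneous d) :
    (restr u v f).natDegree ≤ d := by
  rw [f.as_sum, map_sum]
  refine Polynomial.natDegree_sum_le_of_forall_le _ _ fun s hs => ?_
  have hd : s.degree = d := by
    by_contra hne
    exact (mem_support_iff.mp hs) (hf.coeff_eq_zero hne)
  rw [restr, aeval_monomial, Finsupp.prod_fintype _ _ (by simp), Polynomial.algebraMap_eq]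
  refine (Polynomial.natDegree_C_mul_le _ _).trans ?_
  refine (Polynomial.natDegree_prod_le _ _).trans ?_
  rw [← hd, Finsupp.degree_eq_sum]
  refine Finset.sum_le_sum fun i _ => ?_
  refine (Polynomial.natDegree_pow_le).trans ?_
  have : (Polynomial.C (u i) + Polynomial.C (v i) * Polynomial.X).natDegree ≤ 1 := by
    rw [add_comm]; exact Polynomial.natDegree_linear_le
  nlinarith

theorem restr_Ip (u v p : Vec) (τ a : ℂ) (hp : a • p = u + τ • v) (m : ℕ) {f : R0} (hf : f ∈ Ip p ^ m) :
    (Polynomial.X - Polynomial.C τ) ^ m ∣ restr u v f := by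
  have h1 : (Ip p).map (restr u v) ≤ Ideal.span {Polynomial.X - Polynomial.C τ} := by
    rw [Ip, Ideal.map_span, Ideal.span_le]
    rintro _ ⟨_, ⟨c, hc, rfl⟩, rfl⟩
    have h0 : c ⬝ᵥ u + τ * c ⬝ᵥ v = 0 := by
      have := congrArg (fun z => c ⬝ᵥ z) hp
      simp only [dotProduct_add, dotProduct_smul, hc, smul_eq_mul, mul_zero] at this
      exact this.symm
    rw [restr_lin, SetLike.mem_coe, Ideal.mem_span_singleton, Polynomial.dvd_iff_isRoot]
    simp only [Polynomial.IsRoot.def, Polynomial.eval_add, Polynomial.eval_C, Polynomial.eval_mul,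
      Polynomial.eval_X]
    linear_combination h0
  have h2 := Ideal.mem_map_of_mem (restr u v) hf
  rw [Ideal.map_pow] at h2
  have h3 := Ideal.pow_right_mono h1 m h2
  rwa [Ideal.span_singleton_pow, Ideal.mem_span_singleton] at h3

theorem restr_single_zero {F : R0} {d : ℕ} (hF : F.IsHomogeneous d)
    (h : restr (Pi.single 0 1) (Pi.single 1 1) F = 0) : X 2 ∣ F := by
  rw [X_dvd_iff_modMonomial_eq_zero]
  ext s
  rw [coeff_zero]
  by_cases hs2 : Finsupp.single 2 1 ≤ s
  · rw [coeff_modMonomial_of_le _ hs2]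
  · rw [coeff_modMonomial_of_not_le _ hs2]
    have hs0 : s 2 = 0 := by
      by_contra hne
      apply hs2
      rw [Finsupp.single_le_iff]
      omega
    by_contra hc
    have key : (restr (Pi.single 0 1) (Pi.single 1 1) F).coeff (s 1) = coeff s F := by
      conv_lhs => rw [F.as_sum]
      rw [map_sum, Polynomial.finsetSum_coeff, Finset.sum_eq_single s]
      · rw [restr, aeval_monomial, Finsupp.prod_fintype _ _ (by simp), Fin.prod_univ_three, hs0]
        simp
      · intro t ht hts
        rw [restr, aeval_monomial, Finsupp.prod_fintype _ _ (by simp), Fin.prod_univ_three]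
        simp
        by_cases ht2 : t 2 = 0
        · right
          rw [ht2, pow_zero, mul_one, Polynomial.coeff_X_pow, if_neg]
          intro h1
          apply hts
          have d1 : t.degree = d := by
            by_contra hne
            exact (mem_support_iff.mp ht) (hF.coeff_eq_zero hne)
          have d2 : s.degree = d := by
            by_contra hne
            exact hc (hF.coeff_eq_zero hne)
          rw [Finsupp.degree_eq_sum, Fin.sum_univ_three] at d1 d2
          ext i
          fin_cases i
          · change t 0 = s 0
            omega
          · change t 1 = s 1
            omega
          · change t 2 = s 2
            omega
        · right
          simp [ht2]
      · intro h0
        exact absurd (mem_support_iff.mpr hc) h0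
    rw [h] at key
    exact hc (by rw [← key]; simp)

theorem restr_sub (L : Matrix (Fin 3) (Fin 3) ℂ) (u v : Vec) (f : R0) :
    restr u v (sub L f) = restr (L.mulVec u) (L.mulVec v) f := by
  have : (restr u v).comp (sub L) = restr (L.mulVec u) (L.mulVec v) := by
    apply algHom_ext
    intro i
    rw [AlgHom.comp_apply, ← lin_single, sub_lin, restr_lin, restr_lin,
      Matrix.dotProduct_mulVec, Matrix.dotProduct_mulVec]
  exact DFunLike.congr_fun this f

/-- line lemma -/
theorem line_dvd (c u v z : Vec) (hcu : c ⬝ᵥ u = 0) (hcv : c ⬝ᵥ v = 0) (hcz : c ⬝ᵥ z ≠ 0)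
    (hdet : IsUnit (Matrix.of ![u, v, z]).det) {f : R0} {d : ℕ} (hf : f.IsHomogeneous d)
    (h : restr u v f = 0) : lin c ∣ f := by
  set L := (Matrix.of ![u, v, z]).transpose with hLdef
  have hL : IsUnit L.det := by rw [hLdef, Matrix.det_transpose]; exact hdet
  have e0 : L.mulVec (Pi.single 0 1) = u := by
    rw [Matrix.mulVec_single_one]; rfl
  have e1 : L.mulVec (Pi.single 1 1) = v := by
    rw [Matrix.mulVec_single_one]; rfl
  have e2 : L.mulVec (Pi.single 2 1) = z := by
    rw [Matrix.mulVec_single_one]; rfl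
  have h1 : X 2 ∣ sub L f := by
    apply restr_single_zero (sub_hom L hf)
    rw [restr_sub, e0, e1, h]
  have h2 := map_dvd (sub L⁻¹) h1
  rw [sub_sub, Matrix.mul_nonsing_inv _ hL, sub_one] at h2
  have h3 : c = (c ⬝ᵥ z) • Matrix.vecMul (Pi.single 2 1) L⁻¹ := by
    have : Matrix.vecMul c L = (c ⬝ᵥ z) • (Pi.single 2 1 : Vec) := by
      funext j
      fin_cases j
      · simpa [hLdef, Matrix.vecMul] using hcu
      · simpa [hLdef, Matrix.vecMul] using hcv
      · simp [hLdef, Matrix.vecMul]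
    rw [← Matrix.smul_vecMul, ← this, Matrix.vecMul_vecMul, Matrix.mul_nonsing_inv _ hL, Matrix.vecMul_one]
  rw [h3, lin_smul, ← sub_lin, lin_single]
  have hu : IsUnit (C (c ⬝ᵥ z) : R0) := (isUnit_iff_ne_zero.mpr hcz).map C
  exact hu.mul_left_dvd.mpr h2

/-- ω -/
noncomputable def omg : ℂ := Complex.exp (2 * Real.pi * Complex.I / (3:ℕ))
theorem omg_prim : IsPrimitiveRoot omg 3 := Complex.isPrimitiveRoot_exp 3 (by norm_num)

noncomputable def zet (a : Fin 3) : ℂ := omg ^ a.val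

theorem zet_add (a b : Fin 3) : zet (a + b) = zet a * zet b := by
  rw [zet, zet, zet, ← pow_add, Fin.val_add]
  exact (pow_eq_pow_mod _ omg_prim.pow_eq_one).symm

theorem zet_zero : zet 0 = 1 := by simp [zet]

theorem zet_ne (a : Fin 3) : zet a ≠ 0 := pow_ne_zero _ (omg_prim.ne_zero (by norm_num))

theorem zet_inj {a b : Fin 3} (h : zet a = zet b) : a = b :=
  Fin.ext (omg_prim.pow_inj a.2 b.2 h)

theorem zet_sub (a b : Fin 3) : zet (a - b) = zet a / zet b := by
  rw [eq_div_iff (zet_ne b), ← zet_add, sub_add_cancel]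

/-- exponents of the points in the finite blocks -/
def ex (s t : Fin 3) : Fin 3 → Fin 3 := ![0, t, s - t]

noncomputable def ptA (s t : Fin 3) : Vec := fun i => zet (ex s t i)

/-- the twelve points, in four blocks of three -/
noncomputable def pt : Fin 4 → Fin 3 → Vec := Fin.snoc (α := fun _ => Fin 3 → Vec) ptA fun i => Pi.single i 1

theorem pt_castSucc (s t : Fin 3) : pt s.castSucc t = ptA s t := by
  simp [pt]

theorem pt_last (t : Fin 3) : pt (Fin.last 3) t = Pi.single t 1 := by
  rw [pt, Fin.snoc_last]

theorem ptA_ne (s t i : Fin 3) : ptA s t i ≠ 0 := zet_ne _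

theorem pt_ne (k : Fin 4) (t : Fin 3) : pt k t ≠ 0 := by
  induction k using Fin.lastCases with
  | last => rw [pt_last]; simp
  | cast s => 
    rw [pt_castSucc]
    exact fun h => ptA_ne s t 0 (congrFun h 0)

/-- the nine lines -/
noncomputable def ln (i a : Fin 3) : Vec := Pi.single i 1 - zet a • Pi.single (i+1) 1

theorem ln_dot (i a : Fin 3) (p : Vec) : ln i a ⬝ᵥ p = p i - zet a * p (i+1) := by
  rw [ln, sub_dotProduct, smul_dotProduct, single_one_dotProduct, single_one_dotProduct, smul_eq_mul]

theorem ln_ptA (i a s t : Fin 3) : ln i a ⬝ᵥ ptA s t = 0 ↔ ex s t i = a + ex s t (i+1) := by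
  rw [ln_dot, ptA, ptA, ← zet_add, sub_eq_zero]
  exact ⟨zet_inj, congrArg _⟩

theorem ln_single (i a j : Fin 3) : ln i a ⬝ᵥ Pi.single j 1 = 0 ↔ j = i + 2 := by
  rw [ln_dot]
  have : j = i ∨ j = i+1 ∨ j = i+2 := by clear a; revert i j; decide
  have e1 : i + 1 ≠ i := by clear * -; revert i; decide
  have e2 : i + 2 ≠ i := by clear * -; revert i; decide
  have e3 : i + 2 ≠ i + 1 := by clear * -; revert i; decide
  rcases this with rfl | rfl | rfl
  · simp [e1, e2.symm]
  · simp [e1.symm, e3.symm, zet_ne]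
  · simp [e2.symm, e3.symm]

theorem ln_ne (i a : Fin 3) : ln i a ≠ 0 := by
  intro h
  have := (ln_single i a i)
  rw [h, zero_dotProduct] at this
  have h2 := this.mp rfl
  clear * - h2
  revert i; decide

theorem line_restr_zero (i a : Fin 3) {f : R0} {d : ℕ} (hf : f.IsHomogeneous d) (m : Fin 4 → ℕ)
    (hd : d < ∑ k, m k) (hm : ∀ k t, f ∈ Ip (pt k t) ^ m k) : lin (ln i a) ∣ f := by
  have e1 : i + 1 ≠ i := by clear * -; revert i; decide
  have e2 : i + 2 ≠ i := by clear * -; revert i; decide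
  have e3 : i + 2 ≠ i + 1 := by clear * -; revert i; decide
  have e4 : ∀ j : Fin 3, j = i ∨ j = i+1 ∨ j = i+2 := by clear * -; revert i; decide
  set u : Vec := Pi.single (i+2) 1 with hu
  set v : Vec := zet a • Pi.single i 1 + Pi.single (i+1) 1 with hv
  have hex : ∀ s, ∃ t, ex s t i = a + ex s t (i+1) := by
    clear * -; revert i a; decide
  choose t ht using hex
  let τ : Fin 4 → ℂ := Fin.snoc (α := fun _ => ℂ)
    (fun s => zet (ex s (t s) (i+1)) / zet (ex s (t s) (i+2))) 0
  have hτinj : Function.Injective τ := by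
    apply Fin.snoc_injective_of_injective
    · intro s s' h
      have h : zet (ex s (t s) (i+1)) / zet (ex s (t s) (i+2)) = 
        zet (ex s' (t s') (i+1)) / zet (ex s' (t s') (i+2)) := h
      rw [← zet_sub, ← zet_sub] at h
      have h := zet_inj h
      have h1 := ht s
      have h2 := ht s'
      generalize t s = x at *
      generalize t s' = y at *
      clear * - h h1 h2
      revert i a s s' x y
      decide
    · rintro ⟨s, hs⟩
      exact div_ne_zero (zet_ne _) (zet_ne _) hs
  have hdiv : ∀ k, (Polynomial.X - Polynomial.C (τ k)) ^ m k ∣ restr u v f := by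
    intro k
    induction k using Fin.lastCases with
    | last =>
      refine restr_Ip u v (pt (Fin.last 3) (i+2)) _ 1 ?_ _ (hm _ _)
      have hτ0 : τ (Fin.last 3) = 0 := Fin.snoc_last _ _
      rw [pt_last, hτ0]
      simp [hu]
    | cast s =>
      refine restr_Ip u v (pt s.castSucc (t s)) _ (zet (ex s (t s) (i+2)))⁻¹ ?_ _ (hm _ _)
      rw [pt_castSucc]
      have hz := zet_ne (ex s (t s) (i+2))
      funext j
      have h1 := ht s
      rcases e4 j with rfl | rfl | rfl
      · simp [τ, hu, hv, ptA, e1, e2, h1, zet_add]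
        field_simp
      · simp [τ, hu, hv, ptA, e1, e3]
        field_simp
      · simp [τ, hu, hv, ptA, e2, e3, hz]
  have hprod : ∏ k, (Polynomial.X - Polynomial.C (τ k)) ^ m k ∣ restr u v f := by
    refine Finset.prod_dvd_of_coprime ?_ fun k _ => hdiv k
    intro k _ l _ hkl
    exact (Polynomial.pairwise_coprime_X_sub_C hτinj hkl).pow
  have hz : restr u v f = 0 := by
    by_contra hne
    have h1 := Polynomial.natDegree_le_of_dvd hprod hne
    rw [Polynomial.natDegree_prod _ _ fun k _ => pow_ne_zero _ (Polynomial.X_sub_C_ne_zero _)] at h1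
    simp only [Polynomial.natDegree_pow, Polynomial.natDegree_X_sub_C, mul_one] at h1
    have := restr_natDegree u v hf
    omega
  refine line_dvd (ln i a) u v (Pi.single i 1) ?_ ?_ ?_ ?_ hf hz
  · rw [hu, ln_single]
  · rw [ln_dot, hv]
    simp [e1]
  · rw [Ne, ln_single]
    exact e2.symm
  · rw [isUnit_iff_ne_zero, Matrix.det_fin_three]
    rw [hu, hv]
    clear * -
    fin_cases i <;> simp

theorem lin_irred {c : Vec} (hc : c ≠ 0) : Irreducible (lin c) := by
  have h0 : lin c ≠ 0 := fun h => hc (lin_inj h)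
  apply irreducible_of_totalDegree_eq_one
  · exact (lin_hom c).totalDegree h0
  · intro x hx
    by_contra hxu
    have : x = 0 := by simpa using hxu
    subst this
    obtain ⟨s, hs⟩ := MvPolynomial.ne_zero_iff.mp h0
    exact hs (zero_dvd_iff.mp (hx s))

theorem lines_coprime {x y : Fin 3 × Fin 3} (h : x ≠ y) :
    IsRelPrime (lin (ln x.1 x.2)) (lin (ln y.1 y.2)) := by
  rw [(lin_irred (ln_ne _ _)).isRelPrime_iff_not_dvd]
  intro hd
  have : ∃ s t, ex s t x.1 = x.2 + ex s t (x.1+1) ∧ ¬ ex s t y.1 = y.2 + ex s t (y.1+1) := by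
    clear hd
    revert x y
    decide
  obtain ⟨s, t, h1, h2⟩ := this
  rw [← ln_ptA] at h1 h2
  have := map_dvd (eval (ptA s t)) hd
  rw [eval_lin, eval_lin, h1, zero_dvd_iff] at this
  exact h2 this

/-- product of nine lines -/
noncomputable def PP : R0 := ∏ x : Fin 3 × Fin 3, lin (ln x.1 x.2)

theorem PP_dvd {f : R0} {d : ℕ} (hf : f.IsHomogeneous d) (m : Fin 4 → ℕ)
    (hd : d < ∑ k, m k) (hm : ∀ k t, f ∈ Ip (pt k t) ^ m k) : PP ∣ f := by
  refine Finset.prod_dvd_of_isRelPrime ?_ fun x _ => line_restr_zero x.1 x.2 hf m hd hm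
  intro x _ y _ hxy
  exact lines_coprime hxy

theorem PP_ne : PP ≠ 0 := Finset.prod_ne_zero_iff.mpr fun x _ h => ln_ne _ _ (lin_inj h)

theorem PP_hom : PP.IsHomogeneous 9 := by
  have := IsHomogeneous.prod (Finset.univ : Finset (Fin 3 × Fin 3)) (fun x => lin (ln x.1 x.2))
    (fun _ => 1) (fun x _ => lin_hom _)
  rw [PP]
  simpa using this

end Geo3
end EpsIrr

namespace EpsIrr
section Geo4
open MvPolynomial

theorem card_lines (k : Fin 4) (t : Fin 3) :
    (Finset.univ.filter fun x : Fin 3 × Fin 3 => ln x.1 x.2 ⬝ᵥ pt k t = 0).card = 3 := by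
  induction k using Fin.lastCases with
  | last =>
    simp only [pt_last, ln_single]
    revert t; decide
  | cast s =>
    simp only [pt_castSucc, ln_ptA]
    revert s t; decide

theorem prod_lines_mem (p : Vec) (s : Finset (Fin 3 × Fin 3)) :
    ∏ x ∈ s, lin (ln x.1 x.2) ∈ Ip p ^ (s.filter fun x => ln x.1 x.2 ⬝ᵥ p = 0).card := by
  classical
  induction s using Finset.induction_on with
  | empty => simp
  | insert a s ha ih =>
    rw [Finset.prod_insert ha, Finset.filter_insert]
    split_ifs with h
    · rw [Finset.card_insert_of_notMem (by simp [ha]), pow_succ']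
      exact Ideal.mul_mem_mul (lin_mem_Ip h) ih
    · exact Ideal.mul_mem_left _ _ ih

theorem prod_lines_div {p : Vec} (hp : p ≠ 0) (s : Finset (Fin 3 × Fin 3)) (g : R0) (m : ℕ)
    (h : (∏ x ∈ s, lin (ln x.1 x.2)) * g ∈ Ip p ^ m) :
    g ∈ Ip p ^ (m - (s.filter fun x => ln x.1 x.2 ⬝ᵥ p = 0).card) := by
  classical
  induction s using Finset.induction_on generalizing m with
  | empty => simpa using h
  | insert a s ha ih =>
    rw [Finset.prod_insert ha, mul_assoc] at h
    rw [Finset.filter_insert]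
    split_ifs with h1
    · rw [Finset.card_insert_of_notMem (by simp [ha]), add_comm, ← Nat.sub_sub]
      exact ih _ (lin_div hp (ln_ne _ _) h)
    · exact ih _ (lin_div' hp h1 h)

theorem PP_mem (k : Fin 4) (t : Fin 3) : PP ∈ Ip (pt k t) ^ 3 := by
  have := prod_lines_mem (pt k t) Finset.univ
  rwa [card_lines] at this

theorem PP_div (k : Fin 4) (t : Fin 3) (m : ℕ) (g : R0) (h : PP * g ∈ Ip (pt k t) ^ m) :
    g ∈ Ip (pt k t) ^ (m - 3) := by
  have := prod_lines_div (pt_ne k t) Finset.univ g m h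
  rwa [card_lines] at this

/-- forms of degree d with multiplicity m k at block k -/
noncomputable def V (d : ℕ) (m : Fin 4 → ℤ) : Submodule ℂ R0 :=
  Hom d ⊓ ⨅ k, ⨅ t, Jp (pt k t) (m k).toNat

theorem mem_V {d : ℕ} {m : Fin 4 → ℤ} {f : R0} :
    f ∈ V d m ↔ f.IsHomogeneous d ∧ ∀ k t, f ∈ Ip (pt k t) ^ (m k).toNat := by
  simp only [V, Submodule.mem_inf, Submodule.mem_iInf, mem_Jp, mem_homogeneousSubmodule]

theorem V_le (d : ℕ) (m : Fin 4 → ℤ) : V d m ≤ Hom d := inf_le_left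

instance (d : ℕ) (m : Fin 4 → ℤ) : Module.Finite ℂ (V d m) := finite_of_le (V_le d m)

/-- dimension, for integer degrees -/
noncomputable def hz (d : ℤ) (m : Fin 4 → ℤ) : ℕ :=
  if 0 ≤ d then Module.finrank ℂ (V d.toNat m) else 0

theorem finrank_le_of_map {A B : Submodule ℂ R0} [Module.Finite ℂ B] (φ : R0 →ₗ[ℂ] R0)
    (hφ : Function.Injective φ) (h : ∀ f ∈ A, φ f ∈ B) : Module.finrank ℂ A ≤ Module.finrank ℂ B := by
  refine LinearMap.finrank_le_finrank_of_injective (f := φ.restrict h) ?_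
  intro x y hxy
  exact Subtype.ext (hφ (congrArg Subtype.val hxy))

theorem hom_of_mul {A g : R0} {a d : ℕ} (hA : A.IsHomogeneous a) (h0 : A ≠ 0)
    (h : (A * g).IsHomogeneous d) (had : a ≤ d) : g.IsHomogeneous (d - a) := by
  have h1 : A * g = A * homogeneousComponent (d - a) g := by
    have h3 : homogeneousComponent d (A * g) = A * g := by
      rw [homogeneousComponent_of_mem h, if_pos rfl]
    conv_lhs => rw [← h3, ← sum_homogeneousComponent g,
      Finset.mul_sum, map_sum]
    by_cases hd : d - a ∈ Finset.range (g.totalDegree + 1)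
    · rw [Finset.sum_eq_single_of_mem _ hd]
      · have h2 := hA.mul (homogeneousComponent_isHomogeneous (d-a) g)
        rw [homogeneousComponent_of_mem h2, if_pos (by omega)]
      · intro i _ hi
        have h2 := hA.mul (homogeneousComponent_isHomogeneous i g)
        rw [homogeneousComponent_of_mem h2, if_neg (by omega)]
    · rw [homogeneousComponent_eq_zero _ _ (by rw [Finset.mem_range] at hd; omega), mul_zero]
      refine Finset.sum_eq_zero fun i hi => ?_
      have h2 := hA.mul (homogeneousComponent_isHomogeneous i g)
      rw [homogeneousComponent_of_mem h2, if_neg]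
      rintro rfl
      apply hd
      convert hi using 1
      omega
  rw [mul_left_cancel₀ h0 h1]
  exact homogeneousComponent_isHomogeneous _ _

theorem toNat_sub3 (z : ℤ) : (z - 3).toNat = z.toNat - 3 := by omega

theorem hz_ge (d : ℤ) (m : Fin 4 → ℤ) : hz (d - 9) (fun k => m k - 3) ≤ hz d m := by
  unfold hz
  split_ifs with h1 h2
  · refine finrank_le_of_map (LinearMap.mulLeft ℂ PP) (mul_right_injective₀ PP_ne) ?_
    intro f hf
    rw [mem_V] at hf ⊢
    refine ⟨?_, fun k t => ?_⟩
    · have := PP_hom.mul hf.1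
      have e : 9 + (d - 9).toNat = d.toNat := by omega
      rw [e] at this
      exact this
    · have h3 := Ideal.mul_mem_mul (PP_mem k t) (hf.2 k t)
      rw [← pow_add] at h3
      exact Ideal.pow_le_pow_right (by omega) h3
  · omega
  · omega
  · omega

theorem exists_PP {d : ℕ} {m : Fin 4 → ℤ} (h : (d : ℤ) < ∑ k, m k) {f : R0} (hf : f ∈ V d m) :
    PP ∣ f := by
  rw [mem_V] at hf
  refine PP_dvd hf.1 (fun k => (m k).toNat) ?_ hf.2
  have : ∑ k, m k ≤ ∑ k, ((m k).toNat : ℤ) := Finset.sum_le_sum fun k _ => Int.self_le_toNat _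
  have h2 : (d : ℤ) < ((∑ k, (m k).toNat : ℕ) : ℤ) := by push_cast; omega
  exact_mod_cast h2

theorem hz_le (d : ℤ) (m : Fin 4 → ℤ) (h : d < ∑ k, m k) : 
    hz d m ≤ hz (d - 9) (fun k => m k - 3) := by
  unfold hz
  split_ifs with h1 h2 h2
  · have hle : V d.toNat m ≤ Submodule.map (LinearMap.mulLeft ℂ PP) (V (d-9).toNat (fun k => m k - 3)) := by
      intro f hf
      obtain ⟨g, rfl⟩ := exists_PP (by omega) hf
      refine ⟨g, ?_, rfl⟩
      rw [SetLike.mem_coe, mem_V]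
      rw [mem_V] at hf
      refine ⟨?_, fun k t => ?_⟩
      · by_cases hg : g = 0
        · rw [hg]; exact isHomogeneous_zero _ _ _
        have h3 : g.IsHomogeneous (d.toNat - 9) := by
          exact hom_of_mul PP_hom PP_ne hf.1 (by omega)
        convert h3 using 1
        omega
      · rw [toNat_sub3]
        exact PP_div k t _ _ (hf.2 k t)
    refine (Submodule.finrank_mono hle).trans ?_
    exact Submodule.finrank_map_le _ _
  · have : V d.toNat m = ⊥ := by
      rw [eq_bot_iff]
      intro f hf
      obtain ⟨g, rfl⟩ := exists_PP (by omega) hf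
      rw [mem_V] at hf
      rw [Submodule.mem_bot]
      by_contra hne
      have e1 := hf.1.totalDegree hne
      rw [totalDegree_mul_of_isDomain PP_ne (right_ne_zero_of_mul hne), PP_hom.totalDegree PP_ne] at e1
      omega
    rw [this]; simp
  · exact Nat.zero_le _
  · exact le_rfl

end Geo4
end EpsIrr

namespace EpsIrr
section Geo5
open MvPolynomial

set_option linter.unusedSimpArgs false

/-- existence of a nonzero form -/
def Ex (d : ℕ) (m : Fin 4 → ℤ) : Prop := ∃ f ∈ V d m, f ≠ 0

theorem Ex_sub (L : Matrix (Fin 3) (Fin 3) ℂ) (hL : IsUnit L.det) (σ : Fin 4 → Fin 4)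
    (h : ∀ k t, ∃ t', ∃ a : ℂ, L.mulVec (pt k t) = a • pt (σ k) t') {d : ℕ} {m : Fin 4 → ℤ}
    (hE : Ex d m) : Ex d (m ∘ σ) := by
  obtain ⟨f, hf, h0⟩ := hE
  rw [mem_V] at hf
  refine ⟨sub L f, mem_V.mpr ⟨sub_hom L hf.1, fun k t => ?_⟩, fun h => h0 (sub_injective L hL (by rw [h, map_zero]))⟩
  obtain ⟨t', a, ha⟩ := h k t
  exact sub_Ip L ha (hf.2 (σ k) t')

theorem pt_3 (t : Fin 3) : pt 3 t = Pi.single t 1 := pt_last t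
theorem pt_0 (t : Fin 3) : pt 0 t = ptA 0 t := pt_castSucc 0 t
theorem pt_1 (t : Fin 3) : pt 1 t = ptA 1 t := pt_castSucc 1 t
theorem pt_2 (t : Fin 3) : pt 2 t = ptA 2 t := pt_castSucc 2 t

theorem zet1 : zet 1 = omg := by simp [zet]
theorem zet2 : zet 2 = omg ^ 2 := by simp [zet]
theorem zetn1 : zet (-1) = omg ^ 2 := zet2
theorem zetn2 : zet (-2) = omg := zet1
theorem omg3 : omg ^ 3 = 1 := omg_prim.pow_eq_one
theorem omg_sum : 1 + omg + omg ^ 2 = 0 := by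
  have := omg_prim.geom_sum_eq_zero (by norm_num)
  simpa [Finset.sum_range_succ] using this

/-- the diagonal symmetry -/
noncomputable def matD : Matrix (Fin 3) (Fin 3) ℂ := Matrix.diagonal ![1, 1, omg]
/-- the Fourier symmetry -/
noncomputable def matF : Matrix (Fin 3) (Fin 3) ℂ := !![1, 1, 1; 1, omg, omg^2; 1, omg^2, omg]

theorem Ex_D {d : ℕ} {m : Fin 4 → ℤ} (hE : Ex d m) : Ex d (m ∘ ![1, 2, 0, 3]) := by
  refine Ex_sub matD ?_ _ ?_ hE
  · rw [matD, Matrix.det_diagonal, isUnit_iff_ne_zero, Fin.prod_univ_three]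
    simpa using omg_prim.ne_zero (by norm_num)
  · have hA : ∀ s t, matD.mulVec (ptA s t) = (1:ℂ) • ptA (s+1) t := by
      intro s t
      funext i
      rw [matD, Matrix.mulVec_diagonal, one_smul]
      fin_cases i
      · simp [ptA, ex]
      · simp [ptA, ex]
      · simp only [ptA, ex]
        have : s + 1 - t = 1 + (s - t) := by clear * -; revert s t; decide
        simp [this, zet_add, zet1]
    intro k t
    fin_cases k
    · exact ⟨t, 1, by simpa [pt_0, pt_1] using hA 0 t⟩
    · exact ⟨t, 1, by simpa [pt_1, pt_2] using hA 1 t⟩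
    · exact ⟨t, 1, by simpa [pt_2, pt_0] using hA 2 t⟩
    · refine ⟨t, (![1, 1, omg] : Vec) t, ?_⟩
      funext i
      simp [pt_3, matD, Matrix.mulVec_diagonal, Pi.single_apply]
      split_ifs with h
      · rw [h]
      · rfl

theorem Ex_F {d : ℕ} {m : Fin 4 → ℤ} (hE : Ex d m) : Ex d (m ∘ ![3, 2, 1, 0]) := by
  have h3 := omg3
  have hs := omg_sum
  refine Ex_sub matF ?_ _ ?_ hE
  · rw [isUnit_iff_ne_zero, matF, Matrix.det_fin_three]
    simp
    intro h
    have : omg = omg ^ 2 := by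
      linear_combination (-1/3) * h - (1/3) * omg * h3
    have h1 : omg = 1 := by
      have h0 : omg ≠ 0 := omg_prim.ne_zero (by norm_num)
      field_simp at this
      exact this.symm
    exact omg_prim.ne_one (by norm_num) h1
  · intro k t
    fin_cases k
    · refine ⟨-t, 3, ?_⟩
      funext i
      fin_cases t <;> fin_cases i <;> simp [pt_0, pt_3, ptA, ex, matF, Matrix.mulVec, dotProduct, Fin.sum_univ_three, zet_zero, zet1, zet2, zetn1, zetn2]
      all_goals grind
    · refine ⟨-t, (1 - omg ^ 2) * (![1, 1, omg ^ 2] : Vec) t, ?_⟩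
      funext i
      fin_cases t <;> fin_cases i <;> simp [pt_1, pt_2, ptA, ex, matF, Matrix.mulVec, dotProduct, Fin.sum_univ_three, zet_zero, zet1, zet2, zetn1, zetn2]
      all_goals grind
    · refine ⟨t + 1, (1 - omg) * (![1, omg, 1] : Vec) t, ?_⟩
      funext i
      fin_cases t <;> fin_cases i <;> simp [pt_1, pt_2, ptA, ex, matF, Matrix.mulVec, dotProduct, Fin.sum_univ_three, zet_zero, zet1, zet2, zetn1, zetn2]
      all_goals grind
    · refine ⟨t, 1, ?_⟩
      funext i
      fin_cases t <;> fin_cases i <;> simp [pt_0, pt_3, ptA, ex, matF, Matrix.mulVec, dotProduct, Fin.sum_univ_three, zet_zero, zet1, zet2, zetn1, zetn2]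

end Geo5
end EpsIrr

namespace EpsIrr
section Geo6
open MvPolynomial

/-- standard quadratic transformation -/
noncomputable def kap : R0 →ₐ[ℂ] R0 := aeval fun i => X (i+1) * X (i+2)

theorem kap_Ip {p : Vec} (hp : ∀ i, p i ≠ 0) (μ : ℕ) {f : R0} (hf : f ∈ Ip p ^ μ) :
    kap f ∈ Ip (fun i => (p i)⁻¹) ^ μ := by
  have h1 : (Ip p).map kap ≤ Ip (fun i => (p i)⁻¹) := by
    nth_rewrite 1 [Ip]
    rw [Ideal.map_span, Ideal.span_le]
    rintro _ ⟨_, ⟨c, hc, rfl⟩, rfl⟩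
    have e : kap (lin c) = ∑ i, C (c i) * (X (i+1) * X (i+2)) := by
      simp [kap, lin]
    refine mem_Ip_of_eval (d := 2) ?_ ?_ ?_
    · intro h
      exact inv_ne_zero (hp 0) (congrFun h 0)
    · rw [e]
      refine IsHomogeneous.sum _ _ _ fun i _ => ?_
      simpa using (isHomogeneous_C (Fin 3) (c i)).mul ((isHomogeneous_X ℂ (i+1)).mul (isHomogeneous_X ℂ (i+2)))
    · rw [e]
      have h0 := hp 0
      have h1 := hp 1
      have h2 := hp 2
      have hc : c 0 * p 0 + c 1 * p 1 + c 2 * p 2 = 0 := by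
        rw [← hc, dotProduct, Fin.sum_univ_three]
      rw [Fin.sum_univ_three]
      simp only [map_add, map_mul, eval_C, eval_X]
      change c 0 * ((p 1)⁻¹ * (p 2)⁻¹) + c 1 * ((p 2)⁻¹ * (p 0)⁻¹) + c 2 * ((p 0)⁻¹ * (p 1)⁻¹) = 0
      field_simp
      linear_combination hc
  have h2 := Ideal.mem_map_of_mem kap hf
  rw [Ideal.map_pow] at h2
  exact Ideal.pow_right_mono h1 μ h2

/-- exponent inversion -/
noncomputable def inv (e : ℕ) (s : Fin 3 →₀ ℕ) : Fin 3 →₀ ℕ :=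
  Finsupp.equivFunOnFinite.symm fun i => e - s i

theorem inv_apply (e : ℕ) (s : Fin 3 →₀ ℕ) (i : Fin 3) : inv e s i = e - s i := rfl

/-- Cremona transform of a form -/
noncomputable def crem (e : ℕ) (f : R0) : R0 := ∑ s ∈ f.support, monomial (inv e s) (coeff s f)

theorem deg3 (s : Fin 3 →₀ ℕ) : s.degree = s 0 + s 1 + s 2 := by
  rw [Finsupp.degree_eq_sum, Fin.sum_univ_three]

theorem kap_eq {d m : ℕ} {f : R0} (hf : f.IsHomogeneous d) (hm : ∀ s ∈ f.support, ∀ i, m + s i ≤ d) :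
    kap f = (X 0 * X 1 * X 2) ^ m * crem (d - m) f := by
  conv_lhs => rw [f.as_sum]
  rw [map_sum, crem, Finset.mul_sum]
  refine Finset.sum_congr rfl fun s hs => ?_
  have hd : s.degree = d := by
    by_contra hne
    exact (mem_support_iff.mp hs) (hf.coeff_eq_zero hne)
  rw [deg3] at hd
  have h0 := hm s hs 0
  have h1 := hm s hs 1
  have h2 := hm s hs 2
  rw [kap, aeval_monomial, monomial_eq, Finsupp.prod_fintype _ _ (by simp),
    Finsupp.prod_fintype _ _ (by simp), Fin.prod_univ_three, Fin.prod_univ_three, algebraMap_eq]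
  simp only [inv_apply]
  change C (coeff s f) * ((X 1 * X 2) ^ s 0 * (X 2 * X 0) ^ s 1 * (X 0 * X 1) ^ s 2) = _
  have e0 : d - m - s 0 + m = s 1 + s 2 := by omega
  have e1 : d - m - s 1 + m = s 0 + s 2 := by omega
  have e2 : d - m - s 2 + m = s 0 + s 1 := by omega
  calc C (coeff s f) * (((X 1 : R0) * X 2) ^ s 0 * (X 2 * X 0) ^ s 1 * (X 0 * X 1) ^ s 2)
      = C (coeff s f) * (X 0 ^ (s 1 + s 2) * X 1 ^ (s 0 + s 2) * X 2 ^ (s 0 + s 1)) := by ring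
    _ = _ := by rw [← e0, ← e1, ← e2]; ring

theorem crem_ne {d m : ℕ} {f : R0} (h0 : f ≠ 0) (hm : ∀ s ∈ f.support, ∀ i, m + s i ≤ d) :
    crem (d - m) f ≠ 0 := by
  obtain ⟨s, hs⟩ := MvPolynomial.ne_zero_iff.mp h0
  rw [MvPolynomial.ne_zero_iff]
  refine ⟨inv (d-m) s, ?_⟩
  rw [crem, coeff_sum, Finset.sum_eq_single s]
  · rwa [coeff_monomial, if_pos rfl]
  · intro t ht hts
    rw [coeff_monomial, if_neg]
    intro h
    apply hts
    ext i
    have h1 := DFunLike.congr_fun h i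
    rw [inv_apply, inv_apply] at h1
    have h2 := hm t ht i
    have h3 := hm s (mem_support_iff.mpr hs) i
    omega
  · intro h
    exact absurd (mem_support_iff.mpr hs) h

theorem Ex_cremona {d : ℕ} {m : Fin 4 → ℤ} (hE : Ex d m) (hm0 : 0 ≤ m 3) :
    ∃ d' : ℕ, (d' : ℤ) = 2 * d - 3 * m 3 ∧ Ex d' ![m 0, m 2, m 1, d - 2 * m 3] := by
  obtain ⟨f, hf, h0⟩ := hE
  rw [mem_V] at hf
  obtain ⟨μ, hμ⟩ := Int.eq_ofNat_of_zero_le hm0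
  have hsd : ∀ s ∈ f.support, s 0 + s 1 + s 2 = d := by
    intro s hs
    by_contra hne
    rw [← deg3] at hne
    exact (mem_support_iff.mp hs) (hf.1.coeff_eq_zero hne)
  have hm : ∀ s ∈ f.support, ∀ i, μ + s i ≤ d := by
    intro s hs i
    have h1 := hf.2 3 i
    rw [pt_3, mem_Ip_single_pow, hμ, Int.toNat_natCast] at h1
    have := h1 s hs
    rwa [deg3, hsd s hs] at this
  obtain ⟨s0, hs0⟩ := MvPolynomial.ne_zero_iff.mp h0
  have hs0 := mem_support_iff.mpr hs0
  have g0 := hm s0 hs0 0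
  have g1 := hm s0 hs0 1
  have g2 := hm s0 hs0 2
  have g3 := hsd s0 hs0
  refine ⟨2 * d - 3 * μ, by omega, crem (d - μ) f, ?_, crem_ne h0 hm⟩
  rw [mem_V]
  refine ⟨?_, ?_⟩
  · refine IsHomogeneous.sum _ _ _ fun s hs => ?_
    apply isHomogeneous_monomial
    rw [deg3]
    simp only [inv_apply]
    have g0 := hm s hs 0
    have g1 := hm s hs 1
    have g2 := hm s hs 2
    have g3 := hsd s hs
    omega
  · have hA : ∀ s s' t t' : Fin 3, (ptA s t = fun i => (ptA s' t' i)⁻¹) → ∀ k : ℕ, 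
        f ∈ Ip (ptA s' t') ^ k → crem (d - μ) f ∈ Ip (ptA s t) ^ k := by
      intro s s' t t' h k hk
      have h1 := kap_Ip (fun i => ptA_ne s' t' i) k hk
      rw [← h, kap_eq hf.1 hm] at h1
      refine point_primary (a := 0) (fun h => ptA_ne s t 0 (congrFun h 0)) ?_ (by rw [zero_add]; exact h1)
      intro h2
      rw [zero_add, pow_one] at h2
      have h3 := eval_Ip h2
      simp [ptA_ne] at h3
    have hinv : ∀ s t, ptA s t = fun i => (ptA (-s) (-t) i)⁻¹ := by
      intro s t
      funext i
      apply eq_inv_of_mul_eq_one_left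
      rw [ptA, ptA, ← zet_add, ← zet_zero]
      congr 1
      revert s t i
      decide
    intro k t
    fin_cases k
    · simpa [pt_0] using hA 0 0 t (-t) (hinv 0 t) _ (by rw [← pt_0]; exact hf.2 0 (-t))
    · simpa [pt_1] using hA 1 2 t (-t) (hinv 1 t) _ (by rw [← pt_2]; exact hf.2 2 (-t))
    · simpa [pt_2] using hA 2 1 t (-t) (hinv 2 t) _ (by rw [← pt_1]; exact hf.2 1 (-t))
    · change crem (d - μ) f ∈ Ip (pt 3 t) ^ ((d : ℤ) - 2 * m 3).toNat
      rw [pt_3, crem]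
      refine Ideal.sum_mem _ fun s hs => ?_
      rw [mem_Ip_single_pow]
      intro r hr
      have hr := support_monomial_subset hr
      rw [Finset.mem_singleton] at hr
      subst hr
      rw [deg3]
      simp only [inv_apply]
      have g0 := hm s hs 0
      have g1 := hm s hs 1
      have g2 := hm s hs 2
      have g4 := hm s hs t
      have g3 := hsd s hs
      have g5 : s t = s 0 ∨ s t = s 1 ∨ s t = s 2 := by
        fin_cases t <;> simp
      omega

/-- quadratic form -/
def QQ (d : ℤ) (m : Fin 4 → ℤ) : ℤ := (∑ k, (d - 3 * m k)) ^ 2 - ∑ k, (d - 3 * m k) ^ 2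

theorem QQ_nonneg (d : ℕ) : ∀ (m : Fin 4 → ℤ) (_ : Ex d m), 0 ≤ QQ d m := by
  induction d using Nat.strong_induction_on with
  | _ d ih =>
    have key : ∀ (m : Fin 4 → ℤ), Ex d m → (d : ℤ) < 3 * m 3 → 0 ≤ QQ d m := by
      intro m hE h
      obtain ⟨d', hd', hE'⟩ := Ex_cremona hE (by omega)
      have := ih d' (by omega) _ hE'
      convert this using 1
      rw [QQ, QQ, Fin.sum_univ_four, Fin.sum_univ_four, Fin.sum_univ_four, Fin.sum_univ_four, hd']
      simp
      ring
    intro m hE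
    by_cases h3 : (d : ℤ) < 3 * m 3
    · exact key m hE h3
    by_cases h0 : (d : ℤ) < 3 * m 0
    · have := key _ (Ex_F hE) h0
      convert this using 1
      rw [QQ, QQ, Fin.sum_univ_four, Fin.sum_univ_four, Fin.sum_univ_four, Fin.sum_univ_four]
      simp
      ring
    by_cases h1 : (d : ℤ) < 3 * m 1
    · have := key _ (Ex_F (Ex_D hE)) h1
      convert this using 1
      rw [QQ, QQ, Fin.sum_univ_four, Fin.sum_univ_four, Fin.sum_univ_four, Fin.sum_univ_four]
      simp
      ring
    by_cases h2 : (d : ℤ) < 3 * m 2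
    · have := key _ (Ex_F (Ex_D (Ex_D hE))) h2
      convert this using 1
      rw [QQ, QQ, Fin.sum_univ_four, Fin.sum_univ_four, Fin.sum_univ_four, Fin.sum_univ_four]
      simp
      ring
    rw [QQ, Fin.sum_univ_four, Fin.sum_univ_four]
    push Not at h0 h1 h2 h3
    have h0 := sub_nonneg.mpr h0
    have h1 := sub_nonneg.mpr h1
    have h2 := sub_nonneg.mpr h2
    have h3 := sub_nonneg.mpr h3
    generalize (d:ℤ) - 3 * m 0 = a at *
    generalize (d:ℤ) - 3 * m 1 = b at *
    generalize (d:ℤ) - 3 * m 2 = c at *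
    generalize (d:ℤ) - 3 * m 3 = e at *
    have : (a+b+c+e)^2 - (a^2+b^2+c^2+e^2) = 2*(a*b+a*c+a*e+b*c+b*e+c*e) := by ring
    rw [this]
    positivity

theorem hz_zero {d : ℤ} {m : Fin 4 → ℤ} (h : QQ d m < 0) : hz d m = 0 := by
  unfold hz
  split_ifs with h0
  · have : V d.toNat m = ⊥ := by
      rw [eq_bot_iff]
      intro f hf
      rw [Submodule.mem_bot]
      by_contra hne
      have := QQ_nonneg d.toNat m ⟨f, hf, hne⟩
      rw [Int.toNat_of_nonneg h0] at this
      omega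
    rw [this]; simp
  · rfl

end Geo6
end EpsIrr

namespace EpsIrr
section Geo7
open MvPolynomial
set_option linter.unusedSimpArgs false

/-- general line -/
noncomputable def cg : Vec := ![1, 2, 4]

theorem zet_norm (a : Fin 3) : ‖zet a‖ = 1 := by
  rw [zet, norm_pow, omg_prim.norm'_eq_one (by norm_num), one_pow]

theorem cg_pt (k : Fin 4) (t : Fin 3) : cg ⬝ᵥ pt k t ≠ 0 := by
  induction k using Fin.lastCases with
  | last => 
    rw [pt_last, dotProduct_single_one]
    fin_cases t <;> simp [cg]
  | cast s =>
    rw [pt_castSucc, dotProduct, Fin.sum_univ_three]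
    simp only [cg, ptA]
    generalize ex s t 0 = a
    generalize ex s t 1 = b
    generalize ex s t 2 = c
    simp
    intro h
    have h1 : 4 * zet c = -(zet a + 2 * zet b) := by linear_combination h
    have h2 := congrArg norm h1
    rw [norm_neg, norm_mul, zet_norm] at h2
    have h3 := norm_add_le (zet a) (2 * zet b)
    rw [← h2, norm_mul, zet_norm, zet_norm] at h3
    norm_num at h3

theorem V_step (d : ℕ) (m : Fin 4 → ℤ) :
    Module.finrank ℂ (V (d+1) m) ≤ Module.finrank ℂ (V d m) + (d + 2) := by
  set u : Vec := ![2, -1, 0] with hu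
  set v : Vec := ![0, 2, -1] with hv
  have hdeg : ∀ f : V (d+1) m, restr u v f.1 ∈ Polynomial.degreeLT ℂ (d+2) := by
    intro f
    rw [Polynomial.mem_degreeLT]
    have h1 := restr_natDegree u v (mem_V.mp f.2).1
    refine lt_of_le_of_lt Polynomial.degree_le_natDegree ?_
    exact_mod_cast Nat.lt_succ_of_le h1
  let φ : V (d+1) m →ₗ[ℂ] Polynomial.degreeLT ℂ (d+2) :=
    ((restr u v).toLinearMap ∘ₗ (V (d+1) m).subtype).codRestrict _ hdeg
  have h1 := φ.finrank_range_add_finrank_ker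
  have hfr : Module.finrank ℂ (Polynomial.degreeLT ℂ (d+2)) = d + 2 := by
    rw [(Polynomial.degreeLTEquiv ℂ (d+2)).finrank_eq]
    simp
  have : Module.Finite ℂ (Polynomial.degreeLT ℂ (d+2)) :=
    Module.Finite.equiv (Polynomial.degreeLTEquiv ℂ (d+2)).symm
  have h2 : Module.finrank ℂ (LinearMap.range φ) ≤ d + 2 :=
    (Submodule.finrank_le _).trans hfr.le
  have hcg : cg ≠ 0 := fun h => by simpa [cg] using congrFun h 0
  have hlg : lin cg ≠ 0 := fun h => hcg (lin_inj h)
  have h3 : Module.finrank ℂ (LinearMap.ker φ) ≤ Module.finrank ℂ (V d m) := by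
    have e1 : Module.finrank ℂ ((LinearMap.ker φ).map (V (d+1) m).subtype) = 
      Module.finrank ℂ (LinearMap.ker φ) := 
      Submodule.finrank_map_subtype_eq (V (d+1) m) (LinearMap.ker φ)
    rw [← e1]
    have hle : (LinearMap.ker φ).map (V (d+1) m).subtype ≤ 
      Submodule.map (LinearMap.mulLeft ℂ (lin cg)) (V d m) := by
      rintro _ ⟨f, hf, rfl⟩
      have hz : restr u v f.1 = 0 := congrArg Subtype.val (LinearMap.mem_ker.mp hf)
      have hfV := mem_V.mp f.2
      obtain ⟨g, hg⟩ := line_dvd cg u v ![1,0,0] (by simp [cg, hu, dotProduct, Fin.sum_univ_three])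
        (by simp [cg, hv, dotProduct, Fin.sum_univ_three]; norm_num) (by simp [cg, dotProduct, Fin.sum_univ_three])
        (by rw [Matrix.det_fin_three]; simp [hu, hv]) hfV.1 hz
      refine ⟨g, ?_, hg.symm⟩
      rw [hg] at hfV
      rw [SetLike.mem_coe, mem_V]
      refine ⟨?_, fun k t => lin_div' (pt_ne k t) (cg_pt k t) (hfV.2 k t)⟩
      exact hom_of_mul (lin_hom cg) hlg hfV.1 (by omega)
    exact (Submodule.finrank_mono hle).trans (Submodule.finrank_map_le _ _)
  omega

theorem V_mono (d : ℕ) (m : Fin 4 → ℤ) :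
    Module.finrank ℂ (V d m) ≤ Module.finrank ℂ (V (d+1) m) := by
  refine finrank_le_of_map (LinearMap.mulLeft ℂ (X 0)) (mul_right_injective₀ (X_ne_zero 0)) ?_
  intro f hf
  rw [mem_V] at hf ⊢
  refine ⟨?_, fun k t => Ideal.mul_mem_left _ _ (hf.2 k t)⟩
  rw [add_comm]
  exact (isHomogeneous_X ℂ 0).mul hf.1

theorem block_step {A : Submodule ℂ R0} {d : ℕ} (hA : A ≤ Hom d) (k : Fin 4) (m : ℕ) :
    Module.finrank ℂ ↥(A ⊓ ⨅ t, Jp (pt k t) m) ≤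
      Module.finrank ℂ ↥(A ⊓ ⨅ t, Jp (pt k t) (m+1)) + 3 * (m+1) := by
  have e : ∀ B : Fin 3 → Submodule ℂ R0, ⨅ t, B t = B 0 ⊓ B 1 ⊓ B 2 := by
    intro B
    apply le_antisymm
    · exact le_inf (le_inf (iInf_le _ _) (iInf_le _ _)) (iInf_le _ _)
    · refine le_iInf fun t => ?_
      fin_cases t
      · exact inf_le_left.trans inf_le_left
      · exact inf_le_left.trans inf_le_right
      · exact inf_le_right
  rw [e, e]
  have h0 := finrank_step (pt_ne k 0) (A := A ⊓ Jp (pt k 1) m ⊓ Jp (pt k 2) m) (d := d)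
    (inf_le_left.trans (inf_le_left.trans hA)) m
  have h1 := finrank_step (pt_ne k 1) (A := A ⊓ Jp (pt k 0) (m+1) ⊓ Jp (pt k 2) m) (d := d)
    (inf_le_left.trans (inf_le_left.trans hA)) m
  have h2 := finrank_step (pt_ne k 2) (A := A ⊓ Jp (pt k 0) (m+1) ⊓ Jp (pt k 1) (m+1)) (d := d)
    (inf_le_left.trans (inf_le_left.trans hA)) m
  have e0 : A ⊓ (Jp (pt k 0) m ⊓ Jp (pt k 1) m ⊓ Jp (pt k 2) m) =
    A ⊓ Jp (pt k 1) m ⊓ Jp (pt k 2) m ⊓ Jp (pt k 0) m := by ac_rfl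
  have e1 : A ⊓ Jp (pt k 1) m ⊓ Jp (pt k 2) m ⊓ Jp (pt k 0) (m+1) =
    A ⊓ Jp (pt k 0) (m+1) ⊓ Jp (pt k 2) m ⊓ Jp (pt k 1) m := by ac_rfl
  have e2 : A ⊓ Jp (pt k 0) (m+1) ⊓ Jp (pt k 2) m ⊓ Jp (pt k 1) (m+1) =
    A ⊓ Jp (pt k 0) (m+1) ⊓ Jp (pt k 1) (m+1) ⊓ Jp (pt k 2) m := by ac_rfl
  have e3 : A ⊓ (Jp (pt k 0) (m+1) ⊓ Jp (pt k 1) (m+1) ⊓ Jp (pt k 2) (m+1)) = 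
    A ⊓ Jp (pt k 0) (m+1) ⊓ Jp (pt k 1) (m+1) ⊓ Jp (pt k 2) (m+1) := by ac_rfl
  rw [e0, e3]
  rw [e1] at h0
  rw [e2] at h1
  omega

theorem V_update (d : ℕ) (m : Fin 4 → ℤ) (k : Fin 4) (h : 0 ≤ m k) :
    Module.finrank ℂ (V d m) ≤ Module.finrank ℂ (V d (Function.update m k (m k + 1))) + 3 * ((m k).toNat + 1) := by
  let A : Submodule ℂ R0 := Hom d ⊓ ⨅ j, ⨅ (_ : j ≠ k), ⨅ t, Jp (pt j t) (m j).toNat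
  have hV : ∀ v : ℤ, V d (Function.update m k v) = A ⊓ ⨅ t, Jp (pt k t) v.toNat := by
    intro v
    ext f
    rw [mem_V]
    simp only [A, Submodule.mem_inf, Submodule.mem_iInf, mem_Jp, mem_homogeneousSubmodule]
    constructor
    · rintro ⟨h1, h2⟩
      refine ⟨⟨h1, fun j hj t => ?_⟩, fun t => ?_⟩
      · simpa [Function.update_of_ne hj] using h2 j t
      · simpa using h2 k t
    · rintro ⟨⟨h1, h2⟩, h3⟩
      refine ⟨h1, fun j t => ?_⟩
      by_cases hj : j = k
      · subst hj; simpa using h3 t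
      · simpa [Function.update_of_ne hj] using h2 j hj t
  have h1 := block_step (A := A) (d := d) inf_le_left k (m k).toNat
  have h2 := hV (m k)
  rw [Function.update_eq_self] at h2
  rw [h2, hV]
  have : (m k + 1).toNat = (m k).toNat + 1 := by omega
  rw [this]
  exact h1

theorem hz_update (d : ℤ) (m : Fin 4 → ℤ) (k : Fin 4) (h : 0 ≤ m k) :
    (hz d m : ℤ) ≤ hz d (Function.update m k (m k + 1)) + 3 * (m k + 1) := by
  unfold hz
  split_ifs
  · have := V_update d.toNat m k h
    omega
  · push_cast
    omega

theorem hz_update3 (d : ℤ) (m : Fin 4 → ℤ) (h : 0 ≤ m 0) :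
    (hz d m : ℤ) ≤ hz d (Function.update m 0 (m 0 + 3)) + (9 * m 0 + 18) := by
  have h1 := hz_update d m 0 h
  have h2 := hz_update d (Function.update m 0 (m 0 + 1)) 0 (by simp; omega)
  have h3 := hz_update d (Function.update m 0 (m 0 + 1 + 1)) 0 (by simp; omega)
  simp only [Function.update_self, Function.update_idem] at h2 h3
  have e : m 0 + 1 + 1 + 1 = m 0 + 3 := by ring
  rw [e] at h3
  omega

theorem hz_upper_step (d : ℤ) (m : Fin 4 → ℤ) (h : 0 ≤ m 0) (hd : d ≤ ∑ k, m k + 2) :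
    (hz d m : ℤ) ≤ hz (d - 9) ![m 0, m 1 - 3, m 2 - 3, m 3 - 3] + (9 * m 0 + 18) := by
  have h1 := hz_update3 d m h
  have h2 := hz_le d (Function.update m 0 (m 0 + 3)) (by
    rw [Fin.sum_univ_four] at hd ⊢
    simp
    omega)
  have e : (fun k => Function.update m 0 (m 0 + 3) k - 3) = ![m 0, m 1 - 3, m 2 - 3, m 3 - 3] := by
    funext k
    fin_cases k <;> simp
  rw [e] at h2
  omega

theorem hz_upper_iter (N : ℕ) : ∀ (d : ℤ) (m : Fin 4 → ℤ) (_ : 0 ≤ m 0) (_ : d ≤ ∑ k, m k + 2),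
    (hz d m : ℤ) ≤ hz (d - 9 * N) ![m 0, m 1 - 3 * N, m 2 - 3 * N, m 3 - 3 * N] + N * (9 * m 0 + 18) := by
  induction N with
  | zero =>
    intro d m _ _
    have : m = ![m 0, m 1, m 2, m 3] := by
      funext k
      fin_cases k <;> simp
    simp
    rw [← this]
  | succ N ih =>
    intro d m h hd
    have h1 := hz_upper_step d m h hd
    have h2 := ih (d - 9) ![m 0, m 1 - 3, m 2 - 3, m 3 - 3] (by simpa) (by
      rw [Fin.sum_univ_four] at hd ⊢
      simp
      omega)
    simp at h2
    push_cast
    have e1 : d - 9 - 9 * (N:ℤ) = d - 9 * (N + 1) := by ring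
    have e2 : ∀ z : ℤ, z - 3 - 3 * (N:ℤ) = z - 3 * (N+1) := by intro z; ring
    rw [e1, e2, e2, e2] at h2
    linarith

theorem hz_down (j : ℕ) : ∀ (d : ℤ) (m : Fin 4 → ℤ) (_ : d + 3 * j < ∑ k, m k + 3),
    hz d m = hz (d - 9 * j) (fun k => m k - 3 * j) := by
  induction j with
  | zero => intro d m _; simp
  | succ j ih =>
    intro d m h
    push_cast at h
    have h1 := le_antisymm (hz_le d m (by omega)) (hz_ge d m)
    rw [h1, ih (d-9) (fun k => m k - 3)]
    · congr 1
      · push_cast; ring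
      · funext k; push_cast; ring
    · rw [Fin.sum_univ_four] at h ⊢
      omega

theorem V_lower_nat (d : ℕ) (k : Fin 4) (m : Fin 4 → ℤ) (hm : m k = 0) (v : ℕ) :
    2 * Module.finrank ℂ (V d m) ≤ 2 * Module.finrank ℂ (V d (Function.update m k v)) + 3 * (v * (v+1)) := by
  induction v with
  | zero => 
    have : Function.update m k ((0:ℕ):ℤ) = m := by rw [Nat.cast_zero, ← hm, Function.update_eq_self]
    rw [this]
    omega
  | succ v ih =>
    have := V_update d (Function.update m k v) k (by simp)
    have e1 : Function.update m k (v:ℤ) k = v := Function.update_self ..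
    rw [e1, Function.update_idem, Int.toNat_natCast] at this
    push_cast
    nlinarith

theorem hz_lower (d : ℤ) (m : Fin 4 → ℤ) (hd : 0 ≤ d) :
    (d+1)*(d+2) - 3 * ∑ k, m k * (m k + 1) ≤ 2 * hz d m := by
  have h := finrank_Hom_ge d.toNat
  have h0 : V d.toNat (fun _ => 0) = Hom d.toNat := by
    ext f
    simp [mem_V]
  have e0 := V_lower_nat d.toNat 0 (fun _ => 0) rfl (m 0).toNat
  have e1 := V_lower_nat d.toNat 1 (Function.update (fun _ => 0) 0 ↑(m 0).toNat) (by simp) (m 1).toNat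
  have e2 := V_lower_nat d.toNat 2 (Function.update (Function.update (fun _ => 0) 0 ↑(m 0).toNat) 1 ↑(m 1).toNat) (by simp) (m 2).toNat
  have e3 := V_lower_nat d.toNat 3 (Function.update (Function.update (Function.update (fun _ => 0) 0 ↑(m 0).toNat) 1 ↑(m 1).toNat) 2 ↑(m 2).toNat) (by simp) (m 3).toNat
  have hmx : ∀ z : ℤ, (max z 0).toNat = z.toNat := by intro z; omega
  have hV : V d.toNat (Function.update (Function.update (Function.update (Function.update (fun _ => 0) 0 ↑(m 0).toNat) 1 ↑(m 1).toNat) 2 ↑(m 2).toNat) 3 ↑(m 3).toNat) = V d.toNat m := by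
    ext f
    rw [mem_V, mem_V]
    refine and_congr_right fun _ => forall_congr' fun k => ?_
    fin_cases k <;> simp [Function.update_apply, Int.ofNat_toNat]
    all_goals rw [hmx]
  rw [hV] at e3
  rw [h0] at e0
  have hh : hz d m = Module.finrank ℂ (V d.toNat m) := by rw [hz, if_pos hd]
  rw [hh, Fin.sum_univ_four]
  have hq : ∀ z : ℤ, (z.toNat : ℤ) * (z.toNat + 1) ≤ z * (z + 1) := by
    intro z
    rcases le_or_gt 0 z with hz | hz
    · rw [Int.toNat_of_nonneg hz]
    · rw [Int.toNat_of_nonpos hz.le]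
      push_cast
      nlinarith
  have q0 := hq (m 0)
  have q1 := hq (m 1)
  have q2 := hq (m 2)
  have q3 := hq (m 3)
  have hc : ((d.toNat : ℤ) + 1) * (d.toNat + 2) ≤ 2 * (Module.finrank ℂ (Hom d.toNat) : ℤ) := by exact_mod_cast h
  rw [Int.toNat_of_nonneg hd] at hc
  zify at e0 e1 e2 e3
  linarith

end Geo7
end EpsIrr

namespace EpsIrr
section Geo8
open MvPolynomial
set_option linter.unusedSimpArgs false

/-- multiplicities -/
def mv (n : ℕ) : Fin 4 → ℤ := ![2 * n, 2 * n, n, n]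

/-- Hilbert function -/
noncomputable def hh (n d : ℕ) : ℕ := Module.finrank ℂ (V d (mv n))

theorem hh_eq (n d : ℕ) : hh n d = hz d (mv n) := by
  simp [hh, hz]

theorem hh_mono (n : ℕ) : Monotone (hh n) := monotone_nat_of_le_succ fun d => V_mono d _

theorem QQ_mv (n d : ℕ) : QQ d (mv n) = 2 * (6 * (d:ℤ)^2 - 54 * d * n + 117 * (n:ℤ)^2) := by
  simp only [QQ, Fin.sum_univ_four, mv]
  simp
  ring

theorem hh_zero (n d : ℕ) (h : 6 * (d:ℤ)^2 - 54 * d * n + 117 * (n:ℤ)^2 < 0) : hh n d = 0 := by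
  rw [hh_eq]
  apply hz_zero
  rw [QQ_mv]
  omega

theorem hh_zero' (n d : ℕ) (hn : 0 < n) (h : d ≤ 5 * n) : hh n d = 0 := by
  have h1 := hh_mono n h
  rw [hh_zero n (5 * n)] at h1
  · omega
  · push_cast
    have : (0:ℤ) < n := by exact_mod_cast hn
    nlinarith

theorem hh_mid (n d : ℕ) (hn : 3 ≤ n) (h1 : 5 * n ≤ d) (h2 : d ≤ 6 * n)
    (he : 0 ≤ 6 * (d:ℤ)^2 - 54 * d * n + 117 * (n:ℤ)^2) :
    3 * (hh n d : ℤ) ≤ 6 * (d:ℤ)^2 - 54 * d * n + 117 * (n:ℤ)^2 + 72 * n + 54 ∧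
    6 * (d:ℤ)^2 - 54 * d * n + 117 * (n:ℤ)^2 - 6 ≤ 3 * hh n d := by
  obtain ⟨j, hj⟩ : ∃ j, j = (6 * n - d + 2) / 3 := ⟨_, rfl⟩
  have hd := hz_down j d (mv n) (by
    simp only [Fin.sum_univ_four, mv]
    simp
    omega)
  rw [hh_eq, hd]
  have hm : (fun k => mv n k - 3 * (j:ℤ)) = ![2 * (n:ℤ) - 3 * j, 2 * n - 3 * j, n - 3 * j, n - 3 * j] := by
    funext k
    fin_cases k <;> simp [mv]
  rw [hm]
  constructor
  · obtain ⟨e, hE⟩ : ∃ e : ℤ, e = 6 * (d:ℤ)^2 - 54 * d * n + 117 * (n:ℤ)^2 := ⟨_, rfl⟩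
    obtain ⟨s, hs⟩ : ∃ s : ℤ, s = 3 * (d:ℤ) - 12 * n := ⟨_, rfl⟩
    have hs0 : 3 * (n:ℤ) ≤ s := by omega
    have hs1 : s ≤ 6 * n := by omega
    rw [← hE] at he ⊢
    obtain ⟨q, hq⟩ : ∃ q : ℤ, q = e / (9 * s) := ⟨_, rfl⟩
    have hspos : 0 < 9 * s := by omega
    have hq0 : 0 ≤ q := by rw [hq]; exact Int.ediv_nonneg he (by omega)
    have hq1 : 9 * s * q ≤ e := by rw [hq]; exact Int.mul_ediv_self_le (by omega)
    have hq2 : e < 9 * s * (q + 1) := by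
      rw [hq]
      have := Int.lt_ediv_add_one_mul_self e hspos
      linarith
    lift q to ℕ using hq0
    have hit := hz_upper_iter (q + 1) (d - 9 * j) 
      ![2 * (n:ℤ) - 3 * j, 2 * n - 3 * j, n - 3 * j, n - 3 * j] (by simp; omega) (by
        simp only [Fin.sum_univ_four]
        simp
        omega)
    have h0 : hz (d - 9 * j - 9 * (q + 1 : ℕ)) ![2 * (n:ℤ) - 3 * j, 2 * n - 3 * j - 3 * (q + 1 : ℕ),
        n - 3 * j - 3 * (q + 1 : ℕ), n - 3 * j - 3 * (q + 1 : ℕ)] = 0 := by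
      apply hz_zero
      have : QQ (d - 9 * j - 9 * (q + 1 : ℕ)) ![2 * (n:ℤ) - 3 * j, 2 * n - 3 * j - 3 * (q + 1 : ℕ),
        n - 3 * j - 3 * (q + 1 : ℕ), n - 3 * j - 3 * (q + 1 : ℕ)] = 2 * (e - 9 * s * (q + 1)) := by
        simp only [QQ, Fin.sum_univ_four]
        simp
        rw [hE, hs]
        ring
      rw [this]
      linarith
    have hit' : (hz (d - 9 * j) ![2 * (n:ℤ) - 3 * j, 2 * n - 3 * j, n - 3 * j, n - 3 * j] : ℤ) ≤ 
      0 + (q + 1 : ℕ) * (9 * (2 * (n:ℤ) - 3 * j) + 18) := by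
      have h0' := congrArg (Nat.cast (R := ℤ)) h0
      rw [Nat.cast_zero] at h0'
      exact hit.trans (add_le_add h0'.le le_rfl)
    generalize (hz (d - 9 * j) ![2 * (n:ℤ) - 3 * j, 2 * n - 3 * j, n - 3 * j, n - 3 * j] : ℤ) = H at hit'
    push_cast at hit'
    have hd6 : (d:ℤ) ≤ 6 * n := by exact_mod_cast h2
    have hd5 : 5 * (n:ℤ) ≤ d := by exact_mod_cast h1
    have he9 : e ≤ 9 * n * n := by rw [hE]; nlinarith
    have hn0 : (0:ℤ) < n := by omega
    have hqn : 3 * (q:ℤ) ≤ n := by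
      have : 9 * (3 * n) * (q:ℤ) ≤ 9 * n * n := by nlinarith
      nlinarith
    have hm0 : 3 * (2 * (n:ℤ) - 3 * j) ≤ s := by omega
    have : (q+1 : ℤ) * (9 * (2 * (n:ℤ) - 3 * j) + 18) ≤ (q + 1) * (3 * s + 18) :=
      mul_le_mul_of_nonneg_left (by linarith) (by omega)
    linarith
  · have hlow := hz_lower (d - 9 * j) ![2 * (n:ℤ) - 3 * j, 2 * n - 3 * j, n - 3 * j, n - 3 * j] (by omega)
    simp only [Fin.sum_univ_four] at hlow
    simp at hlow
    obtain ⟨r, hr, hr3⟩ : ∃ r : ℕ, (d:ℤ) = 6 * n - 3 * j + r ∧ r < 3 := ⟨d + 3 * j - 6 * n, by omega, by omega⟩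
    rw [hr] at hlow ⊢
    interval_cases r <;> push_cast at hlow ⊢ <;> nlinarith

theorem hh_high_lower (n d : ℕ) : 
    (d:ℤ)^2 + 3 * d + 2 - 30 * (n:ℤ)^2 - 18 * n ≤ 2 * hh n d := by
  have hlow := hz_lower d (mv n) (by omega)
  rw [hh_eq]
  simp only [Fin.sum_univ_four, mv] at hlow ⊢
  simp at hlow
  nlinarith

theorem hh_high_upper (n d : ℕ) (hn : 3 ≤ n) (hd : 6 * n ≤ d) : 
    2 * (hh n d : ℤ) ≤ (d:ℤ)^2 + 3 * d - 30 * (n:ℤ)^2 + 30 * n + 36 := by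
  induction d, hd using Nat.le_induction with
  | base =>
    have := (hh_mid n (6 * n) hn (by omega) le_rfl (by push_cast; nlinarith)).1
    push_cast at this ⊢
    nlinarith
  | succ d hd ih =>
    have : hh n (d+1) ≤ hh n d + (d + 2) := V_step d (mv n)
    zify at this
    push_cast
    nlinarith

end Geo8
end EpsIrr

namespace EpsIrr
section Num

open Filter

theorem tele (g : ℕ → ℝ) (P : ℝ → ℝ) (C : ℝ) (a b : ℕ) (hab : a ≤ b)
    (h : ∀ d : ℕ, a ≤ d → d < b → |g d - (P (d+1) - P d)| ≤ C) :
    |∑ d ∈ Finset.Ico a b, g d - (P b - P a)| ≤ C * (b - a) := by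
  induction b, hab using Nat.le_induction with
  | base => simp
  | succ b hb ih =>
    rw [Finset.sum_Ico_succ_top hb]
    have h1 := ih fun d h1 h2 => h d h1 (by omega)
    have h2 := h b hb (by omega)
    have : (∑ d ∈ Finset.Ico a b, g d + g b - (P (b+1 : ℕ) - P a)) =
      (∑ d ∈ Finset.Ico a b, g d - (P b - P a)) + (g b - (P (b+1) - P b)) := by
      push_cast; ring
    rw [this]
    refine (abs_add_le _ _).trans ?_
    push_cast
    linarith

/-- sum of Hilbert function -/
noncomputable def c3 (n : ℕ) : ℕ := ∑ d ∈ Finset.range (18 * n), hh n d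

/-- the limit constant -/
noncomputable def L3 : ℝ := 756 + √3 / 2

theorem b2_aux (n a y : ℝ) (ha : 0 ≤ a) (hy : 0 ≤ y) (a6 : a ≤ 6 * n) (y6 : y ≤ 6 * n) :
    |(2/3) * (a^2 + a * y + y^2) - 9 * n * (a + y) + 39 * n^2| ≤ 300 * n^2 := by
  have q1 : a * a ≤ (6 * n) * (6 * n) := mul_le_mul a6 a6 ha (by linarith)
  have q2 : y * y ≤ (6 * n) * (6 * n) := mul_le_mul y6 y6 hy (by linarith)
  have q3 : a * y ≤ (6 * n) * (6 * n) := mul_le_mul a6 y6 hy (by linarith)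
  have q4 : 0 ≤ a * y := mul_nonneg ha hy
  have hn : 0 ≤ n := by linarith
  have q5 : n * (a + y) ≤ n * (12 * n) := mul_le_mul_of_nonneg_left (by linarith) hn
  have q6 : 0 ≤ n * (a + y) := mul_nonneg hn (by linarith)
  have q7 := mul_self_nonneg a
  have q8 := mul_self_nonneg y
  have q9 := mul_self_nonneg n
  rw [abs_le]
  constructor <;> linarith

set_option maxHeartbeats 1000000 in
theorem c3_est (n : ℕ) (hn : 3 ≤ n) : |(c3 n : ℝ) - L3 * n^3| ≤ 2000 * (n:ℝ)^2 := by
  have hs0 : (0:ℝ) ≤ √3 := Real.sqrt_nonneg _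
  have hs2 : (√3 : ℝ)^2 = 3 := Real.sq_sqrt (by norm_num)
  have hs1 : √3 < 2 := by nlinarith
  have hs1' : 1 < √3 := by nlinarith
  obtain ⟨t0, ht0⟩ : ∃ t0 : ℝ, t0 = (9 + √3)/2 := ⟨_, rfl⟩
  have hroot : 2 * t0^2 - 18 * t0 + 39 = 0 := by rw [ht0]; nlinarith
  have hnr : (3:ℝ) ≤ n := by exact_mod_cast hn
  have hx0 : 0 ≤ t0 * n := by rw [ht0]; positivity
  obtain ⟨a, ha⟩ : ∃ a, a = ⌈t0 * n⌉₊ := ⟨_, rfl⟩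
  have ha1 : t0 * n ≤ a := by rw [ha]; exact Nat.le_ceil _
  have ha2 : (a:ℝ) < t0 * n + 1 := by rw [ha]; exact Nat.ceil_lt_add_one hx0
  have ha6 : a ≤ 6 * n := by
    rw [ha, Nat.ceil_le]; push_cast; rw [ht0]; nlinarith
  have ha5 : 5 * n < a := by
    have : (5 * n : ℝ) < a := lt_of_lt_of_le (by rw [ht0]; nlinarith) ha1
    exact_mod_cast this
  have hz1 : ∑ d ∈ Finset.Ico 0 a, hh n d = 0 := by
    apply Finset.sum_eq_zero
    intro d hd
    rw [Finset.mem_Ico] at hd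
    rcases le_or_gt d (5 * n) with h | h
    · exact hh_zero' n d (by omega) h
    · apply hh_zero
      have h1 : (d:ℝ) < t0 * n := by
        rw [ha] at hd
        exact Nat.lt_ceil.mp hd.2
      have h2 : (5 * n : ℝ) < d := by exact_mod_cast h
      have : (6 * (d:ℝ)^2 - 54 * d * n + 117 * (n:ℝ)^2) < 0 := by
        have e : 6 * (d:ℝ)^2 - 54 * d * n + 117 * (n:ℝ)^2 = 
          6 * (d - t0 * n) * (d - (9 - t0) * n) + 3 * n^2 * (2 * t0^2 - 18 * t0 + 39) := by ring
        rw [e, hroot, mul_zero, add_zero]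
        apply mul_neg_of_neg_of_pos
        · linarith
        · rw [ht0]; nlinarith
      exact_mod_cast this
  let P : ℝ → ℝ := fun x => (2/3) * x^3 - 9 * n * x^2 + 39 * n^2 * x
  let Q : ℝ → ℝ := fun x => x^3/6 - 15 * n^2 * x
  have h2 := tele (fun d => hh n d) P (52 * n) a (6 * n) ha6 (by
    intro d h1 h2
    have h1' : (a:ℝ) ≤ d := by exact_mod_cast h1
    have h2' : (d:ℝ) < 6 * n := by exact_mod_cast h2
    have he : (0:ℝ) ≤ (6 * (d:ℝ)^2 - 54 * d * n + 117 * (n:ℝ)^2) := by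
      have e : 6 * (d:ℝ)^2 - 54 * d * n + 117 * (n:ℝ)^2 = 
          6 * ((d - t0 * n) * (d - (9 - t0) * n)) + 3 * n^2 * (2 * t0^2 - 18 * t0 + 39) := by ring
      rw [e, hroot, mul_zero, add_zero]
      have : 0 ≤ d - t0 * n := by linarith
      have : 0 ≤ d - (9 - t0) * n := by rw [ht0] at ha1 ⊢; nlinarith
      positivity
    obtain ⟨u, l⟩ := hh_mid n d hn (by omega) h2.le (by exact_mod_cast he)
    have u' : 3 * (hh n d : ℝ) ≤ 6 * (d:ℝ)^2 - 54 * d * n + 117 * (n:ℝ)^2 + 72 * n + 54 := by exact_mod_cast u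
    have l' : 6 * (d:ℝ)^2 - 54 * d * n + 117 * (n:ℝ)^2 - 6 ≤ 3 * (hh n d : ℝ) := by exact_mod_cast l
    have d0 : (0:ℝ) ≤ d := by positivity
    rw [abs_le]
    constructor <;> simp only [P] <;> nlinarith)
  have h3 := tele (fun d => hh n d) Q (58 * n) (6 * n) (18 * n) (by omega) (by
    intro d h1 h2
    have h1' : 6 * (n:ℝ) ≤ d := by exact_mod_cast h1
    have h2' : (d:ℝ) < 18 * n := by exact_mod_cast h2
    have u := hh_high_upper n d hn h1
    have l := hh_high_lower n d
    have u' : 2 * (hh n d : ℝ) ≤ (d:ℝ)^2 + 3 * d - 30 * (n:ℝ)^2 + 30 * n + 36 := by exact_mod_cast u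
    have l' : (d:ℝ)^2 + 3 * d + 2 - 30 * (n:ℝ)^2 - 18 * n ≤ 2 * (hh n d : ℝ) := by exact_mod_cast l
    have d0 : (0:ℝ) ≤ d := by positivity
    rw [abs_le]
    constructor <;> simp only [Q] <;> nlinarith)
  have hc : (c3 n : ℝ) = ∑ d ∈ Finset.Ico a (6 * n), (hh n d : ℝ) + ∑ d ∈ Finset.Ico (6 * n) (18 * n), (hh n d : ℝ) := by
    have : c3 n = ∑ d ∈ Finset.Ico 0 a, hh n d + ∑ d ∈ Finset.Ico a (6 * n), hh n d + ∑ d ∈ Finset.Ico (6 * n) (18 * n), hh n d := by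
      rw [Finset.sum_Ico_consecutive _ (by omega) ha6, Finset.sum_Ico_consecutive _ (by omega) (by omega), c3, Finset.range_eq_Ico]
    rw [this, hz1]
    push_cast
    ring
  have hP : |P a - P (t0 * n)| ≤ 300 * (n:ℝ)^2 := by
    have e : P a - P (t0 * n) = (a - t0 * n) * ((2/3) * (a^2 + a * (t0 * n) + (t0 * n)^2) - 9 * n * (a + t0 * n) + 39 * n^2) := by
      simp only [P]; ring
    have a6 : (a:ℝ) ≤ 6 * n := by exact_mod_cast ha6
    rw [e, abs_mul]
    have b1 : |a - t0 * n| ≤ 1 := by rw [abs_le]; constructor <;> linarith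
    have b2 : |(2/3) * ((a:ℝ)^2 + a * (t0 * n) + (t0 * n)^2) - 9 * n * (a + t0 * n) + 39 * (n:ℝ)^2| ≤ 300 * (n:ℝ)^2 := by
      exact b2_aux _ _ _ (by positivity) hx0 a6 (ha1.trans a6)
    calc _ ≤ 1 * (300 * (n:ℝ)^2) := mul_le_mul b1 b2 (abs_nonneg _) (by norm_num)
      _ = _ := by ring
  have hL : P (6 * n) - P (t0 * n) + (Q (18 * n) - Q (6 * n)) = L3 * n^3 := by
    have e : P (6 * n) - P (t0 * n) + (Q (18 * n) - Q (6 * n)) = (810 - ((2/3) * t0^3 - 9 * t0^2 + 39 * t0)) * n^3 := by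
      simp only [P, Q]; ring
    rw [e]
    congr 1
    have : (√3)^3 = 3 * √3 := by rw [pow_succ, hs2]
    rw [L3, ht0]
    linear_combination (-1/12 : ℝ) * this 
  rw [hc]
  have e : ∑ d ∈ Finset.Ico a (6 * n), (hh n d : ℝ) + ∑ d ∈ Finset.Ico (6 * n) (18 * n), (hh n d : ℝ) - L3 * n^3 =
    (∑ d ∈ Finset.Ico a (6 * n), (hh n d : ℝ) - (P (6 * n : ℕ) - P a)) + 
    (∑ d ∈ Finset.Ico (6 * n) (18 * n), (hh n d : ℝ) - (Q (18 * n : ℕ) - Q (6 * n : ℕ))) - (P a - P (t0 * n)) := by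
    rw [← hL]; push_cast; ring
  rw [e]
  refine (abs_sub _ _).trans ?_
  have := abs_add_le (∑ d ∈ Finset.Ico a (6 * n), (hh n d : ℝ) - (P (6 * n : ℕ) - P a)) (∑ d ∈ Finset.Ico (6 * n) (18 * n), (hh n d : ℝ) - (Q (18 * n : ℕ) - Q (6 * n : ℕ)))
  push_cast at *
  have a0 : (0:ℝ) ≤ n * a := by positivity
  nlinarith

theorem sum_est (c : ℕ → ℝ) (L C : ℝ) (hC : 0 ≤ C) (h : ∀ n : ℕ, 3 ≤ n → |c n - L * n^3| ≤ C * (n:ℝ)^2) : 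
    Tendsto (fun n : ℕ => (∑ i ∈ Finset.range n, c (i+1)) / (n:ℝ)^4) atTop (nhds (L/4)) := by
  obtain ⟨D, hD⟩ : ∃ D : ℝ, D = C + |c 1 - L| + |c 2 - L * 8| := ⟨_, rfl⟩
  have hD0 : 0 ≤ D := by rw [hD]; positivity
  have hb : ∀ n : ℕ, |c (n+1) - L * ((n+1:ℕ):ℝ)^3| ≤ D * ((n:ℝ)+1)^2 := by
    intro n
    rcases n with _ | _ | n
    · have := abs_nonneg (c 2 - L * 8)
      simp; rw [hD]; linarith
    · have h1 := abs_nonneg (c 1 - L)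
      have h2 := abs_nonneg (c 2 - L * 8)
      norm_num; rw [hD]; linarith
    · refine (h _ (by omega)).trans ?_
      push_cast
      apply mul_le_mul_of_nonneg_right _ (by positivity)
      have h1 := abs_nonneg (c 1 - L)
      have h2 := abs_nonneg (c 2 - L * 8)
      linarith
  have hs : ∀ n : ℕ, |∑ i ∈ Finset.range n, c (i+1) - L * ((n:ℝ)^2 * (n+1)^2 / 4)| ≤ D * (n:ℝ)^3 := by
    intro n
    induction n with
    | zero => simp
    | succ n ih =>
      rw [Finset.sum_range_succ]
      have h1 := hb n
      have e : ∑ i ∈ Finset.range n, c (i+1) + c (n+1) - L * (((n+1:ℕ):ℝ)^2 * ((n+1:ℕ)+1)^2 / 4) =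
        (∑ i ∈ Finset.range n, c (i+1) - L * ((n:ℝ)^2 * (n+1)^2 / 4)) + (c (n+1) - L * ((n+1:ℕ):ℝ)^3) := by
        push_cast; ring
      rw [e]
      refine (abs_add_le _ _).trans ((add_le_add ih h1).trans ?_)
      rw [← mul_add]
      push_cast
      apply mul_le_mul_of_nonneg_left _ hD0
      have : (0:ℝ) ≤ n := by positivity
      nlinarith
  have h1 : Tendsto (fun n : ℕ => L * ((1 + 1 / (n:ℝ))^2 / 4)) atTop (nhds (L/4)) := by
    have := ((tendsto_one_div_atTop_nhds_zero_nat (𝕜 := ℝ)).const_add 1)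
    have := ((this.pow 2).div_const 4).const_mul L
    simpa [div_eq_mul_inv] using this
  have h2 : Tendsto (fun n : ℕ => (∑ i ∈ Finset.range n, c (i+1)) / (n:ℝ)^4 - L * ((1 + 1 / (n:ℝ))^2 / 4)) atTop (nhds 0) := by
    have h0 : Tendsto (fun n : ℕ => D * (1 / (n:ℝ))) atTop (nhds 0) := by
      simpa using (tendsto_one_div_atTop_nhds_zero_nat (𝕜 := ℝ)).const_mul D
    refine squeeze_zero_norm' ?_ h0
    filter_upwards [eventually_gt_atTop 0] with n hn
    have hn' : (0:ℝ) < n := by exact_mod_cast hn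
    have e : (∑ i ∈ Finset.range n, c (i+1)) / (n:ℝ)^4 - L * ((1 + 1 / (n:ℝ))^2 / 4) = 
      (∑ i ∈ Finset.range n, c (i+1) - L * ((n:ℝ)^2 * (n+1)^2 / 4)) / (n:ℝ)^4 := by
      field_simp
    rw [e, Real.norm_eq_abs, abs_div, abs_of_pos (by positivity : (0:ℝ) < (n:ℝ)^4), div_le_iff₀ (by positivity)]
    refine (hs n).trans (le_of_eq ?_)
    field_simp
  have := h2.add h1
  simpa using this

/-- the lengths -/
noncomputable def cc (n : ℕ) : ℕ := ∑ i ∈ Finset.range n, c3 (i+1)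

theorem cc_tendsto : Tendsto (fun n : ℕ => (cc n : ℝ) / (n:ℝ)^4) atTop (nhds (L3/4)) := by
  have := sum_est (fun n => c3 n) L3 2000 (by norm_num) c3_est
  simpa [cc] using this

theorem L_irr : Irrational (L3/4) := by
  have h3 : Irrational √3 := by simpa using Nat.Prime.irrational_sqrt (p := 3) (by norm_num)
  rintro ⟨q, hq⟩
  apply h3
  refine ⟨8 * q - 1512, ?_⟩
  rw [L3] at hq
  push_cast
  rw [hq]
  ring

theorem not_quasi (c : ℕ → ℕ) (L : ℝ) (hL : Irrational L)
    (h : Tendsto (fun n : ℕ => (c n : ℝ) / (n:ℝ)^4) atTop (nhds L)) (p : ℕ) (hp : 0 < p) 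
    (q : Polynomial ℚ) (N : ℕ) (hq : ∀ n, N ≤ n → n % p = 0 → (c n : ℚ) = q.eval (n:ℚ)) : False := by
  have hsub : Tendsto (fun k : ℕ => p * k) atTop atTop := tendsto_id.const_mul_atTop' hp
  have h1 := h.comp hsub
  have hr : Tendsto (fun k : ℕ => ((p * k : ℕ) : ℝ)) atTop atTop := tendsto_natCast_atTop_atTop.comp hsub
  set Q := q.map (algebraMap ℚ ℝ) with hQ
  have h2 : Tendsto (fun k : ℕ => Q.eval ((p * k : ℕ) : ℝ) / (Polynomial.X ^ 4 : Polynomial ℝ).eval ((p * k : ℕ) : ℝ)) atTop (nhds L) := by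
    refine h1.congr' ?_
    filter_upwards [eventually_ge_atTop N] with k hk
    have := hq (p * k) (hk.trans (Nat.le_mul_of_pos_left k hp)) (by simp)
    simp only [Function.comp, Polynomial.eval_pow, Polynomial.eval_X]
    congr 1
    have h3 := congrArg (algebraMap ℚ ℝ) this
    rw [← Polynomial.eval₂_at_apply, ← Polynomial.eval_map] at h3
    rw [hQ]
    simpa only [map_natCast] using h3
  rcases lt_trichotomy Q.degree (Polynomial.X ^ 4 : Polynomial ℝ).degree with hd | hd | hd
  · have := tendsto_nhds_unique h2 ((Polynomial.div_tendsto_atTop_zero_of_degree_lt _ _ hd).comp hr)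
    exact hL ⟨0, by simp [this]⟩
  · have := tendsto_nhds_unique h2 ((Polynomial.div_tendsto_atTop_leadingCoeff_div_of_degree_eq _ _ hd).comp hr)
    refine hL ⟨q.leadingCoeff, ?_⟩
    rw [this, hQ, Polynomial.leadingCoeff_map]
    simp
  · have h5 := (Polynomial.abs_div_tendsto_atTop_atTop_of_degree_gt Q _ hd (by simp)).comp hr
    exact not_tendsto_nhds_of_tendsto_atTop h5 _ h2.abs

end Num
end EpsIrr

namespace EpsIrr
section CH
open MvPolynomial

theorem ideal_calc1 {R : Type} [CommRing R] (W L K D : Ideal R) :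
    W * ((L ⊔ K) * D) = L * (W * D) ⊔ (W * K) * D := by
  rw [Ideal.sup_mul, Ideal.mul_sup, mul_left_comm, mul_assoc]

theorem ideal_calc2 {R : Type} [CommRing R] (l w h : R) (P Q D : Ideal R) (hl : Ideal.span {l} ≤ Q) :
    Ideal.span {l} * (P * D ⊔ Ideal.span {w * h}) ⊔ (P * Q) * D ≤ P * (Q * D) ⊔ Ideal.span {w * (l * h)} := by
  rw [Ideal.mul_sup, Ideal.span_singleton_mul_span_singleton]
  refine sup_le (sup_le ?_ ?_) ?_
  · refine le_trans ?_ le_sup_left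
    rw [mul_left_comm]
    exact Ideal.mul_mono_right (Ideal.mul_mono_left hl)
  · refine le_trans (le_of_eq ?_) le_sup_right
    rw [mul_left_comm]
  · rw [mul_assoc]; exact le_sup_left

theorem ideal_calc3 {R : Type} [CommRing R] (M P D : Ideal R) (w x : R) (k : ℕ) (hM : M ≤ P ⊔ Ideal.span {w})
    (hle : Ideal.span {w} * D ≤ P * D ⊔ Ideal.span {x}) :
    M * (P ^ k * D) ≤ P ^ (k+1) * D ⊔ Ideal.span {x} * P ^ k := by
  have e1 : P ^ k * (P * D) = P ^ (k+1) * D := by rw [pow_succ, mul_assoc]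
  calc M * (P ^ k * D) ≤ (P ⊔ Ideal.span {w}) * (P ^ k * D) := Ideal.mul_mono_left hM
    _ = P ^ (k+1) * D ⊔ P ^ k * (Ideal.span {w} * D) := by
      rw [Ideal.sup_mul, mul_left_comm (Ideal.span {w}), mul_left_comm P, e1]
    _ ≤ P ^ (k+1) * D ⊔ P ^ k * (P * D ⊔ Ideal.span {x}) :=
      sup_le_sup le_rfl (Ideal.mul_mono_right hle)
    _ ≤ _ := by
      rw [Ideal.mul_sup, e1, mul_comm (Ideal.span {x})]
      exact sup_le le_sup_left le_rfl

theorem ideal_calc4 {R : Type} [CommRing R] (M P D : Ideal R) (w h : R) (k : ℕ) (hM : M ≤ P ⊔ Ideal.span {w})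
    (hle : Ideal.span {w} * D ≤ P * D ⊔ Ideal.span {w * h}) (hhD : h ∈ D) 
    (hprim : ∀ G, (w * h) * G ∈ P ^ (k+1) → G ∈ P ^ (k+1)) (f : R) (hf : f ∈ M * (P ^ k * D)) 
    (hf' : f ∈ P ^ (k+1)) : f ∈ P ^ (k+1) * D := by
  have h1 := ideal_calc3 M P D w (w * h) k hM hle hf
  generalize P ^ (k+1) = B at *
  generalize P ^ k = A at *
  obtain ⟨b, hb, z, hz, hbz⟩ := Submodule.mem_sup.mp h1
  obtain ⟨G, hG, hGz⟩ := Ideal.mem_span_singleton_mul.mp hz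
  have hBD : B * D ≤ B := Ideal.mul_le_left
  have hb' : b ∈ B := hBD hb
  have hG' := hprim G (by
    have : (w * h) * G = f - b := by rw [hGz, ← hbz]; ring
    rw [this]
    exact sub_mem hf' hb')
  have : f = b + w * (G * h) := by rw [← hbz, ← hGz]; ring
  rw [this]
  exact add_mem hb (Ideal.mul_mem_left _ _ (Ideal.mul_mem_mul hG' hhD))

theorem sub_C_mem_mm (a : R0) : a - C (coeff 0 a) ∈ mm := by
  have h := (mem_pow_idealOfVars_iff' (σ := Fin 3) (R := ℂ) 1 (a - C (coeff 0 a))).mpr (by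
    intro x hx
    have : x = 0 := by
      rw [← Finsupp.degree_eq_zero_iff]; omega
    subst this
    simp)
  rwa [pow_one] at h

/-- generated in degree r -/
def Gen (r : ℕ) (B : Ideal R0) : Prop :=
  ∀ f ∈ B, ∃ t ∈ B, t.IsHomogeneous r ∧ f - t ∈ mm * B

theorem Gen_top : Gen 0 ⊤ := by
  intro f _
  refine ⟨C (coeff 0 f), trivial, isHomogeneous_C _ _, ?_⟩
  rw [Ideal.mul_top]
  exact sub_C_mem_mm f

theorem Gen_Ip (p : Vec) : Gen 1 (Ip p) := by
  intro f hf
  refine Submodule.span_induction (p := fun f _ => ∃ t ∈ Ip p, t.IsHomogeneous 1 ∧ f - t ∈ mm * Ip p) ?_ ?_ ?_ ?_ hf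
  · rintro _ ⟨c, hc, rfl⟩
    exact ⟨lin c, lin_mem_Ip hc, lin_hom c, by simp⟩
  · exact ⟨0, zero_mem _, isHomogeneous_zero _ _ _, by simp⟩
  · rintro f g _ _ ⟨t, ht, ht1, ht2⟩ ⟨u, hu, hu1, hu2⟩
    refine ⟨t + u, add_mem ht hu, ht1.add hu1, ?_⟩
    have : f + g - (t + u) = (f - t) + (g - u) := by ring
    rw [this]
    exact add_mem ht2 hu2
  · rintro a f hf ⟨t, ht, ht1, ht2⟩
    refine ⟨C (coeff 0 a) * t, Ideal.mul_mem_left _ _ ht, ?_, ?_⟩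
    · simpa using (isHomogeneous_C (Fin 3) (coeff 0 a)).mul ht1
    · have : a • f - C (coeff 0 a) * t = (a - C (coeff 0 a)) * f + C (coeff 0 a) * (f - t) := by
        rw [smul_eq_mul]; ring
      rw [this]
      exact add_mem (Ideal.mul_mem_mul (sub_C_mem_mm a) hf) (Ideal.mul_mem_left _ _ ht2)

theorem Gen_mul {r s : ℕ} {A B : Ideal R0} (hA : Gen r A) (hB : Gen s B) : Gen (r + s) (A * B) := by
  intro f hf
  refine Submodule.mul_induction_on hf ?_ ?_
  · intro a ha b hb
    obtain ⟨t, ht, ht1, ht2⟩ := hA a ha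
    obtain ⟨u, hu, hu1, hu2⟩ := hB b hb
    refine ⟨t * u, Ideal.mul_mem_mul ht hu, ht1.mul hu1, ?_⟩
    have : a * b - t * u = (a - t) * b + t * (b - u) := by ring
    rw [this]
    refine add_mem ?_ ?_
    · rw [← mul_assoc]; exact Ideal.mul_mem_mul ht2 hb
    · rw [mul_left_comm]; exact Ideal.mul_mem_mul ht hu2
  · rintro f g ⟨t, ht, ht1, ht2⟩ ⟨u, hu, hu1, hu2⟩
    refine ⟨t + u, add_mem ht hu, ht1.add hu1, ?_⟩
    have : f + g - (t + u) = (f - t) + (g - u) := by ring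
    rw [this]
    exact add_mem ht2 hu2

theorem Gen_pow {r : ℕ} {A : Ideal R0} (hA : Gen r A) (k : ℕ) : Gen (k * r) (A ^ k) := by
  induction k with
  | zero => simpa using Gen_top
  | succ k ih => 
    rw [pow_succ, add_mul, one_mul]
    exact Gen_mul ih hA

theorem Gen_inter {r : ℕ} {B : Ideal R0} (hB : Gen r B) (hB' : B ≤ mm ^ r) {f : R0} (hf : f ∈ B)
    (hf' : f ∈ mm ^ (r+1)) : f ∈ mm * B := by
  obtain ⟨t, ht, ht1, ht2⟩ := hB f hf
  have h1 : t ∈ mm ^ (r+1) := by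
    have h2 : f - t ∈ mm ^ (r+1) := by
      rw [pow_succ']
      exact Ideal.mul_mono_right hB' ht2
    have := sub_mem hf' h2
    simpa using this
  have h0 : t = 0 := by
    by_contra h0
    have := hom_mm ht1 h0 h1
    omega
  simpa [h0] using ht2

theorem lin_decomp {p : Vec} {w : Vec} (hw : w ⬝ᵥ p ≠ 0) (c : Vec) :
    ∃ a : ℂ, ∃ c' : Vec, c' ⬝ᵥ p = 0 ∧ c = a • w + c' := by
  refine ⟨(c ⬝ᵥ p) / (w ⬝ᵥ p), c - ((c ⬝ᵥ p) / (w ⬝ᵥ p)) • w, ?_, by simp⟩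
  rw [sub_dotProduct, smul_dotProduct, smul_eq_mul, div_mul_cancel₀ _ hw, sub_self]

theorem mm_le {p w : Vec} (hw : w ⬝ᵥ p ≠ 0) : mm ≤ Ip p ⊔ Ideal.span {lin w} := by
  refine Ideal.span_le.mpr ?_
  rintro _ ⟨i, rfl⟩
  obtain ⟨a, c', hc', h⟩ := lin_decomp hw (Pi.single i 1)
  rw [← lin_single, h, lin_add, lin_smul, add_comm]
  exact Submodule.add_mem_sup (lin_mem_Ip hc') (Ideal.mul_mem_left _ _ (Ideal.mem_span_singleton_self _))

/-- induction predicate -/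
def Good (p w : Vec) (D : Ideal R0) : Prop :=
  ∃ h ∈ D, h ∉ Ip p ∧ Ideal.span {lin w} * D ≤ Ip p * D ⊔ Ideal.span {lin w * h}

theorem Good_top (p w : Vec) : Good p w ⊤ := by
  refine ⟨1, trivial, fun h => ?_, ?_⟩
  · simpa using eval_Ip h
  · rw [mul_one, Ideal.mul_top]
    exact le_sup_right

theorem Good_mul {p w q : Vec} (hp : p ≠ 0) {D : Ideal R0} (hD : Good p w D)
    (hq : ∃ c : Vec, c ⬝ᵥ q = 0 ∧ c ⬝ᵥ p ≠ 0) : Good p w (Ip q * D) := by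
  obtain ⟨h, hhD, hh, hle⟩ := hD
  obtain ⟨l, hl, hlp⟩ := hq
  have hl' : lin l ∉ Ip p := fun h => hlp (by rw [← eval_lin]; exact eval_Ip h)
  refine ⟨lin l * h, Ideal.mul_mem_mul (lin_mem_Ip hl) hhD, fun hm => hh ?_, ?_⟩
  · have := point_primary hp (a := 0) (b := 1) (h := lin l) (g := h) (by simpa using hl') (by simpa using hm)
    simpa using this
  · have h1 : Ip q ≤ Ideal.span {lin l} ⊔ (Ip p ⊓ Ip q) := by
      refine Ideal.span_le.mpr ?_
      rintro _ ⟨c, hc, rfl⟩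
      obtain ⟨a, c', hc', rfl⟩ := lin_decomp hlp c
      have hcq : c' ⬝ᵥ q = 0 := by
        rw [add_dotProduct, smul_dotProduct, hl, smul_zero, zero_add] at hc
        exact hc
      rw [lin_add, lin_smul]
      exact Submodule.add_mem_sup (Ideal.mul_mem_left _ _ (Ideal.mem_span_singleton_self _)) 
        ⟨lin_mem_Ip hc', lin_mem_Ip hcq⟩
    have h2 : Ideal.span {lin w} * (Ip p ⊓ Ip q) ≤ Ip p * Ip q := by
      rw [Ideal.span_singleton_mul_le_iff]
      rintro z ⟨hz1, hz2⟩
      obtain ⟨a, c', hc', hw⟩ := lin_decomp hlp w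
      have : lin w * z = z * (C a * lin l) + lin c' * z := by rw [hw, lin_add, lin_smul]; ring
      rw [this]
      exact add_mem (Ideal.mul_mem_mul hz1 (Ideal.mul_mem_left _ _ (lin_mem_Ip hl))) 
        (Ideal.mul_mem_mul (lin_mem_Ip hc') hz2)
    have hlq : Ideal.span {lin l} ≤ Ip q := by
      rw [Ideal.span_singleton_le_iff_mem]; exact lin_mem_Ip hl
    calc Ideal.span {lin w} * (Ip q * D) ≤ Ideal.span {lin w} * ((Ideal.span {lin l} ⊔ (Ip p ⊓ Ip q)) * D) :=
          Ideal.mul_mono_right (Ideal.mul_mono_left h1)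
      _ = Ideal.span {lin l} * (Ideal.span {lin w} * D) ⊔ (Ideal.span {lin w} * (Ip p ⊓ Ip q)) * D := 
          ideal_calc1 _ _ _ _
      _ ≤ Ideal.span {lin l} * (Ip p * D ⊔ Ideal.span {lin w * h}) ⊔ (Ip p * Ip q) * D :=
          sup_le_sup (Ideal.mul_mono_right hle) (Ideal.mul_mono_left h2)
      _ ≤ _ := ideal_calc2 _ _ _ _ _ _ hlq

theorem Good_pow_mul {p w q : Vec} (hp : p ≠ 0) {D : Ideal R0} (hD : Good p w D)
    (hq : ∃ c : Vec, c ⬝ᵥ q = 0 ∧ c ⬝ᵥ p ≠ 0) (k : ℕ) : Good p w (Ip q ^ k * D) := by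
  induction k with
  | zero => simpa using hD
  | succ k ih =>
    rw [pow_succ', mul_assoc]
    exact Good_mul hp ih hq

theorem CH_step {p w : Vec} (hp : p ≠ 0) (hw : w ⬝ᵥ p ≠ 0) {D : Ideal R0} (hD : Good p w D) {k : ℕ}
    {f : R0} (hf : f ∈ mm * (Ip p ^ k * D)) (hf' : f ∈ Ip p ^ (k+1)) : f ∈ Ip p ^ (k+1) * D := by
  obtain ⟨h, hhD, hh, hle⟩ := hD
  have hwh : lin w * h ∉ Ip p ^ (0+1) := by
    intro hm
    apply hh
    have hw' : lin w ∉ Ip p := fun h => hw (by rw [← eval_lin]; exact eval_Ip h)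
    have := point_primary hp (a := 0) (b := 1) (h := lin w) (g := h) (by simpa using hw') (by simpa using hm)
    simpa using this
  refine ideal_calc4 mm (Ip p) D (lin w) h k (mm_le hw) hle hhD ?_ f hf hf'
  intro G hG
  refine point_primary hp hwh ?_
  rw [zero_add]
  exact hG

theorem exists_dot {p : Vec} (hp : p ≠ 0) : ∃ w : Vec, w ⬝ᵥ p ≠ 0 := by
  obtain ⟨k, hk⟩ := Function.ne_iff.mp hp
  exact ⟨Pi.single k 1, by simpa using hk⟩

theorem prod_le_mm {ι : Type} (s : Finset ι) (p : ι → Vec) (a : ι → ℕ) :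
    ∏ j ∈ s, Ip (p j) ^ a j ≤ mm ^ (∑ j ∈ s, a j) := by
  classical
  induction s using Finset.induction_on with
  | empty => simp
  | insert j s hj ih =>
    rw [Finset.prod_insert hj, Finset.sum_insert hj, pow_add]
    exact Ideal.mul_mono (Ideal.pow_right_mono (Ip_le_mm _) _) ih

theorem Gen_prod {ι : Type} (s : Finset ι) (p : ι → Vec) (a : ι → ℕ) :
    Gen (∑ j ∈ s, a j) (∏ j ∈ s, Ip (p j) ^ a j) := by
  classical
  induction s using Finset.induction_on with
  | empty => simpa using Gen_top
  | insert j s hj ih =>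
    rw [Finset.prod_insert hj, Finset.sum_insert hj]
    exact Gen_mul (by simpa using Gen_pow (Gen_Ip (p j)) (a j)) ih

theorem CH_main {ι : Type} [Fintype ι] [DecidableEq ι] (p : ι → Vec) (hp : ∀ j, p j ≠ 0)
    (hsep : ∀ i j, i ≠ j → ∃ c : Vec, c ⬝ᵥ p i = 0 ∧ c ⬝ᵥ p j ≠ 0) :
    ∀ (r : ℕ) (a : ι → ℕ) (_ : ∑ j, a j = r) (f : R0) (_ : f ∈ mm ^ r) (_ : ∀ j, f ∈ Ip (p j) ^ a j),
      f ∈ ∏ j, Ip (p j) ^ a j := by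
  intro r
  induction r with
  | zero =>
    intro a ha f _ _
    have : ∀ j, a j = 0 := by simpa using ha
    rw [Finset.prod_congr rfl (fun j _ => by rw [this j, pow_zero] : ∀ j ∈ Finset.univ, Ip (p j) ^ a j = 1), Finset.prod_const_one]
    trivial
  | succ r ih =>
    intro a ha f hf hfj
    obtain ⟨j, hj⟩ : ∃ j, a j ≠ 0 := by
      by_contra! h
      simp [h] at ha
    obtain ⟨k, hk⟩ := Nat.exists_eq_succ_of_ne_zero hj
    have hprod : ∀ v, ∏ i, Ip (p i) ^ (Function.update a j v i) = 
        Ip (p j) ^ v * ∏ i ∈ Finset.univ.erase j, Ip (p i) ^ a i := by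
      intro v
      rw [← Finset.mul_prod_erase _ _ (Finset.mem_univ j), Function.update_self]
      congr 1
      refine Finset.prod_congr rfl fun i hi => ?_
      rw [Function.update_of_ne (Finset.ne_of_mem_erase hi)]
    have hsum : ∑ i, Function.update a j k i = r := by
      have h1 := Finset.add_sum_erase Finset.univ a (Finset.mem_univ j)
      rw [← Finset.add_sum_erase _ _ (Finset.mem_univ j), Function.update_self]
      rw [Finset.sum_congr rfl (fun i hi => by rw [Function.update_of_ne (Finset.ne_of_mem_erase hi)] : 
        ∀ i ∈ Finset.univ.erase j, Function.update a j k i = a i)]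
      have h2 : ∑ x ∈ Finset.univ.erase j, a x = (Finset.univ.erase j).sum a := rfl
      rw [h2]
      omega
    have hB' := ih (Function.update a j k) hsum f (Ideal.pow_le_pow_right (by omega) hf) (by
      intro i
      by_cases hi : i = j
      · subst hi
        rw [Function.update_self]
        exact Ideal.pow_le_pow_right (by omega) (hfj i)
      · rw [Function.update_of_ne hi]; exact hfj i)
    have hgen := Gen_prod Finset.univ p (Function.update a j k)
    have hle := prod_le_mm Finset.univ p (Function.update a j k)
    rw [hsum] at hgen hle
    have hm := Gen_inter hgen hle hB' hf
    rw [hprod] at hm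
    have hE := hprod (a j)
    rw [Function.update_eq_self] at hE
    rw [hE, hk]
    obtain ⟨w, hw⟩ := exists_dot (hp j)
    refine CH_step (hp j) hw ?_ hm (by have := hfj j; rwa [hk] at this)
    have : ∀ s : Finset ι, j ∉ s → Good (p j) w (∏ i ∈ s, Ip (p i) ^ a i) := by
      intro s
      induction s using Finset.induction_on with
      | empty => intro _; simpa using Good_top (p j) w
      | insert i s hi ih2 =>
        intro hjs
        rw [Finset.prod_insert hi]
        rw [Finset.mem_insert, not_or] at hjs
        exact Good_pow_mul (hp j) (ih2 hjs.2) (hsep i j (Ne.symm hjs.1)) _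
    exact this _ (Finset.notMem_erase j _)

theorem sep_of {p q : Vec} (i j : Fin 3) (h : q j * p i - q i * p j ≠ 0) : 
    ∃ c : Vec, c ⬝ᵥ q = 0 ∧ c ⬝ᵥ p ≠ 0 := by
  refine ⟨q j • Pi.single i 1 - q i • Pi.single j 1, ?_, ?_⟩
  · simp [sub_dotProduct, mul_comm]
  · simpa [sub_dotProduct] using h

theorem ptA_zero (s t : Fin 3) : ptA s t 0 = 1 := by simp [ptA, ex, zet_zero]
theorem ptA_one (s t : Fin 3) : ptA s t 1 = zet t := by simp [ptA, ex]
theorem ptA_two (s t : Fin 3) : ptA s t 2 = zet (s - t) := by simp [ptA, ex]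

theorem pt_sep (x y : Fin 4 × Fin 3) (hxy : x ≠ y) : 
    ∃ c : Vec, c ⬝ᵥ pt x.1 x.2 = 0 ∧ c ⬝ᵥ pt y.1 y.2 ≠ 0 := by
  obtain ⟨k, t⟩ := x
  obtain ⟨l, u⟩ := y
  have hnz : ∀ s t i, ptA s t i ≠ 0 := fun s t i => zet_ne _
  have h3 : ∀ i : Fin 3, i + 1 ≠ i := by decide
  induction k using Fin.lastCases with
  | last =>
    induction l using Fin.lastCases with
    | last =>
      have htu : t ≠ u := by rintro rfl; exact hxy rfl
      simp only [pt_last]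
      refine sep_of u t ?_
      simp [htu.symm, htu]
    | cast s =>
      simp only [pt_last, pt_castSucc]
      refine sep_of (t+1) t ?_
      simp [h3, hnz]
  | cast s =>
    induction l using Fin.lastCases with
    | last =>
      simp only [pt_last, pt_castSucc]
      refine sep_of u (u+1) ?_
      simp [h3, hnz]
    | cast r =>
      simp only [pt_castSucc]
      by_cases htu : t = u
      · subst htu
        have hsr : s ≠ r := by rintro rfl; exact hxy rfl
        refine sep_of 2 0 ?_
        rw [ptA_zero, ptA_zero, ptA_two, ptA_two, one_mul, mul_one, sub_ne_zero]
        intro h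
        have := zet_inj h
        exact hsr (sub_left_injective this).symm
      · refine sep_of 1 0 ?_
        rw [ptA_zero, ptA_zero, ptA_one, ptA_one, one_mul, mul_one, sub_ne_zero]
        intro h
        exact htu (zet_inj h).symm

/-- multiplicity vector -/
def mu : Fin 4 → ℕ := ![2, 2, 1, 1]

/-- the ideal in three variables -/
noncomputable def I0 : Ideal R0 := ∏ x : Fin 4 × Fin 3, Ip (pt x.1 x.2) ^ mu x.1

theorem mem_I0_pow {n : ℕ} {f : R0} : f ∈ I0 ^ n ↔ 
    f ∈ mm ^ (18 * n) ∧ ∀ k t, f ∈ Ip (pt k t) ^ (n * mu k) := by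
  have e : I0 ^ n = ∏ x : Fin 4 × Fin 3, Ip (pt x.1 x.2) ^ (n * mu x.1) := by
    rw [I0, ← Finset.prod_pow]
    refine Finset.prod_congr rfl fun x _ => ?_
    rw [← pow_mul, mul_comm]
  have hs : ∑ x : Fin 4 × Fin 3, n * mu x.1 = 18 * n := by
    rw [← Finset.mul_sum, mul_comm]
    congr 1
  constructor
  · intro h
    rw [e] at h
    refine ⟨?_, fun k t => ?_⟩
    · rw [← hs]
      exact prod_le_mm _ (fun x : Fin 4 × Fin 3 => pt x.1 x.2) (fun x => n * mu x.1) h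
    · exact Ideal.le_of_dvd (Finset.dvd_prod_of_mem (fun x : Fin 4 × Fin 3 => Ip (pt x.1 x.2) ^ (n * mu x.1)) (Finset.mem_univ (k,t))) h
  · rintro ⟨h1, h2⟩
    rw [e]
    exact CH_main (fun x : Fin 4 × Fin 3 => pt x.1 x.2) (fun x => pt_ne _ _) pt_sep (18 * n) _ hs f h1 (fun x => h2 _ _)

end CH
end EpsIrr

namespace EpsIrr
section FI
open Polynomial

/-- extension of an ideal together with the new variable -/
noncomputable def extX {R : Type} [CommRing R] (I : Ideal R) : Ideal R[X] :=
  I.map C ⊔ Ideal.span {X}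

theorem extX_coeff_zero {R : Type} [CommRing R] (I : Ideal R) {g : R[X]} (hg : g ∈ extX I) :
    g.coeff 0 ∈ I := by
  have : extX I ≤ I.comap constantCoeff := by
    refine sup_le (Ideal.map_le_iff_le_comap.2 fun x hx => ?_) ?_
    · simpa using hx
    · rw [Ideal.span_singleton_le_iff_mem]; simp
  simpa using this hg

theorem mem_extX_pow {R : Type} [CommRing R] (I : Ideal R) (n : ℕ) (f : R[X]) :
    f ∈ extX I ^ n ↔ ∀ j, f.coeff j ∈ I ^ (n - j) := by
  constructor
  · induction n generalizing f with
    | zero => intro _ j; simp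
    | succ n ih =>
      intro hf
      rw [pow_succ] at hf
      refine Submodule.mul_induction_on hf ?_ ?_
      · intro a ha b hb j
        have h0 := extX_coeff_zero I hb
        have ha' := ih a ha
        rw [coeff_mul]
        refine Ideal.sum_mem _ fun x hx => ?_
        rw [Finset.HasAntidiagonal.mem_antidiagonal] at hx
        rcases Nat.eq_zero_or_pos x.2 with h | h
        · rw [h]
          have := Ideal.mul_mem_mul (ha' x.1) h0
          rw [← pow_succ] at this
          exact Ideal.pow_le_pow_right (by omega) this
        · exact Ideal.mul_mem_right _ _ (Ideal.pow_le_pow_right (by omega) (ha' x.1))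
      · intro a b ha hb j
        rw [coeff_add]
        exact Ideal.add_mem _ (ha j) (hb j)
  · intro h
    rw [f.as_sum_range_C_mul_X_pow]
    refine Ideal.sum_mem _ fun j _ => ?_
    have h1 : C (f.coeff j) ∈ extX I ^ (n - j) := by
      have : C (f.coeff j) ∈ (I ^ (n - j)).map C := Ideal.mem_map_of_mem _ (h j)
      rw [Ideal.map_pow] at this
      exact Ideal.pow_right_mono le_sup_left _ this
    have h2 : (X : R[X]) ^ j ∈ extX I ^ j :=
      Ideal.pow_mem_pow (Ideal.mem_sup_right (Ideal.mem_span_singleton_self _)) _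
    have := Ideal.mul_mem_mul h1 h2
    rw [← pow_add] at this
    exact Ideal.pow_le_pow_right (by omega) this

theorem mem_extX {R : Type} [CommRing R] (I : Ideal R) (f : R[X]) :
    f ∈ extX I ↔ f.coeff 0 ∈ I := by
  refine ⟨extX_coeff_zero I, fun h => ?_⟩
  rw [← pow_one (extX I), mem_extX_pow]
  intro j
  rcases Nat.eq_zero_or_pos j with rfl | hj
  · simpa using h
  · rw [show 1 - j = 0 by omega]; simp

/-- coefficientwise ideal -/
def coefIdeal {R : Type} [CommRing R] (A : ℕ → Ideal R) (hA : Antitone A) (n : ℕ) : Ideal R[X] where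
  carrier := {f | ∀ j, f.coeff j ∈ A (n - j)}
  add_mem' := by
    intro a b ha hb j
    rw [coeff_add]
    exact Ideal.add_mem _ (ha j) (hb j)
  zero_mem' := by intro j; simp
  smul_mem' := by
    intro c f hf j
    rw [smul_eq_mul, coeff_mul]
    refine Ideal.sum_mem _ fun x hx => ?_
    rw [Finset.HasAntidiagonal.mem_antidiagonal] at hx
    exact Ideal.mul_mem_left _ _ (hA (by omega) (hf x.2))

theorem mem_coefIdeal {R : Type} [CommRing R] {A : ℕ → Ideal R} {hA : Antitone A} {n : ℕ}
    {f : R[X]} : f ∈ coefIdeal A hA n ↔ ∀ j, f.coeff j ∈ A (n - j) := Iff.rfl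

theorem pow_mul_coef {R : Type} [CommRing R] {A : ℕ → Ideal R} {hA : Antitone A} {m I : Ideal R}
    {q : ℕ} (hq : 1 ≤ q)
    (h : ∀ n f, f ∈ I ^ n ↔ f ∈ m ^ (q * n) ∧ f ∈ A n) (n : ℕ) {f g : R[X]}
    (hf : f ∈ extX m ^ (q * n)) (hg : g ∈ coefIdeal A hA n) : f * g ∈ extX I ^ n := by
  rw [mem_extX_pow] at hf ⊢
  rw [mem_coefIdeal] at hg
  intro j
  rw [coeff_mul]
  refine Ideal.sum_mem _ fun x hx => ?_
  rw [Finset.HasAntidiagonal.mem_antidiagonal] at hx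
  rw [h]
  constructor
  · refine Ideal.mul_mem_right _ _ (Ideal.pow_le_pow_right ?_ (hf x.1))
    rw [Nat.mul_sub]
    have : x.1 ≤ q * j := by nlinarith
    omega
  · exact Ideal.mul_mem_left _ _ (hA (by omega) (hg x.2))

end FI
section Concrete
open Polynomial

/-- the saturated ideals -/
noncomputable def AA (i : ℕ) : Ideal R0 := ⨅ (k : Fin 4) (t : Fin 3), Ip (pt k t) ^ (i * mu k)

theorem mem_AA {i : ℕ} {f : R0} : f ∈ AA i ↔ ∀ k t, f ∈ Ip (pt k t) ^ (i * mu k) := by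
  simp only [AA, Submodule.mem_iInf]

theorem AA_anti : Antitone AA := by
  intro i j hij f hf
  rw [mem_AA] at hf ⊢
  exact fun k t => Ideal.pow_le_pow_right (Nat.mul_le_mul_right _ hij) (hf k t)

/-- the ideal upstairs -/
noncomputable def J0 : Ideal R0[X] := extX I0
/-- the saturation upstairs -/
noncomputable def KK (n : ℕ) : Ideal R0[X] := coefIdeal AA AA_anti n
/-- the maximal ideal upstairs -/
noncomputable def MM : Ideal R0[X] := extX mm

theorem I0_iff (n : ℕ) (f : R0) : f ∈ I0 ^ n ↔ f ∈ mm ^ (18 * n) ∧ f ∈ AA n := by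
  rw [mem_I0_pow, mem_AA]

theorem J0_le_KK (n : ℕ) : J0 ^ n ≤ KK n := by
  intro f hf
  rw [J0, mem_extX_pow] at hf
  exact fun j => ((I0_iff _ _).1 (hf j)).2

theorem MM_mul_KK {n : ℕ} {f g : R0[X]} (hf : f ∈ MM ^ (18 * n)) (hg : g ∈ KK n) :
    f * g ∈ J0 ^ n := pow_mul_coef (by norm_num) I0_iff n hf hg

theorem mem_J0_pow {n : ℕ} {f : R0[X]} (hf : f ∈ KK n) : 
    f ∈ J0 ^ n ↔ ∀ j, f.coeff j ∈ mm ^ (18 * (n - j)) := by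
  rw [J0, mem_extX_pow]
  exact forall_congr' fun j => by rw [I0_iff]; exact ⟨fun h => h.1, fun h => ⟨h, hf j⟩⟩

theorem KK_div {n : ℕ} {f : R0[X]} (h : C (lin cg) * f ∈ KK n) : f ∈ KK n := by
  intro j
  have := h j
  rw [coeff_C_mul, mem_AA] at this
  rw [mem_AA]
  exact fun k t => lin_div' (pt_ne k t) (cg_pt k t) (this k t)

end Concrete
end EpsIrr

namespace EpsIrr
section Len

theorem length_killed {k R N : Type} [Field k] [CommRing R] [Algebra k R] [AddCommGroup N] [Module R N]
    [Module k N] [IsScalarTower k R N] (M : Ideal R) (hM : ∀ r : R, ∃ c : k, r - algebraMap k R c ∈ M)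
    (h : ∀ r ∈ M, ∀ x : N, r • x = 0) : Module.length R N = Module.length k N := by
  have key : ∀ r : R, ∃ c : k, ∀ x : N, r • x = c • x := by
    intro r
    obtain ⟨c, hc⟩ := hM r
    refine ⟨c, fun x => ?_⟩
    have := h _ hc x
    rw [sub_smul, algebraMap_smul, sub_eq_zero] at this
    exact this
  let e : Submodule R N ≃o Submodule k N :=
    { toFun := Submodule.restrictScalars k
      invFun := fun P =>
        { P with
          smul_mem' := by
            intro r x hx
            obtain ⟨c, hc⟩ := key r
            rw [hc]
            exact P.smul_mem c hx }
      left_inv := fun P => rfl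
      right_inv := fun P => rfl
      map_rel_iff' := Iff.rfl }
  apply WithBot.coe_injective
  rw [Module.coe_length, Module.coe_length, Order.krullDim_eq_of_orderIso e]

theorem length_pow {k R : Type} [Field k] [CommRing R] [Algebra k R] (M : Ideal R)
    (hM : ∀ r : R, ∃ c : k, r - algebraMap k R c ∈ M) (n : ℕ) :
    ∀ (N : Type) [AddCommGroup N] [Module R N] [Module k N] [IsScalarTower k R N]
      (_ : ∀ r ∈ M ^ n, ∀ x : N, r • x = 0), Module.length R N = Module.length k N := by
  induction n with
  | zero =>
    intro N _ _ _ _ h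
    have : Subsingleton N := ⟨fun a b => by
      have h1 := h 1 (by simp) a
      have h2 := h 1 (by simp) b
      rw [one_smul] at h1 h2
      rw [h1, h2]⟩
    simp
  | succ n ih =>
    intro N _ _ _ _ h
    let P : Submodule R N := M ^ n • ⊤
    have h1 : Module.length R N = Module.length R P + Module.length R (N ⧸ P) :=
      Module.length_eq_add_of_exact P.subtype P.mkQ P.subtype_injective P.mkQ_surjective
        (LinearMap.exact_subtype_mkQ P)
    have h2 : Module.length k N = Module.length k P + Module.length k (N ⧸ P) :=
      Module.length_eq_add_of_exact (P.subtype.restrictScalars k) (P.mkQ.restrictScalars k)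
        P.subtype_injective P.mkQ_surjective
        (LinearMap.exact_subtype_mkQ P)
    rw [h1, h2, length_killed M hM, ih]
    · intro r hr x
      obtain ⟨x, rfl⟩ := P.mkQ_surjective x
      rw [← map_smul, Submodule.mkQ_apply, Submodule.Quotient.mk_eq_zero]
      exact Submodule.smul_mem_smul hr trivial
    · rintro r hr ⟨x, hx⟩
      refine Subtype.ext ?_
      change r • x = 0
      refine Submodule.smul_induction_on hx ?_ ?_
      · intro a ha y _
        rw [smul_smul]
        exact h _ (by rw [pow_succ']; exact Ideal.mul_mem_mul hr ha) y
      · intro x y hx hy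
        rw [smul_add, hx, hy, add_zero]

end Len
end EpsIrr

namespace EpsIrr
section LocLen

theorem loc_residue {T S : Type} [CommRing T] [Algebra ℂ T] (M : Ideal T) [M.IsMaximal]
    [CommRing S] [IsLocalRing S] [Algebra T S] [Algebra ℂ S] [IsScalarTower ℂ T S]
    [IsLocalization.AtPrime S M]
    (hM : ∀ r : T, ∃ c : ℂ, r - algebraMap ℂ T c ∈ M) (s : S) :
    ∃ c : ℂ, s - algebraMap ℂ S c ∈ M.map (algebraMap T S) := by
  obtain ⟨f, u, rfl⟩ := IsLocalization.exists_mk'_eq M.primeCompl s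
  obtain ⟨b, hb⟩ := Ideal.IsMaximal.exists_inv (I := M) ‹_› u.2
  obtain ⟨a, ha, hab⟩ := hb
  obtain ⟨c, hc⟩ := hM (b * f)
  refine ⟨c, ?_⟩
  have e : IsLocalization.mk' S f u = algebraMap T S (b * f) + algebraMap T S a * IsLocalization.mk' S f u := by
    have h1 : IsLocalization.mk' S f u * algebraMap T S u = algebraMap T S f := IsLocalization.mk'_spec _ _ _
    have h2 : algebraMap T S b * algebraMap T S u + algebraMap T S a = 1 := by
      rw [← map_mul, ← map_add, hab, map_one]
    rw [map_mul]
    linear_combination (-IsLocalization.mk' S f u) * h2 + algebraMap T S b * h1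
  rw [e, IsScalarTower.algebraMap_apply ℂ T S, add_sub_right_comm, ← map_sub]
  exact Ideal.add_mem _ (Ideal.mem_map_of_mem _ hc) (Ideal.mul_mem_right _ _ (Ideal.mem_map_of_mem _ ha))

theorem loc_length {T S : Type} [CommRing T] [Algebra ℂ T] (M : Ideal T) [M.IsMaximal]
    [CommRing S] [IsLocalRing S] [Algebra T S] [Algebra ℂ S] [IsScalarTower ℂ T S]
    [IsLocalization.AtPrime S M]
    (hM : ∀ r : T, ∃ c : ℂ, r - algebraMap ℂ T c ∈ M)
    (I K : Ideal T) (k : ℕ) (hk : ∀ a ∈ M ^ k, ∀ f ∈ K, a * f ∈ I)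
    (W : Type) [AddCommGroup W] [Module ℂ W] [Module.Finite ℂ W]
    (Θ : K.restrictScalars ℂ →ₗ[ℂ] W) (hs : Function.Surjective Θ) (hker : ∀ f, Θ f = 0 ↔ (f : T) ∈ I) :
    Module.length S (Submodule.map (Submodule.mkQ (I.map (algebraMap T S))) (K.map (algebraMap T S))) =
      (Module.finrank ℂ W : ℕ∞) := by
  have cop : ∀ u : M.primeCompl, ∃ a ∈ M ^ k, ∃ b, a + b * u = 1 := by
    intro u
    have h1 : M ⊔ Ideal.span {(u : T)} = ⊤ := by
      obtain ⟨b, a, ha, hab⟩ := Ideal.IsMaximal.exists_inv (I := M) ‹_› u.2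
      rw [Ideal.eq_top_iff_one, ← hab, add_comm]
      exact Submodule.add_mem_sup ha (Ideal.mul_mem_left _ _ (Ideal.mem_span_singleton_self _))
    have h2 : M ^ k ⊔ Ideal.span {(u : T)} = ⊤ := Ideal.pow_sup_eq_top h1
    rw [Ideal.eq_top_iff_one, Submodule.mem_sup] at h2
    obtain ⟨a, ha, c, hc, h⟩ := h2
    rw [Ideal.mem_span_singleton'] at hc
    obtain ⟨b, rfl⟩ := hc
    exact ⟨a, ha, b, h⟩
  have ann : ∀ a ∈ M ^ k, ∀ z ∈ K.map (algebraMap T S), algebraMap T S a * z ∈ I.map (algebraMap T S) := by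
    intro a ha z hz
    refine Submodule.span_induction (p := fun z _ => algebraMap T S a * z ∈ I.map (algebraMap T S)) ?_ ?_ ?_ ?_ hz
    · rintro _ ⟨f, hf, rfl⟩
      rw [← map_mul]
      exact Ideal.mem_map_of_mem _ (hk a ha f hf)
    · simp
    · intro x y _ _ hx hy
      rw [mul_add]
      exact Ideal.add_mem _ hx hy
    · intro c x _ hx
      rw [smul_eq_mul, mul_left_comm]
      exact Ideal.mul_mem_left _ _ hx
  rw [length_pow (k := ℂ) (M.map (algebraMap T S)) (loc_residue M hM) k]
  · let α : K.restrictScalars ℂ →ₗ[ℂ] Submodule.map (Submodule.mkQ (I.map (algebraMap T S))) (K.map (algebraMap T S)) :=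
      { toFun := fun f => ⟨Submodule.mkQ (I.map (algebraMap T S)) (algebraMap T S f),
          Submodule.mem_map_of_mem (Ideal.mem_map_of_mem _ f.2)⟩
        map_add' := by
          intro f g
          refine Subtype.ext ?_
          simp
        map_smul' := by
          intro c f
          refine Subtype.ext ?_
          simp [Algebra.smul_def, ← IsScalarTower.algebraMap_apply] 
          }
    have hα : Function.Surjective α := by
      rintro ⟨_, z, hz, rfl⟩
      obtain ⟨⟨f, u⟩, hfu⟩ := (IsLocalization.mem_map_algebraMap_iff M.primeCompl S).1 hz
      obtain ⟨a, ha, b, hab⟩ := cop u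
      refine ⟨⟨b * f, K.mul_mem_left _ f.2⟩, Subtype.ext ?_⟩
      change Submodule.mkQ (I.map (algebraMap T S)) (algebraMap T S (b * f)) = Submodule.mkQ _ z
      rw [← sub_eq_zero, ← map_sub, Submodule.mkQ_apply, Submodule.Quotient.mk_eq_zero]
      have h2 : algebraMap T S a + algebraMap T S b * algebraMap T S u = 1 := by
        rw [← map_mul, ← map_add, hab, map_one]
      have : algebraMap T S (b * f) - z = - (algebraMap T S a * z) := by
        rw [map_mul]
        simp only at hfu
        linear_combination z * h2 - algebraMap T S b * hfu
      rw [this]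
      exact neg_mem (ann a ha z hz)
    have hαk : ∀ f, α f = 0 ↔ (f : T) ∈ I := by
      intro f
      have : α f = 0 ↔ algebraMap T S f ∈ I.map (algebraMap T S) := by
        rw [← Submodule.Quotient.mk_eq_zero, ← Submodule.mkQ_apply]
        exact Subtype.ext_iff
      rw [this]
      refine ⟨fun h => ?_, Ideal.mem_map_of_mem _⟩
      obtain ⟨u, hu, hf⟩ := (IsLocalization.algebraMap_mem_map_algebraMap_iff M.primeCompl S I f.1).1 h
      obtain ⟨a, ha, b, hab⟩ := cop ⟨u, hu⟩
      have : (f : T) = a * f + b * (u * f) := by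
        linear_combination -(f : T) * hab
      rw [this]
      exact I.add_mem (hk a ha f f.2) (I.mul_mem_left _ hf)
    have hke : LinearMap.ker α = LinearMap.ker Θ := by
      ext f
      rw [LinearMap.mem_ker, LinearMap.mem_ker, hker, hαk]
    have e := (LinearMap.quotKerEquivOfSurjective α hα).symm ≪≫ₗ Submodule.quotEquivOfEq _ _ hke ≪≫ₗ
      LinearMap.quotKerEquivOfSurjective Θ hs
    rw [e.length_eq, Module.length_eq_finrank]
  · rintro r hr ⟨_, z, hz, rfl⟩
    refine Subtype.ext ?_
    change r • Submodule.mkQ (I.map (algebraMap T S)) z = 0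
    rw [← map_smul, Submodule.mkQ_apply, Submodule.Quotient.mk_eq_zero, smul_eq_mul]
    rw [← Ideal.map_pow] at hr
    refine Submodule.span_induction (p := fun r _ => r * z ∈ I.map (algebraMap T S)) ?_ ?_ ?_ ?_ hr
    · rintro _ ⟨a, ha, rfl⟩
      exact ann a ha z hz
    · simp
    · intro x y _ _ hx hy
      rw [add_mul]
      exact Ideal.add_mem _ hx hy
    · intro c x _ hx
      rw [smul_eq_mul, mul_assoc]
      exact Ideal.mul_mem_left _ _ hx

end LocLen
end EpsIrr

namespace EpsIrr
section Theta
open Polynomial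

theorem mv_toNat (i : ℕ) (k : Fin 4) : (mv i k).toNat = i * mu k := by
  fin_cases k <;> simp [mv, mu] <;> omega

theorem mem_mm_pow (N : ℕ) (f : R0) :
    f ∈ mm ^ N ↔ ∀ d < N, MvPolynomial.homogeneousComponent d f = 0 := by
  rw [mm, MvPolynomial.mem_pow_idealOfVars_iff']
  constructor
  · intro h d hd
    ext x
    rw [MvPolynomial.coeff_homogeneousComponent]
    split_ifs with hx
    · rw [h x (by omega)]; simp
    · simp
  · intro h x hx
    have := congrArg (MvPolynomial.coeff x) (h _ hx)
    rw [MvPolynomial.coeff_homogeneousComponent, if_pos rfl] at this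
    simpa using this

/-- target of the graded map -/
abbrev WW (n : ℕ) : Type := (j : Fin n) → (d : Fin (18 * (n - j))) → V d (mv (n - j))

theorem comp_mem_V {i : ℕ} {f : R0} (hf : f ∈ AA i) (d : ℕ) :
    MvPolynomial.homogeneousComponent d f ∈ V d (mv i) := by
  rw [mem_V]
  refine ⟨MvPolynomial.homogeneousComponent_isHomogeneous _ _, fun k t => ?_⟩
  rw [mv_toNat]
  exact Ip_pow_homog _ _ (mem_AA.1 hf k t) d

theorem V_mem_AA {i d : ℕ} {f : R0} (hf : f ∈ V d (mv i)) : f ∈ AA i := by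
  rw [mem_AA]
  intro k t
  rw [← mv_toNat]
  exact (mem_V.1 hf).2 k t

/-- the graded pieces map -/
noncomputable def theta (n : ℕ) : (KK n).restrictScalars ℂ →ₗ[ℂ] WW n where
  toFun f j d := ⟨MvPolynomial.homogeneousComponent d (f.1.coeff j), comp_mem_V (f.2 j) d⟩
  map_add' f g := by
    funext j d
    refine Subtype.ext ?_
    simp
  map_smul' c f := by
    funext j d
    refine Subtype.ext ?_
    simp

theorem theta_ker (n : ℕ) (f) : theta n f = 0 ↔ (f : R0[X]) ∈ J0 ^ n := by
  rw [mem_J0_pow f.2]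
  constructor
  · intro h j
    rw [mem_mm_pow]
    intro d hd
    have hj : j < n := by omega
    exact congrArg Subtype.val (congrFun (congrFun h ⟨j, hj⟩) ⟨d, hd⟩)
  · intro h
    funext j d
    refine Subtype.ext ?_
    exact (mem_mm_pow _ _).1 (h j) d d.2

theorem theta_surj (n : ℕ) : Function.Surjective (theta n) := by
  intro w
  obtain ⟨g, hg⟩ : ∃ g : ℕ → R0, g = fun i => if h : i < n then ∑ d, (w ⟨i, h⟩ d : R0) else 0 := ⟨_, rfl⟩
  have hc : ∀ i, (∑ j ∈ Finset.range n, monomial j (g j)).coeff i = g i := by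
    intro i
    rw [finsetSum_coeff]
    simp only [coeff_monomial, Finset.sum_ite_eq', Finset.mem_range]
    split_ifs with h
    · rfl
    · rw [hg]; simp [h]
  have hK : (∑ j ∈ Finset.range n, monomial j (g j)) ∈ KK n := by
    intro i
    rw [hc, hg]
    dsimp only
    split_ifs with h
    · exact Ideal.sum_mem _ fun d _ => V_mem_AA (w ⟨i, h⟩ d).2
    · exact Ideal.zero_mem _
  refine ⟨⟨_, hK⟩, ?_⟩
  funext j d
  refine Subtype.ext ?_
  change MvPolynomial.homogeneousComponent d (Polynomial.coeff _ _) = _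
  rw [hc, hg]
  dsimp only
  rw [dif_pos j.2, map_sum, Finset.sum_eq_single d]
  · rw [MvPolynomial.homogeneousComponent_of_mem (mem_V.1 (w j d).2).1, if_pos rfl]
  · intro e _ he
    rw [MvPolynomial.homogeneousComponent_of_mem (mem_V.1 (w j e).2).1, if_neg]
    intro h
    exact he (Fin.ext h.symm)
  · simp

theorem finrank_WW (n : ℕ) : Module.finrank ℂ (WW n) = cc n := by
  rw [Module.finrank_pi_fintype]
  have : ∀ j : Fin n, Module.finrank ℂ ((d : Fin (18 * (n - j))) → V d (mv (n - j))) = c3 (n - j) := by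
    intro j
    rw [Module.finrank_pi_fintype, c3]
    exact Fin.sum_univ_eq_sum_range (fun d => hh (n - j) d) _
  rw [Finset.sum_congr rfl fun j _ => this j, cc, Fin.sum_univ_eq_sum_range (fun j => c3 (n - j)) n,
    ← Finset.sum_range_reflect]
  refine Finset.sum_congr rfl fun j hj => ?_
  rw [Finset.mem_range] at hj
  congr 1
  omega

theorem MM_residue (r : R0[X]) : ∃ c : ℂ, r - algebraMap ℂ R0[X] c ∈ MM := by
  refine ⟨MvPolynomial.coeff 0 (r.coeff 0), ?_⟩
  rw [MM, mem_extX, coeff_sub, Polynomial.algebraMap_apply, coeff_C_zero]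
  exact sub_C_mem_mm _

theorem mem_MM (f : R0[X]) : f ∈ MM ↔ MvPolynomial.constantCoeff (constantCoeff f) = 0 := by
  rw [MM, mem_extX, ← pow_one mm, mem_mm_pow]
  simp only [Nat.lt_one_iff, forall_eq, MvPolynomial.homogeneousComponent_zero]
  rw [constantCoeff_apply, MvPolynomial.constantCoeff_eq]
  exact MvPolynomial.C_eq_zero

theorem MM_eq_ker : MM = RingHom.ker (MvPolynomial.constantCoeff.comp constantCoeff : R0[X] →+* ℂ) := by
  ext f
  rw [mem_MM, RingHom.mem_ker, RingHom.comp_apply]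

instance : MM.IsMaximal := by
  rw [MM_eq_ker]
  refine RingHom.ker_isMaximal_of_surjective _ ?_
  intro c
  exact ⟨C (MvPolynomial.C c), by simp⟩

end Theta
section TheRing
open Polynomial

variable (SS : Type) [CommRing SS] [IsLocalRing SS] [Algebra R0[X] SS] [Algebra ℂ SS]
  [IsScalarTower ℂ R0[X] SS] [IsLocalization.AtPrime SS MM]

theorem length_SS (n : ℕ) (I K : Ideal SS) (hI : I = (J0.map (algebraMap R0[X] SS)) ^ n)
    (hK : K = (KK n).map (algebraMap R0[X] SS)) :
    Module.length SS (Submodule.map (Submodule.mkQ I) K) = (cc n : ℕ∞) := by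
  rw [← Ideal.map_pow] at hI
  subst hI hK
  rw [← finrank_WW]
  exact loc_length MM MM_residue (J0 ^ n) (KK n) (18 * n) (fun a ha f hf => MM_mul_KK ha hf) (WW n)
    (theta n) (theta_surj n) (theta_ker n)

theorem SS_div (n : ℕ) (z : SS) (h : algebraMap R0[X] SS (C (lin cg)) * z ∈ (KK n).map (algebraMap R0[X] SS)) :
    z ∈ (KK n).map (algebraMap R0[X] SS) := by
  obtain ⟨f, u, rfl⟩ := IsLocalization.exists_mk'_eq MM.primeCompl z
  rw [IsLocalization.mul_mk'_eq_mk'_of_mul, IsLocalization.mk'_mem_map_algebraMap_iff MM.primeCompl] at h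
  rw [IsLocalization.mk'_mem_map_algebraMap_iff MM.primeCompl]
  obtain ⟨v, hv, h⟩ := h
  refine ⟨v, hv, KK_div ?_⟩
  rw [mul_left_comm]
  exact h

end TheRing
end EpsIrr

namespace EpsIrr
section RegSeq
set_option linter.unusedSectionVars false
open Polynomial

theorem X_div {s : Set (Fin 3)} {k : Fin 3} (hk : k ∉ s) {f : R0}
    (h : MvPolynomial.X k * f ∈ Ideal.span (MvPolynomial.X '' s : Set R0)) :
    f ∈ Ideal.span (MvPolynomial.X '' s : Set R0) := by
  rw [MvPolynomial.mem_ideal_span_X_image] at h ⊢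
  intro m hm
  obtain ⟨i, hi, hmi⟩ := h (Finsupp.single k 1 + m) (by
    rw [MvPolynomial.mem_support_iff, MvPolynomial.coeff_X_mul]
    exact MvPolynomial.mem_support_iff.1 hm)
  refine ⟨i, hi, ?_⟩
  rw [Finsupp.add_apply, Finsupp.single_eq_of_ne, zero_add] at hmi
  · exact hmi
  · rintro rfl; exact hk hi

theorem CX_div {s : Set (Fin 3)} {k : Fin 3} (hk : k ∉ s) (f : R0[X])
    (h : C (MvPolynomial.X k) * f ∈ extX (Ideal.span (MvPolynomial.X '' s : Set R0))) :
    f ∈ extX (Ideal.span (MvPolynomial.X '' s : Set R0)) := by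
  rw [mem_extX] at h ⊢
  rw [coeff_C_mul] at h
  exact X_div hk h

theorem extX_span (s : Set (Fin 3)) : extX (Ideal.span (MvPolynomial.X '' s : Set R0)) =
    Ideal.span {f | f = X ∨ ∃ k ∈ s, C (MvPolynomial.X k) = f} := by
  rw [extX, Ideal.map_span, ← Ideal.span_union]
  congr 1
  ext f
  simp [or_comm]

/-- the regular system of parameters upstairs -/
noncomputable def rs0 : List R0[X] :=
  [X, C (MvPolynomial.X 0), C (MvPolynomial.X 1), C (MvPolynomial.X 2)]

theorem rs0_reg : RingTheory.Sequence.IsWeaklyRegular R0[X] rs0 := by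
  rw [RingTheory.Sequence.isWeaklyRegular_iff_Fin]
  intro i
  rw [isSMulRegular_quotient_iff_mem_of_smul_mem]
  simp only [smul_eq_mul, Ideal.mul_top]
  have key : ∀ (s : Set (Fin 3)) (k : Fin 3) (hk : k ∉ s) (l : List R0[X])
      (hl : ∀ f, f ∈ l ↔ f = X ∨ ∃ k ∈ s, C (MvPolynomial.X k) = f) (f : R0[X])
      (h : C (MvPolynomial.X k) * f ∈ Ideal.ofList l), f ∈ Ideal.ofList l := by
    intro s k hk l hl f h
    have : Ideal.ofList l = extX (Ideal.span (MvPolynomial.X '' s : Set R0)) := by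
      rw [extX_span, Ideal.ofList]
      congr 1
      ext f
      exact hl f
    rw [this] at h ⊢
    exact CX_div hk f h
  fin_cases i
  · intro f h
    simp [rs0] at h ⊢
    exact h
  · refine key ∅ 0 (by simp) _ ?_
    simp [rs0]
  · refine key {0} 1 (by simp) _ ?_
    simp [rs0, eq_comm]
  · refine key {0, 1} 2 (by simp) _ ?_
    simp [rs0, eq_comm]

theorem rs0_span : Ideal.ofList rs0 = MM := by
  have : mm = Ideal.span (MvPolynomial.X '' (Set.univ : Set (Fin 3)) : Set R0) := by
    rw [mm, MvPolynomial.idealOfVars, Set.image_univ]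
  rw [MM, this, extX_span, Ideal.ofList]
  congr 1
  ext f
  simp [rs0, Fin.exists_fin_succ, eq_comm]

variable (SS : Type) [CommRing SS] [IsLocalRing SS] [IsNoetherianRing SS] [Algebra R0[X] SS] [Algebra ℂ SS]
  [IsScalarTower ℂ R0[X] SS] [IsLocalization.AtPrime SS MM]

/-- the regular system of parameters -/
noncomputable def rsS : List SS := rs0.map (algebraMap R0[X] SS)

theorem rsS_regular : RingTheory.Sequence.IsRegular SS (rsS SS) :=
  rs0_reg.isRegular_of_isLocalization_of_mem SS MM (fun r hr => by
    rw [← rs0_span]; exact Ideal.subset_span hr)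

theorem rsS_span : Ideal.ofList (rsS SS) = IsLocalRing.maximalIdeal SS := by
  rw [rsS, ← Ideal.map_ofList, rs0_span]
  exact IsLocalization.AtPrime.map_eq_maximalIdeal MM SS

theorem SS_dim : ringKrullDim SS = 4 := by
  have h := ringKrullDim_add_length_eq_ringKrullDim_of_isRegular (rsS SS) (rsS_regular SS)
  rw [(rsS_span SS)] at h
  have h2 : ringKrullDim (SS ⧸ IsLocalRing.maximalIdeal SS) = 0 :=
    ringKrullDim_eq_zero_of_isField ((Ideal.Quotient.maximal_ideal_iff_isField_quotient _).1 inferInstance)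
  rw [h2, zero_add] at h
  rw [← h]
  simp [rsS, rs0]

theorem rs0_nodup : rs0.Nodup := by
  have h : ∀ a : R0, (X : R0[X]) ≠ C a := by
    intro a h
    have := congrArg (fun f => coeff f 1) h
    simp at this
  simp [rs0, MvPolynomial.X_inj, h]

theorem SS_inj : Function.Injective (algebraMap R0[X] SS) :=
  IsLocalization.injective _ MM.primeCompl_le_nonZeroDivisors

theorem SS_gens : ∃ s : Finset SS, s.card = 4 ∧
    Ideal.span (↑s : Set SS) = IsLocalRing.maximalIdeal SS := by
  classical
  refine ⟨(rsS SS).toFinset, ?_, ?_⟩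
  · rw [rsS, List.toFinset_card_of_nodup (rs0_nodup.map (SS_inj SS))]
    simp [rs0]
  · rw [← rsS_span SS, List.coe_toFinset, Ideal.ofList]

theorem main_length (n : ℕ) : moduleLength SS
    (extModule SS 4 (ModuleCat.of SS (SS ⧸ (J0.map (algebraMap R0[X] SS)) ^ n)) (ModuleCat.of SS SS)) =
        (cc n : WithBot ℕ∞) := by
  have hle : (J0.map (algebraMap R0[X] SS)) ^ n ≤ (KK n).map (algebraMap R0[X] SS) := by
    rw [← Ideal.map_pow]
    exact Ideal.map_mono (J0_le_KK n)
  have hx : algebraMap R0[X] SS (C (lin cg)) ∈ IsLocalRing.maximalIdeal SS := by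
    rw [← IsLocalization.AtPrime.map_eq_maximalIdeal MM SS]
    refine Ideal.mem_map_of_mem _ ?_
    rw [MM, mem_extX, coeff_C_zero]
    exact lin_mem_mm cg
  rw [ext_four_length (rsS SS) (rsS_regular SS).toIsWeaklyRegular (by simp [rsS, rs0]) (rsS_span SS) _ _ hle
    (by rw [← Module.length_ne_top_iff, length_SS SS n _ _ rfl rfl]; exact ENat.natCast_ne_top _) _ hx (SS_div SS n), length_SS SS n _ _ rfl rfl]
  rfl

/-- the counterexample -/
noncomputable def DD : RegularLocal4Data where
  S := Localization.AtPrime MM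
  dim4 := SS_dim _
  regular := SS_gens _
  J := J0.map (algebraMap R0[X] (Localization.AtPrime MM))

theorem final :
    ∃ D : RegularLocal4Data, ∃ c : ℕ → ℕ,
      (∀ n : ℕ, moduleLength D.S
          (extModule D.S 4 (ModuleCat.of D.S (D.S ⧸ D.J ^ n)) (ModuleCat.of D.S D.S)) =
        (c n : WithBot ℕ∞)) ∧
      ∃ L : ℝ,
        Filter.Tendsto (fun n : ℕ => (c n : ℝ) / (n : ℝ) ^ 4) Filter.atTop (nhds L) ∧
        Irrational L ∧
        ¬ (∃ q : Polynomial ℚ, ∃ N : ℕ, ∀ n : ℕ, N ≤ n → (c n : ℚ) = q.eval (n : ℚ)) ∧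
        ¬ (∃ p : ℕ, 0 < p ∧ ∃ q : ℕ → Polynomial ℚ, ∃ N : ℕ,
            ∀ n : ℕ, N ≤ n → (c n : ℚ) = (q (n % p)).eval (n : ℚ)) := by
  refine ⟨DD, cc, fun n => main_length (Localization.AtPrime MM) n, L3 / 4, cc_tendsto, L_irr, ?_, ?_⟩
  · rintro ⟨q, N, h⟩
    exact not_quasi cc _ L_irr cc_tendsto 1 one_pos q N fun n hn _ => h n hn
  · rintro ⟨p, hp, q, N, h⟩
    refine not_quasi cc _ L_irr cc_tendsto p hp (q 0) N fun n hn h0 => ?_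
    rw [h n hn, h0]

end RegSeq
end EpsIrr

theorem statement7 :
    ∃ D : RegularLocal4Data, ∃ c : ℕ → ℕ,
      -- `c n = λ(Ext^4_S(S/Jⁿ, S))` (in particular these lengths are finite)
      (∀ n : ℕ, moduleLength D.S
          (extModule D.S 4 (ModuleCat.of D.S (D.S ⧸ D.J ^ n)) (ModuleCat.of D.S D.S)) =
        (c n : WithBot ℕ∞)) ∧
      ∃ L : ℝ,
        Tendsto (fun n : ℕ => (c n : ℝ) / (n : ℝ) ^ 4) atTop (nhds L) ∧
        Irrational L ∧
        -- `c` is not eventually a polynomial in `n`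
        ¬ (∃ q : Polynomial ℚ, ∃ N : ℕ, ∀ n : ℕ, N ≤ n → (c n : ℚ) = q.eval (n : ℚ)) ∧
        -- `c` is not eventually a quasi-polynomial in `n`
        ¬ (∃ p : ℕ, 0 < p ∧ ∃ q : ℕ → Polynomial ℚ, ∃ N : ℕ,
            ∀ n : ℕ, N ≤ n → (c n : ℚ) = (q (n % p)).eval (n : ℚ)) := by
  exact EpsIrr.final
end

section
/- Let R be the quotient of a polynomial ring over a field by a homogeneous prime ideal, m its maximal homogeneous ideal, d = dim R, and assume depth(R_m) ≥ 2. Let I ⊆ R be a homogeneous ideal of height less than d whose analytic spread ℓ(I) is less than d. Then H^0_m(R/\overline{I^n}) = 0 for all sufficiently large n, where \overline{I^n} denotes the integral closure of I^n. -/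
/-!
STATEMENT 11: Let `R` be the quotient of a polynomial ring over a field by a homogeneous prime
ideal, `m` its maximal homogeneous ideal, `d = dim R`, and assume `depth(R_m) ≥ 2`.  Let
`I ⊆ R` be a homogeneous ideal of height less than `d` whose analytic spread `ℓ(I)` is less
than `d`.  Then `H⁰_m(R/\overline{Iⁿ}) = 0` for all sufficiently large `n`, where
`\overline{Iⁿ}` is the integral closure of `Iⁿ`.

`R` is modelled as a finitely generated standard ℕ-graded algebra domain over a field `k`;
`m` is the irrelevant ideal; `depth(R_m) ≥ 2` is a length-two regular sequence inside `m`;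
the analytic spread is the Krull dimension of the fiber cone `R[It] ⊗_R R/m`; the integral
closure of an ideal `N` consists of the elements satisfying an equation of integral dependence
`x^n + a₁x^{n-1} + ⋯ + aₙ = 0` with `aᵢ ∈ N^i`.  The conclusion is stated for any ideal `K`
whose members are exactly the elements integral over `Iⁿ`.
-/

/-- The zeroth local cohomology module `H⁰_J(M) = {x ∈ M | ∃ n, Jⁿ • x = 0}`. -/
noncomputable def H0 {R M : Type*} [CommRing R] [AddCommGroup M] [Module R M]
    (J : Ideal R) : Submodule R M :=
  ⨆ n : ℕ, Submodule.torsionBySet R M (J ^ n : Ideal R)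

/-- Height of an ideal: the infimum of the heights of the primes containing it. -/
noncomputable def idealHeight {R : Type*} [CommRing R] (I : Ideal R) : ℕ∞ :=
  ⨅ (p : PrimeSpectrum R) (_ : I ≤ p.asIdeal), Order.height p

/-- `x` is integral over the ideal `N`: it satisfies an equation
`x^n + a₁ x^{n-1} + ⋯ + aₙ = 0` with `aᵢ ∈ N^i`. -/
def IsIntegralOverIdeal {R : Type*} [CommRing R] (N : Ideal R) (x : R) : Prop :=
  ∃ n : ℕ, 0 < n ∧ ∃ a : ℕ → R, (∀ i, 1 ≤ i → i ≤ n → a i ∈ N ^ i) ∧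
    x ^ n + ∑ i ∈ Finset.Icc 1 n, a i * x ^ (n - i) = 0

/-- The analytic spread `ℓ(I)`: the Krull dimension of the fiber cone
`R[It] ⊗_R R/m = R[It]/m·R[It]`. -/
noncomputable def analyticSpread {R : Type*} [CommRing R] (I m : Ideal R) :
    WithBot (WithTop ℕ) :=
  ringKrullDim (↥(reesAlgebra I) ⧸ Ideal.map (algebraMap R ↥(reesAlgebra I)) m)


theorem aux_krullDim_le {α β : Type*} [PartialOrder α] [PartialOrder β] (f : β → α)
    (hs : Function.Surjective f)
    (hg : ∀ b a, f b ≤ a → ∃ b', b ≤ b' ∧ f b' = a) :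
    Order.krullDim α ≤ Order.krullDim β := by
  have key : ∀ p : LTSeries α, ∃ q : LTSeries β, q.length = p.length ∧ f q.last = p.last := by
    intro p
    induction p using RelSeries.inductionOn' with
    | singleton x =>
      obtain ⟨b, hb⟩ := hs x
      exact ⟨RelSeries.singleton _ b, rfl, by simpa using hb⟩
    | snoc p x hx ih =>
      obtain ⟨q, hq, hl⟩ := ih
      have hlt : p.last < x := hx
      obtain ⟨b', hb, hb'⟩ := hg q.last x (hl ▸ hlt.le)
      have hlt' : q.last < b' := by
        refine lt_of_le_of_ne hb ?_
        intro h
        rw [h, hb'] at hl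
        exact hlt.ne' hl
      exact ⟨RelSeries.snoc q b' hlt', by simp [hq], by simpa using hb'⟩
  refine iSup_le fun p => ?_
  obtain ⟨q, hq, -⟩ := key p
  rw [← hq]
  exact le_iSup (fun p : LTSeries β => (p.length : WithBot ℕ∞)) q

theorem aux_dim_le_of_integral {A B : Type*} [CommRing A] [CommRing B] (f : A →+* B)
    (hf : Function.Injective f) (hi : f.IsIntegral) : ringKrullDim A ≤ ringKrullDim B := by
  let _ := f.toAlgebra
  have : Algebra.IsIntegral A B := ⟨hi⟩
  have hk : RingHom.ker (algebraMap A B) = ⊥ := (RingHom.injective_iff_ker_eq_bot _).1 hf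
  refine aux_krullDim_le (PrimeSpectrum.comap (algebraMap A B)) ?_ ?_
  · intro P
    obtain ⟨Q, -, hQ, h⟩ := Ideal.exists_ideal_over_prime_of_isIntegral P.asIdeal (⊥ : Ideal B)
      (by rw [← RingHom.ker_eq_comap_bot, hk]; exact bot_le)
    exact ⟨⟨Q, hQ⟩, PrimeSpectrum.ext h⟩
  · intro Q P h
    obtain ⟨Q', h1, hQ, h⟩ := Ideal.exists_ideal_over_prime_of_isIntegral P.asIdeal Q.asIdeal h
    exact ⟨⟨Q', hQ⟩, h1, PrimeSpectrum.ext h⟩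

theorem aux_dim_ge_of_integral {A B : Type*} [CommRing A] [CommRing B] (f : A →+* B)
    (hi : f.IsIntegral) : ringKrullDim B ≤ ringKrullDim A := by
  let _ := f.toAlgebra
  have : Algebra.IsIntegral A B := ⟨hi⟩
  refine Order.krullDim_le_of_strictMono (PrimeSpectrum.comap (algebraMap A B)) ?_
  intro P Q h
  exact Ideal.IsIntegral.comap_lt_comap (R := A) (I := P.asIdeal) (J := Q.asIdeal) h

/-- Dimension of an affine domain is its transcendence degree. -/
theorem aux_dim_trdeg (k D : Type) [Field k] [CommRing D] [IsDomain D] [Algebra k D]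
    [Algebra.FiniteType k D] :
    ∃ (s : ℕ) (g : MvPolynomial (Fin s) k →ₐ[k] D), Function.Injective g ∧ g.IsIntegral ∧
      ringKrullDim D = s ∧ Algebra.trdeg k D = s := by
  obtain ⟨s, g, hg, hi⟩ := exists_integral_inj_algHom_of_fg k D
  have hP : ringKrullDim (MvPolynomial (Fin s) k) = s := by
    rw [MvPolynomial.ringKrullDim_of_isNoetherianRing]; simp
  refine ⟨s, g, hg, hi, ?_, ?_⟩
  · rw [← hP]
    exact le_antisymm (aux_dim_ge_of_integral g.toRingHom hi)
      (aux_dim_le_of_integral g.toRingHom hg hi)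
  · algebraize [g.toRingHom]
    have : Algebra.IsIntegral (MvPolynomial (Fin s) k) D := ⟨hi⟩
    have : FaithfulSMul (MvPolynomial (Fin s) k) D :=
      (faithfulSMul_iff_algebraMap_injective _ _).2 hg
    rw [← trdeg_add_eq k (MvPolynomial (Fin s) k) (A := D), MvPolynomial.trdeg_of_isDomain,
      trdeg_eq_zero]
    simp

theorem aux_hypersurface (k : Type) [Field k] (e : ℕ) (p : MvPolynomial (Fin (e + 1)) k)
    (hp : Prime p) :
    (e : WithBot ℕ∞) ≤ ringKrullDim (MvPolynomial (Fin (e + 1)) k ⧸ Ideal.span {p}) := by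
  have : (Ideal.span {p}).IsPrime := (Ideal.span_singleton_prime hp.ne_zero).2 hp
  obtain ⟨s, -, -, -, hs, ht⟩ := aux_dim_trdeg k (MvPolynomial (Fin (e + 1)) k ⧸ Ideal.span {p})
  rw [hs]
  obtain ⟨i, hi⟩ : ∃ i, p.degreeOf i ≠ 0 := by
    by_contra! h
    have : p.vars = ∅ := by
      ext i; simp [MvPolynomial.mem_vars_iff_degreeOf_ne_zero, h i]
    rw [MvPolynomial.vars_eq_empty_iff_eq_C] at this
    apply hp.not_isUnit
    rw [this]
    refine IsUnit.map MvPolynomial.C (IsUnit.mk0 _ ?_)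
    intro h0
    rw [h0] at this
    exact hp.ne_zero (by simpa using this)
  let x : {j : Fin (e + 1) // j ≠ i} → MvPolynomial (Fin (e + 1)) k ⧸ Ideal.span {p} :=
    fun j => Ideal.Quotient.mk _ (MvPolynomial.X j.1)
  have hx : AlgebraicIndependent k x := by
    rw [algebraicIndependent_iff]
    intro f hf
    have h1 : MvPolynomial.aeval x f
        = Ideal.Quotient.mkₐ k (Ideal.span {p}) (MvPolynomial.rename Subtype.val f) := by
      have h2 : MvPolynomial.aeval x = (Ideal.Quotient.mkₐ k (Ideal.span {p})).comp
          (MvPolynomial.rename Subtype.val) := by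
        ext j
        simp [x]
      rw [h2, AlgHom.comp_apply]
    rw [h1, Ideal.Quotient.mkₐ_eq_mk, Ideal.Quotient.eq_zero_iff_mem,
      Ideal.mem_span_singleton] at hf
    obtain ⟨r, hr⟩ := hf
    by_contra hf0
    have hne : MvPolynomial.rename (Subtype.val : {j : Fin (e + 1) // j ≠ i} → _) f ≠ 0 := by
      intro h
      exact hf0 (MvPolynomial.rename_injective _ Subtype.val_injective (by simpa using h))
    have hr0 : r ≠ 0 := by rintro rfl; simp at hr; exact hf0 hr
    have hdeg := congrArg (MvPolynomial.degreeOf i) hr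
    rw [MvPolynomial.degreeOf_mul_eq hp.ne_zero hr0] at hdeg
    have : i ∉ (MvPolynomial.rename (Subtype.val : {j : Fin (e + 1) // j ≠ i} → _) f).vars := by
      intro h
      obtain ⟨j, -, hj⟩ := MvPolynomial.mem_vars_rename _ _ h
      exact j.2 hj
    rw [MvPolynomial.mem_vars_iff_degreeOf_ne_zero, not_not] at this
    omega
  have := hx.cardinalMk_le_trdeg
  rw [ht] at this
  simp at this
  exact_mod_cast this

theorem aux_normal {P L : Type*} [CommRing P] [IsDomain P] [UniqueFactorizationMonoid P]
    [Field L] [Algebra P L] [FaithfulSMul P L] (y : L) (c : Ideal P)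
    (hc : ∀ p : P, Prime p → ∃ a ∈ c, ¬ p ∣ a) (hc0 : ∃ a ∈ c, a ≠ 0)
    (s : ℕ) (hy : ∀ a ∈ c, IsIntegral P ((a ^ s) • y)) : IsIntegral P y := by
  let F := FractionRing P
  let _ : Algebra F L := FractionRing.liftAlgebra _ _
  have hyF : IsIntegral F y := by
    obtain ⟨a, ha, ha0⟩ := hc0
    have h1 : IsIntegral F ((a ^ s) • y) := (hy a ha).tower_top
    have h2 := h1.smul ((algebraMap P F (a ^ s))⁻¹)
    rw [← algebraMap_smul F (a ^ s) y, smul_smul, inv_mul_cancel₀, one_smul] at h2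
    · exact h2
    · simpa using fun h => absurd h ha0
  have hcoef : ∀ i, ∀ a ∈ c, a ≠ 0 → ∃ b : P, algebraMap P F b =
      (minpoly F y).coeff i * algebraMap P F (a ^ s) ^ ((minpoly F y).natDegree - i) := by
    intro i a ha ha0
    have h1 := IsIntegrallyClosed.minpoly_smul (R := F) (S := L) (r := algebraMap P F (a ^ s))
      (by simpa using fun h => absurd h ha0) hyF
    rw [algebraMap_smul, minpoly.isIntegrallyClosed_eq_field_fractions' F (hy a ha)] at h1
    refine ⟨(minpoly P (a ^ s • y)).coeff i, ?_⟩
    rw [← Polynomial.coeff_scaleRoots, ← h1, Polynomial.coeff_map]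
  have hint : ∀ i, ∃ b : P, algebraMap P F b = (minpoly F y).coeff i := by
    intro i
    set z := (minpoly F y).coeff i with hz
    suffices h : IsUnit (IsFractionRing.den P z : P) from IsFractionRing.isInteger_of_isUnit_den h
    by_contra hu
    obtain ⟨p, hp, hpd⟩ := WfDvdMonoid.exists_irreducible_factor hu
      (nonZeroDivisors.coe_ne_zero _)
    have hpp := hp.prime
    obtain ⟨a, ha, hpa⟩ := hc p hpp
    obtain ⟨b, hb⟩ := hcoef i a ha (by rintro rfl; simp at hpa)
    rw [← hz, ← IsFractionRing.mk'_num_den' P z] at hb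
    have hd0 : algebraMap P F (IsFractionRing.den P z) ≠ 0 := by
      simp
    have h3 : b * IsFractionRing.den P z
        = IsFractionRing.num P z * (a ^ s) ^ ((minpoly F y).natDegree - i) := by
      apply FaithfulSMul.algebraMap_injective P F
      simp only [map_mul, map_pow] at hb ⊢
      rw [hb, mul_right_comm, div_mul_cancel₀ _ hd0]
    have h4 : p ∣ IsFractionRing.num P z * (a ^ s) ^ ((minpoly F y).natDegree - i) :=
      h3 ▸ hpd.mul_left b
    rcases hpp.dvd_or_dvd h4 with h | h
    · exact hp.not_isUnit (IsFractionRing.num_den_reduced P z h hpd)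
    · exact hpa (hpp.dvd_of_dvd_pow (hpp.dvd_of_dvd_pow h))
  have hl : minpoly F y ∈ Polynomial.lifts (algebraMap P F) := by
    rw [Polynomial.lifts_iff_coeff_lifts]
    exact hint
  obtain ⟨q, hq, -, hqm⟩ := Polynomial.lifts_and_natDegree_eq_and_monic hl (minpoly.monic hyF)
  refine ⟨q, hqm, ?_⟩
  rw [← Polynomial.aeval_def, ← Polynomial.aeval_map_algebraMap F, hq, minpoly.aeval]

theorem aux_main (k S T : Type) [Field k] [CommRing S] [IsDomain S] [Algebra k S]
    [Algebra.FiniteType k S] [CommRing T] [IsDomain T] [Algebra S T] [FaithfulSMul S T]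
    (d : ℕ) (hd : ((d + 1 : ℕ) : Cardinal) ≤ Algebra.trdeg k S) (J : Ideal S)
    (hJ : ringKrullDim (S ⧸ J) < (d : WithBot ℕ∞)) (y : T) (s : ℕ)
    (hy : ∀ b ∈ J ^ s, IsIntegral S (b • y)) : IsIntegral S y := by
  obtain ⟨e', g, hg, hgi, -, ht⟩ := aux_dim_trdeg k S
  rw [ht] at hd
  have hd' : d + 1 ≤ e' := by exact_mod_cast hd
  obtain ⟨e, rfl⟩ : ∃ e, e' = e + 1 := ⟨e' - 1, by omega⟩
  let L := FractionRing T
  let P := MvPolynomial (Fin (e + 1)) k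
  let _ : Algebra P S := g.toRingHom.toAlgebra
  have hPS : Algebra.IsIntegral P S := ⟨hgi⟩
  let _ : Algebra P L := ((algebraMap S L).comp (algebraMap P S)).toAlgebra
  have : IsScalarTower P S L := IsScalarTower.of_algebraMap_eq' rfl
  have hSL : Function.Injective (algebraMap S L) := by
    rw [IsScalarTower.algebraMap_eq S T L]
    exact (IsFractionRing.injective T L).comp (FaithfulSMul.algebraMap_injective S T)
  have : FaithfulSMul P L := (faithfulSMul_iff_algebraMap_injective _ _).2 (hSL.comp hg)
  have hc : ∀ p : P, Prime p → ∃ a ∈ J.comap (algebraMap P S), ¬ p ∣ a := by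
    intro p hp
    by_contra! h
    have hle : J.comap (algebraMap P S) ≤ Ideal.span {p} := fun a ha =>
      Ideal.mem_span_singleton.2 (h a ha)
    have h1 : ringKrullDim (P ⧸ Ideal.span {p}) ≤ ringKrullDim (P ⧸ J.comap (algebraMap P S)) :=
      ringKrullDim_le_of_surjective (Ideal.Quotient.factor hle) (Ideal.Quotient.factor_surjective hle)
    have h2 : ringKrullDim (P ⧸ J.comap (algebraMap P S)) ≤ ringKrullDim (S ⧸ J) :=
      aux_dim_le_of_integral (Ideal.quotientMap J (algebraMap P S) le_rfl)
        Ideal.quotientMap_injective (RingHom.IsIntegral.quotient _ hgi)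
    have h3 := aux_hypersurface k e p hp
    have h4 : (e : WithBot ℕ∞) < d := (h3.trans (h1.trans h2)).trans_lt hJ
    have h5 : e < d := by exact_mod_cast h4
    omega
  have hX : Prime (MvPolynomial.X 0 : P) := MvPolynomial.X_prime
  have hyL : IsIntegral P (algebraMap T L y) := by
    refine aux_normal (algebraMap T L y) (J.comap (algebraMap P S)) hc ?_ s ?_
    · obtain ⟨a, ha, h⟩ := hc _ hX
      exact ⟨a, ha, by rintro rfl; simp at h⟩
    · intro a ha
      have h1 := hy ((algebraMap P S a) ^ s) (Ideal.pow_mem_pow (Ideal.mem_comap.1 ha) s)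
      have h2 := h1.algebraMap (B := L)
      rw [Algebra.smul_def, map_mul, ← IsScalarTower.algebraMap_apply, ← Algebra.smul_def,
        ← map_pow, algebraMap_smul] at h2
      exact isIntegral_trans (R := P) (A := S) _ h2
  have h3 : IsIntegral S (algebraMap T L y) := hyL.tower_top
  exact (isIntegral_algebraMap_iff (IsFractionRing.injective T L)).1 h3

open Polynomial in
theorem aux_rees_of {R : Type} [CommRing R] (I : Ideal R) (n : ℕ) (x : R)
    (h : IsIntegralOverIdeal (I ^ n) x) : IsIntegral (reesAlgebra I) (monomial n x) := by
  obtain ⟨r, hr, a, ha, he⟩ := h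
  classical
  let b : ℕ → reesAlgebra I := fun i =>
    if hi : a i ∈ (I ^ n) ^ i then
      ⟨monomial (n * i) (a i), reesAlgebra.monomial_mem.2 (by rwa [pow_mul])⟩ else 0
  have hb : ∀ i ∈ Finset.Icc 1 r, (algebraMap (reesAlgebra I) R[X] (b i)) = monomial (n * i) (a i) := by
    intro i hi
    rw [Finset.mem_Icc] at hi
    simp only [b, dif_pos (ha i hi.1 hi.2)]
    rfl
  refine ⟨X ^ r + ∑ i ∈ Finset.Icc 1 r, C (b i) * X ^ (r - i), ?_, ?_⟩
  · refine monic_X_pow_add ?_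
    refine (degree_sum_le _ _).trans_lt ?_
    rw [Finset.sup_lt_iff (by exact_mod_cast WithBot.bot_lt_coe r)]
    intro i hi
    rw [Finset.mem_Icc] at hi
    refine (degree_C_mul_X_pow_le _ _).trans_lt ?_
    exact_mod_cast (by omega : r - i < r)
  · rw [eval₂_add, eval₂_X_pow, eval₂_finsetSum]
    have h1 : ∀ i ∈ Finset.Icc 1 r,
        eval₂ (algebraMap (reesAlgebra I) R[X]) (monomial n x) (C (b i) * X ^ (r - i))
          = monomial (n * r) (a i * x ^ (r - i)) := by
      intro i hi
      rw [eval₂_mul, eval₂_C, eval₂_X_pow, hb i hi, monomial_pow, monomial_mul_monomial,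
        ← mul_add]
      rw [Finset.mem_Icc] at hi
      rw [Nat.add_sub_cancel' hi.2]
    rw [Finset.sum_congr rfl h1, monomial_pow, ← map_sum, ← map_add, he, map_zero]

open Polynomial in
theorem aux_of_rees {R : Type} [CommRing R] [Nontrivial R] (I : Ideal R) (n : ℕ) (x : R)
    (h : IsIntegral (reesAlgebra I) (monomial n x)) : IsIntegralOverIdeal (I ^ n) x := by
  obtain ⟨q, hq, he⟩ := h
  -- make the degree positive
  obtain ⟨q, hq, hpos, he⟩ : ∃ q : (reesAlgebra I)[X], q.Monic ∧ 0 < q.natDegree ∧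
      eval₂ (algebraMap (reesAlgebra I) R[X]) (monomial n x) q = 0 := by
    refine ⟨q * X, hq.mul monic_X, ?_, ?_⟩
    · rw [natDegree_mul_X hq.ne_zero]; omega
    · rw [eval₂_mul, he, zero_mul]
  set r := q.natDegree with hr
  refine ⟨r, hpos, fun i => ((q.coeff (r - i) : reesAlgebra I) : R[X]).coeff (n * i), ?_, ?_⟩
  · intro i _ _
    rw [← pow_mul]
    exact (q.coeff (r - i)).2 _
  · rw [eval₂_eq_sum_range, ← hr] at he
    have h1 := congrArg (fun f : R[X] => f.coeff (n * r)) he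
    simp only [finsetSum_coeff, coeff_zero] at h1
    have h2 : ∀ j ∈ Finset.range (r + 1),
        ((algebraMap (reesAlgebra I) R[X]) (q.coeff j) * monomial n x ^ j).coeff (n * r)
          = ((q.coeff j : reesAlgebra I) : R[X]).coeff (n * (r - j)) * x ^ j := by
      intro j hj
      have hj' : j ≤ r := by simpa [Nat.lt_succ_iff] using hj
      rw [monomial_pow]
      have h3 : n * r = n * (r - j) + n * j := by rw [← mul_add]; congr 1; omega
      rw [h3, coeff_mul_monomial]
      rfl
    rw [Finset.sum_congr rfl h2, Finset.sum_range_succ, add_comm] at h1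
    have hlead : q.coeff r = 1 := hq.coeff_natDegree
    rw [hlead] at h1
    have h5 : ((1 : reesAlgebra I) : R[X]).coeff (n * (r - r)) * x ^ r = x ^ r := by simp
    rw [h5] at h1
    rw [← h1]
    congr 1
    refine Finset.sum_bij' (fun i _ => r - i) (fun j _ => r - j) ?_ ?_ ?_ ?_ ?_
    · intro i hi; simp at hi ⊢; omega
    · intro i hi; simp at hi ⊢; omega
    · intro i hi; simp at hi ⊢; omega
    · intro i hi; simp at hi ⊢; omega
    · intro i hi
      simp only [Finset.mem_Icc] at hi
      have : r - (r - i) = i := by omega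
      rw [this]

open Polynomial in
theorem aux_key (k R : Type) [Field k] [CommRing R] [IsDomain R] [Algebra k R]
    [Algebra.FiniteType k R] (m I : Ideal R) (d : ℕ) (hd : ringKrullDim R = d) (hI : I ≠ ⊥)
    (hspread : analyticSpread I m < (d : WithBot (WithTop ℕ))) (n s : ℕ) (x : R)
    (hx : ∀ a ∈ m ^ s, IsIntegralOverIdeal (I ^ n) (a * x)) : IsIntegralOverIdeal (I ^ n) x := by
  have hN : IsNoetherianRing R := Algebra.FiniteType.isNoetherianRing k R
  apply aux_of_rees
  have hft : Algebra.FiniteType k (reesAlgebra I) := Algebra.FiniteType.trans (S := R) ‹_› inferInstance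
  obtain ⟨s', -, -, -, h1, h2⟩ := aux_dim_trdeg k R
  have hs' : s' = d := by rw [hd] at h1; exact_mod_cast h1.symm
  subst hs'
  have hfR : FaithfulSMul R (reesAlgebra I) := by
    rw [faithfulSMul_iff_algebraMap_injective]
    intro a b hab
    exact C_injective (congrArg Subtype.val hab)
  refine aux_main k (reesAlgebra I) R[X] s' ?_ (m.map (algebraMap R (reesAlgebra I)))
    hspread _ s ?_
  · rw [← trdeg_add_eq k R (A := reesAlgebra I), h2]
    obtain ⟨g, hg, hg0⟩ := Submodule.exists_mem_ne_zero_of_ne_bot hI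
    have ht : Algebra.Transcendental R (reesAlgebra I) := by
      refine ⟨⟨monomial 1 g, reesAlgebra.monomial_mem.2 (by simpa using hg)⟩, ?_⟩
      intro ha
      have hb := ha.algebraMap (A := R[X])
      change IsAlgebraic R (monomial 1 g : R[X]) at hb
      rw [← C_mul_X_eq_monomial] at hb
      rw [← smul_eq_C_mul] at hb
      exact transcendental_X R (hb.of_smul (mem_nonZeroDivisors_of_ne_zero hg0))
    have h3 : 1 ≤ Algebra.trdeg R (reesAlgebra I) := Cardinal.one_le_iff_pos.2 (trdeg_pos R _)
    push_cast
    gcongr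
  · intro b hb
    rw [← Ideal.map_pow] at hb
    have hcl : ∀ a ∈ m ^ s, IsIntegral (reesAlgebra I) (monomial n (a * x)) := fun a ha =>
      aux_rees_of I n _ (hx a ha)
    induction hb using Submodule.span_induction with
    | mem b hb =>
      obtain ⟨a, ha, rfl⟩ := hb
      have := hcl a ha
      rw [algebraMap_smul, smul_monomial, smul_eq_mul]
      exact this
    | zero => rw [zero_smul]; exact isIntegral_zero
    | add b c _ _ hb hc => rw [add_smul]; exact hb.add hc
    | smul r b _ hb => rw [smul_eq_mul, mul_smul]; exact hb.smul r

theorem statement11 (k : Type) [Field k]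
    (R : Type) [CommRing R] [IsDomain R] [Algebra k R]
    (𝒜 : ℕ → Submodule k R) [GradedAlgebra 𝒜]
    -- `R` is a quotient of a polynomial ring by a homogeneous prime ideal
    (hFG : Algebra.FiniteType k R)
    (hstd : Algebra.adjoin k (𝒜 1 : Set R) = ⊤)
    (m : Ideal R) (hm : m = (HomogeneousIdeal.irrelevant 𝒜).toIdeal)
    (d : ℕ) (hd : ringKrullDim R = d)
    -- `depth (R_m) ≥ 2`
    (hdepth : ∃ a b : R, a ∈ m ∧ b ∈ m ∧ RingTheory.Sequence.IsRegular R [a, b])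
    -- a homogeneous ideal of height `< d` and analytic spread `< d`
    (I : Ideal R) (hI : I.IsHomogeneous 𝒜)
    (hht : idealHeight I < (d : ℕ∞))
    (hspread : analyticSpread I m < (d : WithBot (WithTop ℕ))) :
    ∃ N : ℕ, ∀ n : ℕ, N ≤ n →
      ∀ K : Ideal R, (∀ x : R, x ∈ K ↔ IsIntegralOverIdeal (I ^ n) x) →
        H0 (M := R ⧸ K) m = ⊥ := by
  obtain ⟨a, b, ha, -, hreg⟩ := hdepth
  have ha0 : a ≠ 0 := by
    rintro rfl
    have h := hreg.toIsWeaklyRegular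
    rw [RingTheory.Sequence.isWeaklyRegular_cons_iff] at h
    exact one_ne_zero (h.1 (show (0 : R) • (1 : R) = (0 : R) • (0 : R) by simp))
  refine ⟨1, fun n hn K hK => ?_⟩
  rw [eq_bot_iff]
  intro z hz
  have hdir : Directed (· ≤ ·) fun n : ℕ =>
      Submodule.torsionBySet R (R ⧸ K) ((m ^ n : Ideal R) : Set R) := by
    refine Monotone.directed_le fun i j hij => ?_
    exact Submodule.torsionBySet_le_torsionBySet_of_subset (Ideal.pow_le_pow_right hij)
  obtain ⟨s, hs⟩ := (Submodule.mem_iSup_of_directed _ hdir).1 hz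
  obtain ⟨x, rfl⟩ := Ideal.Quotient.mk_surjective z
  have hx : ∀ a ∈ m ^ s, a * x ∈ K := by
    intro a ha
    rw [Submodule.mem_torsionBySet_iff] at hs
    have := hs ⟨a, ha⟩
    rw [← Ideal.Quotient.eq_zero_iff_mem]
    exact this
  rw [Submodule.mem_bot, Ideal.Quotient.eq_zero_iff_mem]
  by_cases hI0 : I = ⊥
  · have h1 : a ^ s * x ∈ K := hx _ (Ideal.pow_mem_pow ha s)
    have h2 : ∀ y ∈ K, y = 0 := by
      intro y hy
      obtain ⟨r, hr, c, hc, he⟩ := (hK y).1 hy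
      have h3 : ∑ i ∈ Finset.Icc 1 r, c i * y ^ (r - i) = 0 := by
        refine Finset.sum_eq_zero fun i hi => ?_
        rw [Finset.mem_Icc] at hi
        have h4 := hc i hi.1 hi.2
        rw [hI0, ← Ideal.zero_eq_bot, zero_pow (by omega), zero_pow (by omega)] at h4
        have h5 : c i = 0 := by simpa using h4
        rw [h5, zero_mul]
      rw [h3, add_zero] at he
      exact pow_eq_zero_iff (by omega) |>.1 he
    have h6 : x = 0 := (mul_eq_zero.1 (h2 _ h1)).resolve_left (pow_ne_zero _ ha0)
    rw [h6]; exact K.zero_mem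
  · rw [hK]
    exact aux_key k R m I d hd hI0 hspread n s x fun a ha => (hK _).1 (hx a ha)
end
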